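/- Let K be a finite extension of ℚ_p. The multiplicative group K^× is isomorphic to the fibre product G_K^{ab} ×_{G_K^{unr}} Frob^ℤ, where G_K^{unr} = G_K^{ab}/I_K is the unramified quotient (I_K the inertia subgroup), Frob^ℤ is the dense discrete subgroup of G_K^{unr} generated by the Frobenius, and the map G_K^{ab} → G_K^{unr} is the natural projection. -/

import Mathlib

noncomputable section

open IntermediateField

variable (p : ℕ) [Fact p.Prime] (K : Type*) [Field K]
  [Algebra ℚ_[p] K] [FiniteDimensional ℚ_[p] K]

/-- The absolute Galois group of `K`, with the Krull topology. -/
abbrev AbsGal := AlgebraicClosure K ≃ₐ[K] AlgebraicClosure K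

/-- The maximal unramified extension of `K` inside a fixed algebraic closure, i.e. the
extension generated by all roots of unity of order prime to `p`. -/
def maxUnramified : IntermediateField K (AlgebraicClosure K) :=
  adjoin K {x : AlgebraicClosure K | ∃ n : ℕ, 0 < n ∧ ¬ p ∣ n ∧ x ^ n = 1}

/-- `G_K^{ab}`: the topological abelianization of the absolute Galois group. -/
abbrev GabK := TopologicalAbelianization (AbsGal K)

/-- The inertia subgroup of `G_K^{ab}`: the image in `G_K^{ab}` of the subgroup of `G_K`
fixing the maximal unramified extension of `K`. -/
def inertiaAb : Subgroup (GabK K) :=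
  ((maxUnramified p K).fixingSubgroup).map
    (QuotientGroup.mk' ((commutator (AbsGal K)).topologicalClosure))

/-- The unramified quotient `G_K^{unr} = G_K^{ab}/I_K`. -/
abbrev GunrK := GabK K ⧸ inertiaAb p K

/-- The fibre product `G_K^{ab} ×_{G_K^{unr}} φ^ℤ`, for an element `φ` of `G_K^{unr}`:
pairs `(a, n)` with `a` mapping to `φ ^ n` in `G_K^{unr}`. -/
def fibreProd (φ : GunrK p K) : Subgroup (GabK K × Multiplicative ℤ) where
  carrier := {x | (QuotientGroup.mk x.1 : GunrK p K) = φ ^ (Multiplicative.toAdd x.2)}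
  one_mem' := by simp
  mul_mem' := by
    intro a b ha hb
    have ha' : (QuotientGroup.mk a.1 : GunrK p K) = φ ^ (Multiplicative.toAdd a.2) := ha
    have hb' : (QuotientGroup.mk b.1 : GunrK p K) = φ ^ (Multiplicative.toAdd b.2) := hb
    show (QuotientGroup.mk (a.1 * b.1) : GunrK p K)
        = φ ^ (Multiplicative.toAdd (a.2 * b.2))
    rw [QuotientGroup.mk_mul, ha', hb', toAdd_mul, zpow_add]
  inv_mem' := by
    intro a ha
    have ha' : (QuotientGroup.mk a.1 : GunrK p K) = φ ^ (Multiplicative.toAdd a.2) := ha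
    show (QuotientGroup.mk (a.1⁻¹) : GunrK p K) = φ ^ (Multiplicative.toAdd a.2⁻¹)
    rw [QuotientGroup.mk_inv, ha', toAdd_inv, zpow_neg]

set_option linter.unusedSectionVars false

/-- Hilbert's Theorem 90 for a finite group acting faithfully on a field. -/
theorem exists_mul_smul_eq_of_cocycle {H Q : Type*} [Group H] [Finite H] [Field Q]
    [MulSemiringAction H Q] [FaithfulSMul H Q] (c : H → Q) (h0 : ∀ g, c g ≠ 0)
    (hc : ∀ g h, c (g * h) = c g * g • c h) : ∃ b : Q, b ≠ 0 ∧ ∀ g, c g * g • b = b := by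
  classical
  have := Fintype.ofFinite H
  have hli : LinearIndependent Q (fun f : Q →* Q => (f : Q → Q)) := linearIndependent_monoidHom Q Q
  have hinj : Function.Injective
      (fun g : H => ((MulSemiringAction.toRingHom H Q g : Q →+* Q) : Q →* Q)) := by
    intro g h hgh
    apply eq_of_smul_eq_smul (α := Q)
    intro x
    exact DFunLike.congr_fun hgh x
  have hli2 := hli.comp _ hinj
  have hne : ∃ a : Q, ∑ g : H, c g * g • a ≠ 0 := by
    by_contra! hcon
    have := Fintype.linearIndependent_iff.1 hli2 c (by
      funext a
      simpa using hcon a) 1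
    exact h0 1 this
  obtain ⟨a, ha⟩ := hne
  refine ⟨_, ha, fun g => ?_⟩
  rw [Finset.smul_sum, Finset.mul_sum]
  refine Fintype.sum_bijective (fun h => g * h) (Group.mulLeft_bijective g) _ _ fun h => ?_
  rw [hc, smul_mul', mul_smul, mul_assoc]

section CyclicQuotient

variable {G Q : Type*} [CommGroup G] [Field Q] [MulSemiringAction G Q]

/-- The partial norm `∏_{i < a} σ^i v`. -/
def partialNorm (σ : G) (a : ℕ) (v : Q) : Q := ∏ i ∈ Finset.range a, σ ^ i • v

theorem partialNorm_add (σ : G) (a b : ℕ) (v : Q) :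
    partialNorm σ (a + b) v = partialNorm σ a v * σ ^ a • partialNorm σ b v := by
  simp only [partialNorm, Finset.prod_range_add, Finset.smul_prod', ← mul_smul, pow_add]

theorem partialNorm_mul (σ : G) (a : ℕ) (v w : Q) :
    partialNorm σ a (v * w) = partialNorm σ a v * partialNorm σ a w := by
  simp only [partialNorm, smul_mul', Finset.prod_mul_distrib]

theorem partialNorm_inv (σ : G) (a : ℕ) (v : Q) :
    partialNorm σ a v⁻¹ = (partialNorm σ a v)⁻¹ := by
  simp only [partialNorm, smul_inv₀', Finset.prod_inv_distrib]

theorem partialNorm_ne_zero (σ : G) (a : ℕ) {v : Q} (hv : v ≠ 0) : partialNorm σ a v ≠ 0 :=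
  Finset.prod_ne_zero_iff.2 fun _ _ => (smul_ne_zero_iff_ne _).2 hv

theorem smul_partialNorm (g σ : G) (a : ℕ) (v : Q) :
    g • partialNorm σ a v = partialNorm σ a (g • v) := by
  simp only [partialNorm, Finset.smul_prod', smul_smul, mul_comm]

theorem partialNorm_of_fixed (σ : G) (a : ℕ) {v : Q} (hv : σ • v = v) :
    partialNorm σ a v = v ^ a := by
  have : ∀ i : ℕ, σ ^ i • v = v := fun i => by
    induction i with
    | zero => simp
    | succ i ih => rw [pow_succ, mul_smul, hv, ih]
  simp [partialNorm, this]

theorem smul_self_partialNorm (σ : G) (m : ℕ) {v : Q} (hv : σ ^ m • v = v) :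
    σ • partialNorm σ m v = partialNorm σ m v := by
  by_cases h0 : v = 0
  · subst h0
    rw [smul_partialNorm, smul_zero]
  have h1 := partialNorm_add σ 1 m v
  have h2 := partialNorm_add σ m 1 v
  rw [add_comm, h2] at h1
  have h3 : partialNorm σ 1 v = v := by simp [partialNorm]
  rw [h3, hv, pow_one, mul_comm] at h1
  exact (mul_left_cancel₀ h0 h1).symm

theorem partialNorm_add_mul (σ : G) (a m e : ℕ) {v : Q} (hv : σ ^ m • v = v) :
    partialNorm σ (a + m * e) v = partialNorm σ a v * partialNorm σ m v ^ e := by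
  induction e with
  | zero => simp
  | succ e ih =>
    rw [mul_add, mul_one, ← add_assoc, add_comm (a + m * e) m, partialNorm_add, pow_succ, ← mul_assoc,
      ← ih, smul_partialNorm, hv, mul_comm]

theorem exists_coset_index (T : Subgroup G) (σ : G) (m : ℕ) (hm : 0 < m)
    (hσ : ∀ i : ℕ, σ ^ i ∈ T ↔ m ∣ i) : ∃ j : G → ℕ, ∀ g ∈ T ⊔ Subgroup.zpowers σ,
      j g < m ∧ ∃ t ∈ T, g = σ ^ j g * t := by
  have key : ∀ g : G, ∃ j : ℕ, g ∈ T ⊔ Subgroup.zpowers σ → j < m ∧ ∃ t ∈ T, g = σ ^ j * t := by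
    intro g
    by_cases hg : g ∈ T ⊔ Subgroup.zpowers σ
    · obtain ⟨t, ht, s, ⟨k, rfl⟩, rfl⟩ := Subgroup.mem_sup.1 hg
      have hm' : (0 : ℤ) < m := by exact_mod_cast hm
      refine ⟨(k % m).toNat, fun _ => ⟨?_, ?_⟩⟩
      · have := Int.emod_lt_of_pos k hm'
        have := Int.emod_nonneg k hm'.ne'
        omega
      · refine ⟨(σ ^ m) ^ (k / m) * t, T.mul_mem (T.zpow_mem ((hσ m).2 dvd_rfl) _) ht, ?_⟩
        have h1 : σ ^ (k % m).toNat = σ ^ (k % m) := by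
          rw [← zpow_natCast, Int.toNat_of_nonneg (Int.emod_nonneg k hm'.ne')]
        rw [h1, ← mul_assoc, ← zpow_natCast, ← zpow_mul, ← zpow_add, Int.emod_add_mul_ediv,
          mul_comm]
    · exact ⟨0, fun h => absurd h hg⟩
  choose j hj using key
  exact ⟨j, hj⟩

theorem partialNorm_cocycle {T : Subgroup G} {σ : G} {m : ℕ}
    (hσ : ∀ i : ℕ, σ ^ i ∈ T ↔ m ∣ i) {j : G → ℕ}
    (hj : ∀ g ∈ T ⊔ Subgroup.zpowers σ, j g < m ∧ ∃ t ∈ T, g = σ ^ j g * t)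
    {v : Q} (hv : ∀ t ∈ T, t • v = v) {g h : G} (hg : g ∈ T ⊔ Subgroup.zpowers σ)
    (hh : h ∈ T ⊔ Subgroup.zpowers σ) :
    ∃ e : ℕ, j g + j h = j (g * h) + m * e ∧
      partialNorm σ (j g) v * g • partialNorm σ (j h) v =
        partialNorm σ (j (g * h)) v * partialNorm σ m v ^ e := by
  obtain ⟨h1, t, ht, hgt⟩ := hj g hg
  obtain ⟨h2, s, hs, hhs⟩ := hj h hh
  obtain ⟨h3, r, hr, hghr⟩ := hj (g * h) (mul_mem hg hh)
  have hmem : ∀ a b : ℕ, a ≤ b → σ ^ a * (σ ^ b)⁻¹ ∈ T → m ∣ b - a := by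
    intro a b hab hT
    rw [← hσ, pow_sub σ hab]
    have := T.inv_mem hT
    rwa [mul_inv_rev, inv_inv] at this
  have hmain : σ ^ (j g + j h) * (σ ^ j (g * h))⁻¹ ∈ T := by
    have : σ ^ (j g + j h) * (σ ^ j (g * h))⁻¹ = r * t⁻¹ * s⁻¹ := by
      have e1 : σ ^ (j g) = g * t⁻¹ := eq_mul_inv_of_mul_eq hgt.symm
      have e2 : σ ^ (j h) = h * s⁻¹ := eq_mul_inv_of_mul_eq hhs.symm
      have e3 : σ ^ (j (g * h)) = g * h * r⁻¹ := eq_mul_inv_of_mul_eq hghr.symm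
      rw [pow_add, e1, e2, e3, mul_inv_rev, inv_inv, mul_inv_rev]
      apply Additive.ofMul.injective
      simp only [ofMul_mul, ofMul_inv]
      abel
    rw [this]
    exact T.mul_mem (T.mul_mem hr (T.inv_mem ht)) (T.inv_mem hs)
  have hle : j (g * h) ≤ j g + j h := by
    by_contra hlt
    push Not at hlt
    have := Nat.le_of_dvd (by omega) (hmem _ _ hlt.le hmain)
    omega
  have hdvd : m ∣ j g + j h - j (g * h) := by
    apply hmem _ _ hle
    have := T.inv_mem hmain
    rwa [mul_inv_rev, inv_inv] at this
  obtain ⟨e, he⟩ := hdvd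
  have he' : j g + j h = j (g * h) + m * e := by omega
  refine ⟨e, he', ?_⟩
  rw [← partialNorm_add_mul σ _ m e (hv _ ((hσ m).2 dvd_rfl)), ← he', partialNorm_add]
  congr 1
  conv_lhs => rw [hgt]
  rw [mul_smul, smul_partialNorm t, hv t ht]

/-- Hilbert's Theorem 90 for the cyclic quotient of `T ⊔ ⟨σ⟩` by `T`. -/
theorem exists_eq_smul_div [Finite G] [FaithfulSMul G Q] {T : Subgroup G} {σ : G} {m : ℕ}
    (hm : 0 < m) (hσ : ∀ i : ℕ, σ ^ i ∈ T ↔ m ∣ i) {x : Q} (hx0 : x ≠ 0)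
    (hx : ∀ t ∈ T, t • x = x) (hN : partialNorm σ m x = 1) :
    ∃ y : Q, y ≠ 0 ∧ (∀ t ∈ T, t • y = y) ∧ σ • y = x * y := by
  obtain ⟨j, hj⟩ := exists_coset_index T σ m hm hσ
  have hone : ∀ t ∈ T, j t = 0 := by
    intro t ht
    obtain ⟨h1, s, hs, h2⟩ := hj t (Subgroup.mem_sup_left ht)
    have : σ ^ j t ∈ T := by
      rw [eq_mul_inv_of_mul_eq h2.symm]
      exact T.mul_mem ht (T.inv_mem hs)
    exact Nat.eq_zero_of_dvd_of_lt ((hσ _).1 this) h1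
  obtain ⟨b, hb0, hb⟩ := exists_mul_smul_eq_of_cocycle
    (H := ↥(T ⊔ Subgroup.zpowers σ)) (fun g => partialNorm σ (j g) x)
    (fun g => partialNorm_ne_zero _ _ hx0) (fun g h => by
      obtain ⟨e, -, he⟩ := partialNorm_cocycle hσ hj hx g.2 h.2
      rw [hN, one_pow, mul_one] at he
      exact he.symm)
  have hbT : ∀ t ∈ T, t • b = b := by
    intro t ht
    have := hb ⟨t, Subgroup.mem_sup_left ht⟩
    simpa [hone t ht, partialNorm] using this
  have hbs : x * σ • b = b := by
    have hmem : σ ∈ T ⊔ Subgroup.zpowers σ :=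
      Subgroup.mem_sup_right (Subgroup.mem_zpowers σ)
    have h1 := hb ⟨σ, hmem⟩
    obtain ⟨h2, s, hs, h3⟩ := hj σ hmem
    by_cases hm1 : m = 1
    · subst hm1
      have : x = 1 := by simpa [partialNorm] using hN
      rw [this, one_mul]
      exact hbT σ (by simpa using (hσ 1).2 dvd_rfl)
    · have hj1 : j σ = 1 := by
        by_cases hj0 : j σ = 0
        · rw [hj0, pow_zero, one_mul] at h3
          have := (hσ 1).1 (by rw [pow_one, h3]; exact hs)
          exact absurd (Nat.dvd_one.1 this) hm1
        · have : σ ^ (j σ - 1) ∈ T := by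
            have e1 : σ ^ (j σ) = σ * s⁻¹ := eq_mul_inv_of_mul_eq h3.symm
            have e2 : σ ^ (j σ) = σ * σ ^ (j σ - 1) := by
              rw [← pow_succ', Nat.sub_add_cancel (Nat.one_le_iff_ne_zero.2 hj0)]
            rw [e2] at e1
            rw [mul_left_cancel e1]
            exact T.inv_mem hs
          have := Nat.eq_zero_of_dvd_of_lt ((hσ _).1 this) (by omega)
          omega
      simpa [hj1, partialNorm, Subgroup.smul_def] using h1
  refine ⟨b⁻¹, inv_ne_zero hb0, fun t ht => by rw [smul_inv₀', hbT t ht], ?_⟩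
  rw [smul_inv₀']
  have : σ • b ≠ 0 := (smul_ne_zero_iff_ne _).2 hb0
  rw [eq_comm, mul_inv_eq_iff_eq_mul₀ hb0]
  field_simp
  exact hbs

end CyclicQuotient

/-- Equality of the two Tate cohomology orders of a cyclic group whose restriction to a subgroup
of finite index is cohomologically trivial. -/
theorem relIndex_range_ker_eq {A : Type*} [CommGroup A] (D N : A →* A) (V : Subgroup A)
    [V.FiniteIndex] (hND : ∀ a, N (D a) = 1) (hDN : ∀ a, D (N a) = 1)
    (hNV : ∀ v ∈ V, N v ∈ V) (hDV : ∀ v ∈ V, D v ∈ V)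
    (h1 : ∀ v ∈ V, D v = 1 → ∃ w ∈ V, N w = v) (h2 : ∀ v ∈ V, N v = 1 → ∃ w ∈ V, D w = v) :
    N.range.relIndex D.ker = D.range.relIndex N.ker ∧ N.range.relIndex D.ker ≠ 0 := by
  have aux : ∀ (D N : A →* A), (∀ a, D (N a) = 1) → (∀ v ∈ V, D v ∈ V) →
      (∀ v ∈ V, D v = 1 → ∃ w ∈ V, N w = v) → (∀ v ∈ V, N v = 1 → ∃ w ∈ V, D w = v) →
      (∀ a, N (D a) = 1) →
      N.range.relIndex D.ker * ((V.comap D).index * (V.comap N).index) = V.index := by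
    intro D N hDN hDV h1 h2 hND
    have hNR : N.range ⊔ V ≤ V.comap D := by
      refine sup_le ?_ hDV
      rintro _ ⟨a, rfl⟩
      simp [hDN]
    have e1 : N.range.relIndex D.ker = (N.range ⊔ V).relIndex (V.comap D) := by
      have hle : N.range ≤ D.ker := by rintro _ ⟨a, rfl⟩; exact hDN a
      have hinf : (N.range ⊔ V) ⊓ D.ker = N.range := by
        apply le_antisymm
        · rintro x ⟨hx, hxD⟩
          obtain ⟨_, ⟨a, rfl⟩, v, hv, rfl⟩ := Subgroup.mem_sup.1 hx
          have : D v = 1 := by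
            have h : D (N a * v) = 1 := hxD
            rwa [map_mul, hDN, one_mul] at h
          obtain ⟨w, -, rfl⟩ := h1 v hv this
          exact ⟨a * w, map_mul _ _ _⟩
        · exact le_inf le_sup_left hle
      have hsup : (N.range ⊔ V) ⊔ D.ker = V.comap D := by
        apply le_antisymm
        · refine sup_le hNR fun x hx => ?_
          have : D x = 1 := hx
          simp [this]
        · intro x hx
          have hx' : D x ∈ V := hx
          obtain ⟨w, hw, hwx⟩ := h2 _ hx' (hND x)
          have : x = w * (x * w⁻¹) := by simp
          rw [this]
          refine Subgroup.mul_mem_sup (Subgroup.mem_sup_right hw) ?_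
          show D _ = 1
          rw [map_mul, map_inv, hwx, mul_inv_cancel]
      rw [← hsup, Subgroup.relIndex_sup_left,
        ← Subgroup.inf_relIndex_right (N.range ⊔ V), hinf]
    have e2 : (V.comap N).index = V.relIndex (N.range ⊔ V) := by
      rw [Subgroup.index_comap, sup_comm]
      exact (Subgroup.relIndex_sup_left _ _).symm
    rw [e1, e2, ← Subgroup.relIndex_mul_index (le_sup_right : V ≤ N.range ⊔ V),
      ← Subgroup.relIndex_mul_index hNR]
    ring
  have e1 := aux D N hDN hDV h1 h2 hND
  have e2 := aux N D hND hNV h2 h1 hDN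
  have hne : V.index ≠ 0 := Subgroup.FiniteIndex.index_ne_zero
  have h3 : (V.comap D).index * (V.comap N).index ≠ 0 := fun h => hne (by rw [← e1, h, mul_zero])
  rw [mul_comm (V.comap N).index] at e2
  exact ⟨mul_right_cancel₀ h3 (e1.trans e2.symm), fun h => hne (by rw [← e1, h, zero_mul])⟩

section Herbrand

variable {G Q : Type*} [CommGroup G]

theorem exists_linearIndependent_smul [Field Q] [MulSemiringAction G Q] [Finite G]
    [FaithfulSMul G Q] (S : Subgroup G) :
    ∃ α : Q, LinearIndependent (FixedPoints.subfield S Q) (fun s : S => s • α) := by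
  have : Finite Gal(Q/FixedPoints.subfield S Q) :=
    Finite.of_equiv _ (FixedPoints.toAlgAutMulEquiv S Q).toEquiv
  obtain ⟨α, hα⟩ := exists_linearIndependent_algEquiv_apply (FixedPoints.subfield S Q) Q
  refine ⟨α, ?_⟩
  exact hα.comp _ (FixedPoints.toAlgAutMulEquiv S Q).injective

/-- A normal element of the fixed field of `T` over the fixed field of `T ⊔ ⟨σ⟩`. -/
theorem exists_det_smul_ne_zero [Field Q] [MulSemiringAction G Q] [Finite G]
    [FaithfulSMul G Q] {T : Subgroup G} {σ : G} {m : ℕ}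
    (hm : 0 < m) (hσ : ∀ i : ℕ, σ ^ i ∈ T ↔ m ∣ i) :
    ∃ β : Q, (∀ t ∈ T, t • β = β) ∧
      (Matrix.of fun k i : Fin m => σ ^ (k + i : ℕ) • β).det ≠ 0 := by
  classical
  have := Fintype.ofFinite G
  obtain ⟨α, hα⟩ := exists_linearIndependent_smul (Q := Q) (T ⊔ Subgroup.zpowers σ)
  set S := T ⊔ Subgroup.zpowers σ with hS
  set β : Q := ∑ t : T, t • α with hβ
  have hβT : ∀ t ∈ T, t • β = β := by
    intro t ht
    rw [hβ, Finset.smul_sum]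
    refine Fintype.sum_bijective (fun h => (⟨t, ht⟩ : T) * h) (Group.mulLeft_bijective _) _ _
      fun h => ?_
    rw [mul_smul]; rfl
  refine ⟨β, hβT, fun hdet => ?_⟩
  obtain ⟨v, hv0, hv⟩ := Matrix.exists_mulVec_eq_zero_iff.2 hdet
  obtain ⟨j, hj⟩ := exists_coset_index T σ m hm hσ
  have hsum : ∀ s : S, ∑ i : Fin m, s • v i * σ ^ (i : ℕ) • β = 0 := by
    intro s
    obtain ⟨h1, t, ht, h2⟩ := hj (s : G)⁻¹ (S.inv_mem s.2)
    have h3 := congr_fun hv ⟨j (s : G)⁻¹, h1⟩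
    simp only [Matrix.mulVec, dotProduct, Matrix.of_apply, Pi.zero_apply] at h3
    have h4 := congr_arg (fun x => s • x) h3
    simp only [Finset.smul_sum, smul_mul', smul_zero] at h4
    rw [← h4]
    refine Finset.sum_congr rfl fun i _ => ?_
    rw [mul_comm]
    congr 1
    have e1 : σ ^ j (s : G)⁻¹ = (s : G)⁻¹ * t⁻¹ := eq_mul_inv_of_mul_eq h2.symm
    rw [Subgroup.smul_def, smul_smul, pow_add, ← mul_assoc, e1, mul_inv_cancel_left, mul_comm,
      mul_smul, hβT _ (T.inv_mem ht)]
  have htr : ∀ x : Q, (∑ s : S, s • x) ∈ FixedPoints.subfield S Q := by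
    intro x s
    rw [Finset.smul_sum]
    exact Fintype.sum_bijective (fun h => s * h) (Group.mulLeft_bijective _) _ _
      fun h => (mul_smul _ _ _).symm
  have hmem : ∀ (i : ℕ) (t : T), σ ^ i * (t : G) ∈ S := fun i t =>
    S.mul_mem (S.pow_mem (Subgroup.mem_sup_right (Subgroup.mem_zpowers σ)) _)
      (Subgroup.mem_sup_left t.2)
  let e : Fin m × T → S := fun x => ⟨σ ^ (x.1 : ℕ) * (x.2 : G), hmem _ _⟩
  have he : Function.Injective e := by
    have key : ∀ (i k : Fin m) (t t' : T), (i : ℕ) ≤ k →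
        σ ^ (i : ℕ) * (t : G) = σ ^ (k : ℕ) * (t' : G) → i = k := by
      intro i k t t' hik h
      have : σ ^ ((k : ℕ) - i) ∈ T := by
        have e2 : σ ^ ((k : ℕ) - i) = t * (t' : G)⁻¹ := by
          rw [pow_sub σ hik, eq_mul_inv_of_mul_eq h.symm]
          apply Additive.ofMul.injective
          simp only [ofMul_mul, ofMul_inv]
          abel
        rw [e2]
        exact T.mul_mem t.2 (T.inv_mem t'.2)
      have := Nat.eq_zero_of_dvd_of_lt ((hσ _).1 this) (by omega)
      exact Fin.ext (by omega)
    rintro ⟨i, t⟩ ⟨k, t'⟩ h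
    have h' : σ ^ (i : ℕ) * (t : G) = σ ^ (k : ℕ) * (t' : G) := congr_arg Subtype.val h
    have hik : i = k := by
      rcases le_total (i : ℕ) k with hl | hl
      · exact key i k t t' hl h'
      · exact (key k i t' t hl h'.symm).symm
    subst hik
    exact Prod.ext rfl (Subtype.ext (mul_left_cancel h'))
  have hli := hα.comp e he
  have hzero : ∀ (x : Q) (i : Fin m), ∑ s : S, s • (x * v i) = 0 := by
    intro x i
    have h1 : ∑ y : Fin m × T, (⟨_, htr (x * v y.1)⟩ : FixedPoints.subfield S Q) • (e y • α) = 0 := by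
      rw [Fintype.sum_prod_type]
      have h2 : ∀ i : Fin m, ∑ t : T, (⟨_, htr (x * v i)⟩ : FixedPoints.subfield S Q) •
          (e (i, t) • α) = ∑ s : S, s • x * (s • v i * σ ^ (i : ℕ) • β) := by
        intro i
        have h3 : σ ^ (i : ℕ) • β = ∑ t : T, e (i, t) • α := by
          rw [hβ, Finset.smul_sum]
          refine Finset.sum_congr rfl fun t _ => ?_
          simp only [Subgroup.smul_def, e, mul_smul]
        rw [← Finset.smul_sum, ← h3, Subfield.smul_def]
        simp only [smul_eq_mul, Finset.sum_mul, smul_mul', mul_assoc]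
      rw [Finset.sum_congr rfl fun i _ => h2 i, Finset.sum_comm]
      refine Finset.sum_eq_zero fun s _ => ?_
      rw [← Finset.mul_sum, hsum, mul_zero]
    have h5 := Fintype.linearIndependent_iff.1 hli _ h1 (i, 1)
    exact congr_arg Subtype.val h5
  obtain ⟨i, hi⟩ := Function.ne_iff.1 hv0
  have hi' : v i ≠ 0 := hi
  have h6 := hzero (α / v i) i
  rw [div_mul_cancel₀ _ hi'] at h6
  have h7 := Fintype.linearIndependent_iff.1 hα (fun _ => 1) (by simpa using h6) 1
  exact one_ne_zero h7

end Herbrand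

section Lattice

variable {G Q : Type*} [CommGroup G] [Finite G] [NormedField Q] [IsUltrametricDist Q]
  [MulSemiringAction G Q] [FaithfulSMul G Q]

theorem pow_smul_eq_self {M : Type*} [Monoid M] {X : Type*} [MulAction M X] {σ : M} {x : X}
    (h : σ • x = x) (i : ℕ) : σ ^ i • x = x := by
  induction i with
  | zero => simp
  | succ i ih => rw [pow_succ, mul_smul, h, ih]

set_option maxHeartbeats 600000 in
/-- An integral lattice in the fixed field of `T` with trivial cohomology. -/
theorem exists_lattice (hiso : ∀ (g : G) (x : Q), ‖g • x‖ = ‖x‖) {ρ : ℝ} (h1 : ρ < 1)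
    {T : Subgroup G} {σ : G} {m : ℕ} (hm : 0 < m) (hσ : ∀ i : ℕ, σ ^ i ∈ T ↔ m ∣ i) :
    ∃ (Λ : AddSubgroup Q) (c : ℕ), (∀ x ∈ Λ, ‖x‖ ≤ 1) ∧ (∀ x ∈ Λ, ∀ t ∈ T, t • x = x) ∧
      (∀ x : Q, (∀ t ∈ T, t • x = x) → ‖x‖ ≤ ρ ^ c → x ∈ Λ) ∧ (∀ x ∈ Λ, σ • x ∈ Λ) ∧
      (∀ a : Q, (∀ g : G, g • a = a) → ‖a‖ ≤ 1 → ∀ x ∈ Λ, a * x ∈ Λ) ∧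
      (∀ x ∈ Λ, σ • x = x → ∃ y ∈ Λ, ∑ i ∈ Finset.range m, σ ^ i • y = x) ∧
      (∀ x ∈ Λ, ∑ i ∈ Finset.range m, σ ^ i • x = 0 → ∃ y ∈ Λ, σ • y - y = x) := by
  classical
  obtain ⟨β, hβT, hdet⟩ := exists_det_smul_ne_zero (Q := Q) hm hσ
  obtain ⟨m, rfl⟩ := Nat.exists_eq_succ_of_ne_zero hm.ne'
  have hσT : σ ^ (m + 1) ∈ T := (hσ _).2 dvd_rfl
  set M := Matrix.of fun k i : Fin (m + 1) => σ ^ (k + i : ℕ) • β with hM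
  have huniq : ∀ a : ℕ → Q, (∀ i, σ • a i = a i) →
      ∑ i ∈ Finset.range (m + 1), a i * σ ^ i • β = 0 → ∀ i < m + 1, a i = 0 := by
    intro a ha hsum i hi
    have h1 : M.mulVec (fun i => a i) = 0 := by
      funext k
      simp only [Matrix.mulVec, dotProduct, hM, Matrix.of_apply, Pi.zero_apply]
      have h2 := congr_arg (fun x => σ ^ (k : ℕ) • x) hsum
      simp only [Finset.smul_sum, smul_mul', smul_zero, pow_smul_eq_self (ha _), smul_smul,
        ← pow_add] at h2
      rw [Fin.sum_univ_eq_sum_range (fun i => σ ^ ((k : ℕ) + i) • β * a i), ← h2]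
      exact Finset.sum_congr rfl fun i _ => mul_comm _ _
    exact congr_fun (Matrix.eq_zero_of_mulVec_eq_zero hdet h1) ⟨i, hi⟩
  let P : (ℕ → Q) → Prop := fun a => ∀ i, ‖a i‖ * ‖β‖ ≤ 1 ∧ σ • a i = a i ∧ ∀ t ∈ T, t • a i = a i
  have hmax : ∀ x y : Q, ‖x‖ * ‖β‖ ≤ 1 → ‖y‖ * ‖β‖ ≤ 1 → ‖x + y‖ * ‖β‖ ≤ 1 := by
    intro x y hx hy
    refine le_trans (mul_le_mul_of_nonneg_right (IsUltrametricDist.norm_add_le_max x y)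
      (norm_nonneg _)) ?_
    rcases max_choice ‖x‖ ‖y‖ with h | h <;> rw [h] <;> assumption
  let Λ : AddSubgroup Q :=
    { carrier := {x | ∃ a, P a ∧ x = ∑ i ∈ Finset.range (m + 1), a i * σ ^ i • β}
      zero_mem' := ⟨0, fun i => by simp, by simp⟩
      add_mem' := by
        rintro x y ⟨a, ha, rfl⟩ ⟨b, hb, rfl⟩
        refine ⟨a + b, fun i => ⟨hmax _ _ (ha i).1 (hb i).1, ?_, fun t ht => ?_⟩, ?_⟩
        · rw [Pi.add_apply, smul_add, (ha i).2.1, (hb i).2.1]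
        · rw [Pi.add_apply, smul_add, (ha i).2.2 t ht, (hb i).2.2 t ht]
        · simp only [Pi.add_apply, add_mul, Finset.sum_add_distrib]
      neg_mem' := by
        rintro x ⟨a, ha, rfl⟩
        refine ⟨-a, fun i => ⟨?_, ?_, fun t ht => ?_⟩, ?_⟩
        · rw [Pi.neg_apply, norm_neg]; exact (ha i).1
        · rw [Pi.neg_apply, smul_neg, (ha i).2.1]
        · rw [Pi.neg_apply, smul_neg, (ha i).2.2 t ht]
        · simp only [Pi.neg_apply, neg_mul, Finset.sum_neg_distrib] }
  have hcomm : ∀ (g : G) (i : ℕ) (x : Q), g • σ ^ i • x = σ ^ i • g • x := fun g i x => by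
    rw [smul_smul, smul_smul, mul_comm]
  have hTr : ∑ i ∈ Finset.range (m + 1), σ ^ i • β ≠ 0 := by
    intro h
    have := huniq (fun _ => 1) (fun _ => smul_one σ) (by simpa using h) 0 (by omega)
    exact one_ne_zero this
  -- shift of coordinates
  have hshift : ∀ a : ℕ → Q, (∀ i, σ • a i = a i) →
      σ • ∑ i ∈ Finset.range (m + 1), a i * σ ^ i • β =
        ∑ i ∈ Finset.range (m + 1), (Nat.casesOn i (a m) a : Q) * σ ^ i • β := by
    intro a ha
    rw [Finset.smul_sum, Finset.sum_range_succ, Finset.sum_range_succ']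
    congr 1
    · refine Finset.sum_congr rfl fun i _ => ?_
      rw [smul_mul', ha, pow_succ', mul_smul]
    · rw [smul_mul', ha, ← mul_smul, ← pow_succ', hβT _ hσT, pow_zero, one_smul]
      rfl
  have hnorm : ∀ x ∈ Λ, ‖x‖ ≤ 1 := by
    rintro x ⟨a, ha, rfl⟩
    refine IsUltrametricDist.norm_sum_le_of_forall_le_of_nonneg zero_le_one fun i _ => ?_
    rw [norm_mul, hiso]
    exact (ha i).1
  obtain ⟨C, hC, hCle⟩ : ∃ C : ℝ, 0 < C ∧ ∀ i, ∑ k, ‖M⁻¹ i k‖ * ‖β‖ ≤ C :=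
    ⟨1 + ∑ i, ∑ k, ‖M⁻¹ i k‖ * ‖β‖, by positivity, fun i =>
      (Finset.single_le_sum (f := fun i => ∑ k, ‖M⁻¹ i k‖ * ‖β‖)
        (fun i _ => by positivity) (Finset.mem_univ i)).trans
        (le_add_of_nonneg_left zero_le_one)⟩
  obtain ⟨c, hc⟩ := exists_pow_lt_of_lt_one (inv_pos.2 hC) h1
  refine ⟨Λ, c, hnorm, ?_, ?_, ?_, ?_, ?_, ?_⟩
  · rintro x ⟨a, ha, rfl⟩ t ht
    rw [Finset.smul_sum]
    refine Finset.sum_congr rfl fun i _ => ?_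
    rw [smul_mul', (ha i).2.2 t ht, hcomm, hβT t ht]
  · intro x hxT hx
    have hdet' : IsUnit M.det := isUnit_iff_ne_zero.2 hdet
    let X : Fin (m + 1) → Q := fun k => σ ^ (k : ℕ) • x
    let a : Fin (m + 1) → Q := M⁻¹.mulVec X
    have hMa : M.mulVec a = X := by
      rw [Matrix.mulVec_mulVec, Matrix.mul_nonsing_inv _ hdet', Matrix.one_mulVec]
    have hinj : ∀ b, M.mulVec b = X → b = a := by
      intro b hb
      rw [← hb] at hMa
      have h3 : M.mulVec (a - b) = 0 := by rw [Matrix.mulVec_sub, hMa, sub_self]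
      exact (sub_eq_zero.1 (Matrix.eq_zero_of_mulVec_eq_zero hdet h3)).symm
    have haσ : ∀ i, σ • a i = a i := by
      intro i
      refine congr_fun (hinj (fun i => σ • a i) ?_) i
      funext k
      obtain ⟨k', hk'⟩ : ∃ k' : Fin (m + 1), ∀ y : Q, (∀ t ∈ T, t • y = y) →
          ∀ i : ℕ, σ • σ ^ (k' + i : ℕ) • y = σ ^ (k + i : ℕ) • y := by
        rcases k with ⟨_ | k, hk⟩
        · refine ⟨⟨m, by omega⟩, fun y hy i => ?_⟩
          rw [smul_smul, ← pow_succ', zero_add, add_right_comm, add_comm, pow_add, mul_smul,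
            hy _ hσT]
        · refine ⟨⟨k, by omega⟩, fun y hy i => ?_⟩
          rw [smul_smul, ← pow_succ', add_right_comm]
      have h4 := congr_arg (fun y => σ • y) (congr_fun hMa k')
      simp only [Matrix.mulVec, dotProduct, hM, Matrix.of_apply, X, Finset.smul_sum, smul_mul',
        hk' β hβT] at h4
      have h5 := hk' x hxT 0
      simp only [add_zero] at h5
      rw [h5] at h4
      exact h4
    have haT : ∀ t ∈ T, ∀ i, t • a i = a i := by
      intro t ht i
      refine congr_fun (hinj (fun i => t • a i) ?_) i
      funext k
      have h4 := congr_arg (fun y => t • y) (congr_fun hMa k)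
      simp only [Matrix.mulVec, dotProduct, hM, Matrix.of_apply, X, Finset.smul_sum, smul_mul',
        hcomm, hβT t ht, hxT t ht] at h4
      exact h4
    have hna : ∀ i, ‖a i‖ * ‖β‖ ≤ 1 := by
      intro i
      have h6 : ‖a i‖ ≤ ∑ k, ‖M⁻¹ i k‖ * ‖x‖ := by
        have h13 : a i = ∑ k, M⁻¹ i k * X k := rfl
        rw [h13]
        refine (norm_sum_le _ _).trans (Finset.sum_le_sum fun k _ => ?_)
        rw [norm_mul, hiso]
      calc ‖a i‖ * ‖β‖ ≤ (∑ k, ‖M⁻¹ i k‖ * ‖x‖) * ‖β‖ := by gcongr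
        _ = (∑ k, ‖M⁻¹ i k‖ * ‖β‖) * ‖x‖ := by
          rw [Finset.sum_mul, Finset.sum_mul]
          exact Finset.sum_congr rfl fun k _ => by ring
        _ ≤ C * ‖x‖ := mul_le_mul_of_nonneg_right (hCle i) (norm_nonneg _)
        _ ≤ C * C⁻¹ := mul_le_mul_of_nonneg_left (hx.trans hc.le) hC.le
        _ = 1 := mul_inv_cancel₀ hC.ne'
    refine ⟨fun i => if h : i < m + 1 then a ⟨i, h⟩ else 0, fun i => ?_, ?_⟩
    · by_cases h : i < m + 1
      · simp only [h, dif_pos]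
        exact ⟨hna _, haσ _, fun t ht => haT t ht _⟩
      · simp [h]
    · have h7 := congr_fun hMa 0
      simp only [Matrix.mulVec, dotProduct, hM, Matrix.of_apply, X, Fin.val_zero, zero_add,
        pow_zero, one_smul] at h7
      rw [← h7, Finset.sum_range]
      refine Finset.sum_congr rfl fun i _ => ?_
      simp only [dif_pos i.2, Fin.eta, mul_comm]
  · rintro x ⟨a, ha, rfl⟩
    refine ⟨fun i => Nat.casesOn i (a m) a, fun i => ?_, hshift a fun i => (ha i).2.1⟩
    cases i with
    | zero => exact ha m
    | succ i => exact ha i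
  · rintro d hd hd1 x ⟨a, ha, rfl⟩
    refine ⟨fun i => d * a i, fun i => ⟨?_, ?_, fun t ht => ?_⟩, ?_⟩
    · rw [norm_mul, mul_assoc]
      exact mul_le_one₀ hd1 (by positivity) (ha i).1
    · rw [smul_mul', hd, (ha i).2.1]
    · rw [smul_mul', hd, (ha i).2.2 t ht]
    · simp only [Finset.mul_sum, mul_assoc]
  · rintro x ⟨a, ha, rfl⟩ hx
    rw [hshift a fun i => (ha i).2.1, ← sub_eq_zero, ← Finset.sum_sub_distrib] at hx
    simp only [← sub_mul] at hx
    have h8 := huniq (fun i => (Nat.casesOn i (a m) a : Q) - a i) (fun i => by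
      cases i with
      | zero =>
        show σ • (a m - a 0) = a m - a 0
        simp only [smul_sub, (ha _).2.1]
      | succ i =>
        show σ • (a i - a (i + 1)) = a i - a (i + 1)
        simp only [smul_sub, (ha _).2.1]) hx
    have h9 : ∀ i < m + 1, a i = a 0 := by
      intro i
      induction i with
      | zero => simp
      | succ i ih =>
        intro hi
        rw [← ih (by omega)]
        exact (sub_eq_zero.1 (h8 _ hi)).symm
    refine ⟨a 0 * β, ⟨fun i => if i = 0 then a 0 else 0, fun i => ?_, ?_⟩, ?_⟩
    · by_cases h : i = 0
      · simpa [h] using ha 0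
      · simp [h]
    · simp [ite_mul]
    · refine Finset.sum_congr rfl fun i hi => ?_
      rw [h9 i (Finset.mem_range.1 hi), smul_mul', pow_smul_eq_self (ha 0).2.1]
  · rintro x ⟨a, ha, rfl⟩ hx
    have h10 : ∑ i ∈ Finset.range (m + 1), a i = 0 := by
      have h11 : (∑ i ∈ Finset.range (m + 1), a i) * ∑ i ∈ Finset.range (m + 1), σ ^ i • β = 0 := by
        rw [← hx, Finset.sum_mul]
        simp only [Finset.smul_sum, smul_mul', pow_smul_eq_self (ha _).2.1]
        rw [Finset.sum_comm]
        refine Finset.sum_congr rfl fun i _ => ?_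
        rw [← Finset.mul_sum]
        congr 1
        have h12 : σ • (∑ i ∈ Finset.range (m + 1), σ ^ i • β) =
            ∑ i ∈ Finset.range (m + 1), σ ^ i • β := by
          have := hshift (fun _ => 1) (fun _ => smul_one σ)
          simp only [one_mul] at this
          rw [this]
          refine Finset.sum_congr rfl fun i _ => ?_
          cases i <;> simp
        rw [← pow_smul_eq_self h12 i, Finset.smul_sum]
        refine Finset.sum_congr rfl fun i _ => ?_
        rw [smul_smul, smul_smul, mul_comm]
      exact (mul_eq_zero.1 h11).resolve_right hTr
    let b : ℕ → Q := fun i => -∑ j ∈ Finset.range (i + 1), a j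
    have hbσ : ∀ i, σ • b i = b i := fun i => by
      simp only [b, smul_neg, Finset.smul_sum, (ha _).2.1]
    have hb : P b := fun i => by
      refine ⟨?_, hbσ i, fun t ht => ?_⟩
      · simp only [b, norm_neg, ← norm_mul, Finset.sum_mul]
        refine IsUltrametricDist.norm_sum_le_of_forall_le_of_nonneg zero_le_one fun i _ => ?_
        rw [norm_mul]
        exact (ha i).1
      · simp only [b, smul_neg, Finset.smul_sum, (ha _).2.2 t ht]
    refine ⟨_, ⟨b, hb, rfl⟩, ?_⟩
    rw [hshift b hbσ, ← Finset.sum_sub_distrib]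
    refine Finset.sum_congr rfl fun i _ => ?_
    rw [← sub_mul]
    congr 1
    cases i with
    | zero =>
      simp only [b, h10, neg_zero]
      simp
    | succ i =>
      simp only [b]
      rw [Finset.sum_range_succ _ (i + 1)]
      ring

end Lattice

section UnitGroups

variable {G Q : Type*} [CommGroup G] [NormedField Q] [MulSemiringAction G Q]

/-- The action of a group element on the units of a field. -/
def unitsSmul (g : G) : Qˣ →* Qˣ := Units.map (MulDistribMulAction.toMonoidHom Q g)

@[simp] theorem coe_unitsSmul (g : G) (u : Qˣ) : (unitsSmul g u : Q) = g • (u : Q) := rfl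

/-- The nonzero elements fixed by a subgroup. -/
def fixedUnits (Q : Type*) [NormedField Q] [MulSemiringAction G Q] (T : Subgroup G) :
    Subgroup Qˣ where
  carrier := {u | ∀ t ∈ T, t • (u : Q) = u}
  one_mem' := fun t _ => by simp
  mul_mem' := fun ha hb t ht => by rw [Units.val_mul, smul_mul', ha t ht, hb t ht]
  inv_mem' := fun {a} ha t ht => by rw [Units.val_inv_eq_inv_val, smul_inv₀', ha t ht]

theorem mem_fixedUnits {T : Subgroup G} {u : Qˣ} :
    u ∈ fixedUnits Q T ↔ ∀ t ∈ T, t • (u : Q) = u := Iff.rfl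

/-- The norm of a unit as a nonzero real number. -/
def unitsNorm (Q : Type*) [NormedField Q] : Qˣ →* ℝˣ := Units.map (normHom (α := Q)).toMonoidHom

@[simp] theorem coe_unitsNorm (u : Qˣ) : (unitsNorm Q u : ℝ) = ‖(u : Q)‖ := rfl

/-- The elements of norm one fixed by a subgroup. -/
def unitSphere (Q : Type*) [NormedField Q] [MulSemiringAction G Q] (T : Subgroup G) :
    Subgroup Qˣ := fixedUnits Q T ⊓ (unitsNorm Q).ker

theorem mem_unitSphere {T : Subgroup G} {u : Qˣ} :
    u ∈ unitSphere Q T ↔ (∀ t ∈ T, t • (u : Q) = u) ∧ ‖(u : Q)‖ = 1 := by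
  rw [unitSphere, Subgroup.mem_inf, mem_fixedUnits, MonoidHom.mem_ker, Units.ext_iff]
  rfl

/-- The group of norms of nonzero elements fixed by a subgroup. -/
def normGroup (Q : Type*) [NormedField Q] [MulSemiringAction G Q] (T : Subgroup G) :
    Subgroup ℝˣ := (fixedUnits Q T).map (unitsNorm Q)

/-- The partial norm on units. -/
def unitsPartialNorm (σ : G) (m : ℕ) : Qˣ →* Qˣ :=
  Units.map
    { toFun := partialNorm σ m
      map_one' := by simp [partialNorm]
      map_mul' := partialNorm_mul σ m }

@[simp] theorem coe_unitsPartialNorm (σ : G) (m : ℕ) (u : Qˣ) :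
    (unitsPartialNorm σ m u : Q) = partialNorm σ m (u : Q) := rfl

/-- The homomorphism `u ↦ σ u / u`. -/
def unitsSmulDiv (σ : G) : Qˣ →* Qˣ := unitsSmul σ / MonoidHom.id _

@[simp] theorem coe_unitsSmulDiv (σ : G) (u : Qˣ) :
    (unitsSmulDiv σ u : Q) = σ • (u : Q) / u := by
  simp [unitsSmulDiv]

theorem unitsPartialNorm_eq_prod (σ : G) (m : ℕ) (u : Qˣ) :
    unitsPartialNorm σ m u = ∏ i ∈ Finset.range m, unitsSmul (σ ^ i) u := by
  ext
  rw [Units.coe_prod]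
  rfl

end UnitGroups

section Approx

variable {Q : Type*} [NormedField Q]

theorem exists_map_eq_of_approx {f : Qˣ →* Qˣ} {W : ℕ → Subgroup Qˣ} {Z : Subgroup Qˣ}
    (hanti : ∀ n, W (n + 1) ≤ W n)
    {ρ : ℝ} (h1 : ρ < 1) (hWn : ∀ n, ∀ w ∈ W n, ‖(w : Q) - 1‖ ≤ ρ ^ n)
    (hcpt : IsCompact ((fun u : Qˣ => (u : Q)) '' (W 0 : Set Qˣ)))
    (hstep : ∀ n, ∀ u ∈ W n, u ∈ Z → ∃ w ∈ W n, u / f w ∈ W (n + 1) ∧ u / f w ∈ Z)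
    {u : Qˣ} (hu : u ∈ W 0) (huZ : u ∈ Z) {F : Q → Q} (hF : Continuous F)
    (hFu : ∀ w ∈ W 0, ‖F w‖ = ‖((u / f w : Qˣ) : Q) - 1‖) : ∃ w ∈ W 0, f w = u := by
  have hle : ∀ n, W n ≤ W 0 := fun n => by
    induction n with
    | zero => exact le_rfl
    | succ n ih => exact (hanti n).trans ih
  have happ : ∀ n, ∃ w ∈ W 0, u / f w ∈ W n ∧ u / f w ∈ Z := by
    intro n
    induction n with
    | zero => exact ⟨1, one_mem _, by simpa using hu, by simpa using huZ⟩
    | succ n ih =>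
      obtain ⟨w, hw, h2, h3⟩ := ih
      obtain ⟨w', hw', h4, h5⟩ := hstep n _ h2 h3
      refine ⟨w * w', mul_mem hw (hle n hw'), ?_, ?_⟩
      · rwa [map_mul, ← div_div]
      · rwa [map_mul, ← div_div]
  have hcl : (0 : Q) ∈ closure (F '' ((fun u : Qˣ => (u : Q)) '' (W 0 : Set Qˣ))) := by
    rw [Metric.mem_closure_iff]
    intro ε hε
    obtain ⟨n, hn⟩ := exists_pow_lt_of_lt_one hε h1
    obtain ⟨w, hw, h2, -⟩ := happ n
    refine ⟨F w, ⟨_, ⟨w, hw, rfl⟩, rfl⟩, ?_⟩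
    rw [dist_eq_norm, zero_sub, norm_neg, hFu w hw]
    exact (hWn n _ h2).trans_lt hn
  rw [(hcpt.image hF).isClosed.closure_eq] at hcl
  obtain ⟨_, ⟨w, hw, rfl⟩, h⟩ := hcl
  refine ⟨w, hw, ?_⟩
  have h6 := hFu w hw
  simp only at h
  rw [h, norm_zero, eq_comm, norm_eq_zero, sub_eq_zero, Units.val_eq_one, div_eq_one] at h6
  exact h6.symm

end Approx

section FixedIntegers

variable {G Q : Type*} [CommGroup G] [NormedField Q] [IsUltrametricDist Q]
  [MulSemiringAction G Q]

theorem norm_one_add_eq_one {y : Q} (hy : ‖y‖ < 1) : ‖1 + y‖ = 1 := by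
  rw [IsUltrametricDist.norm_add_eq_max_of_norm_ne_norm (by rw [norm_one]; exact hy.ne'),
    norm_one, max_eq_left hy.le]

/-- The integers fixed by a subgroup. -/
def fixedIntegers (Q : Type*) [NormedField Q] [IsUltrametricDist Q]
    [MulSemiringAction G Q] (T : Subgroup G) : Subring Q where
  carrier := {x | ‖x‖ ≤ 1 ∧ ∀ t ∈ T, t • x = x}
  one_mem' := ⟨by simp, fun t _ => smul_one t⟩
  zero_mem' := ⟨by simp, fun t _ => smul_zero t⟩
  mul_mem' := fun ha hb => ⟨by rw [norm_mul]; exact mul_le_one₀ ha.1 (norm_nonneg _) hb.1,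
    fun t ht => by rw [smul_mul', ha.2 t ht, hb.2 t ht]⟩
  add_mem' := fun ha hb => ⟨(IsUltrametricDist.norm_add_le_max _ _).trans (max_le ha.1 hb.1),
    fun t ht => by rw [smul_add, ha.2 t ht, hb.2 t ht]⟩
  neg_mem' := fun ha => ⟨by rw [norm_neg]; exact ha.1, fun t ht => by rw [smul_neg, ha.2 t ht]⟩

theorem smul_mem_fixedIntegers (hiso : ∀ (g : G) (x : Q), ‖g • x‖ = ‖x‖) {T : Subgroup G} (g : G)
    {x : Q} (hx : x ∈ fixedIntegers Q T) : g • x ∈ fixedIntegers Q T :=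
  ⟨by rw [hiso]; exact hx.1, fun t ht => by rw [smul_smul, mul_comm, mul_smul, hx.2 t ht]⟩

theorem partialNorm_one_add (hiso : ∀ (g : G) (x : Q), ‖g • x‖ = ‖x‖) {T : Subgroup G} (σ : G)
    {b : Q} (hb : ∀ g : G, g • b = b) (hb1 : ‖b‖ ≤ 1) {x : Q} (hx : x ∈ fixedIntegers Q T)
    (n : ℕ) : ∃ z ∈ fixedIntegers Q T, partialNorm σ n (1 + b * x) =
      1 + b * ∑ i ∈ Finset.range n, σ ^ i • x + b ^ 2 * z := by
  have hbO : b ∈ fixedIntegers Q T := ⟨hb1, fun t _ => hb t⟩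
  induction n with
  | zero => exact ⟨0, zero_mem _, by simp [partialNorm]⟩
  | succ n ih =>
    obtain ⟨z, hz, h⟩ := ih
    have hx' := smul_mem_fixedIntegers hiso (σ ^ n) hx
    have hs : ∑ i ∈ Finset.range n, σ ^ i • x ∈ fixedIntegers Q T :=
      sum_mem fun i _ => smul_mem_fixedIntegers hiso _ hx
    refine ⟨z + (∑ i ∈ Finset.range n, σ ^ i • x) * σ ^ n • x + b * (z * σ ^ n • x),
      add_mem (add_mem hz (mul_mem hs hx')) (mul_mem hbO (mul_mem hz hx')), ?_⟩
    rw [partialNorm_add, h, Finset.sum_range_succ]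
    simp only [partialNorm, Finset.prod_range_one, pow_zero, one_smul, smul_add, smul_one, smul_mul',
      hb]
    ring

end FixedIntegers

section Trivial

variable {G Q : Type*} [CommGroup G] [Finite G] [NormedField Q] [IsUltrametricDist Q]
  [ProperSpace Q] [MulSemiringAction G Q] [FaithfulSMul G Q]

set_option maxHeartbeats 1000000 in
/-- An open subgroup of the units fixed by `T` which is cohomologically trivial. -/
theorem exists_trivial_subgroup (hiso : ∀ (g : G) (x : Q), ‖g • x‖ = ‖x‖) {ϖ : Q}
    (hϖ : ∀ g : G, g • ϖ = ϖ) (h0 : ϖ ≠ 0) (h1 : ‖ϖ‖ < 1)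
    {T : Subgroup G} {σ : G} {m : ℕ} (hm : 0 < m) (hσ : ∀ i : ℕ, σ ^ i ∈ T ↔ m ∣ i) :
    ∃ V : Subgroup Qˣ, V ≤ unitSphere Q T ∧ (∀ u ∈ V, unitsSmul σ u ∈ V) ∧
      (∀ v ∈ V, unitsSmulDiv σ v = 1 → ∃ w ∈ V, unitsPartialNorm σ m w = v) ∧
      (∀ v ∈ V, unitsPartialNorm σ m v = 1 → ∃ w ∈ V, unitsSmulDiv σ w = v) ∧
      ∃ ε > 0, ∀ u ∈ unitSphere Q T, ‖(u : Q) - 1‖ < ε → u ∈ V := by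
  obtain ⟨Λ, c, hΛ1, hΛT, hΛ2, hΛσ, hΛ6, hΛ4, hΛ5⟩ :=
    exists_lattice (Q := Q) hiso h1 hm hσ
  have hr0 : 0 < ‖ϖ‖ := norm_pos_iff.2 h0
  have hpow : ∀ (j : ℕ) (g : G), g • ϖ ^ j = ϖ ^ j := fun j g => by rw [smul_pow', hϖ]
  have hpow1 : ∀ j : ℕ, ‖ϖ ^ j‖ ≤ 1 := fun j => by
    rw [norm_pow]; exact pow_le_one₀ hr0.le h1.le
  have hpowlt : ∀ j : ℕ, ‖ϖ ^ (j + 1)‖ < 1 := fun j => by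
    rw [norm_pow]; exact pow_lt_one₀ hr0.le h1 (by omega)
  have hΛO : ∀ x ∈ Λ, x ∈ fixedIntegers Q T := fun x hx => ⟨hΛ1 x hx, hΛT x hx⟩
  have hΛp : ∀ j, ∀ x ∈ Λ, ϖ ^ j * x ∈ Λ := fun j x hx => hΛ6 _ (hpow j) (hpow1 j) x hx
  have hOΛ : ∀ j, c ≤ j → ∀ z ∈ fixedIntegers Q T, ϖ ^ j * z ∈ Λ := by
    intro j hj z hz
    refine hΛ2 _ (fun t ht => by rw [smul_mul', hpow, hz.2 t ht]) ?_
    rw [norm_mul, norm_pow]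
    calc ‖ϖ‖ ^ j * ‖z‖ ≤ ‖ϖ‖ ^ j * 1 := by gcongr; exact hz.1
      _ = ‖ϖ‖ ^ j := mul_one _
      _ ≤ ‖ϖ‖ ^ c := pow_le_pow_of_le_one hr0.le h1.le hj
  have hlt : ∀ j, ∀ x ∈ Λ, ‖ϖ ^ (j + 1) * x‖ < 1 := fun j x hx => by
    rw [norm_mul]
    exact mul_lt_one_of_nonneg_of_lt_one_left (norm_nonneg _) (hpowlt j) (hΛ1 x hx)
  have hnorm : ∀ (j : ℕ) (x : Q), x ∈ Λ → ‖1 + ϖ ^ (j + 1) * x‖ = 1 := fun j x hx =>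
    norm_one_add_eq_one (hlt j x hx)
  have hinvO : ∀ u ∈ fixedIntegers Q T, ‖u‖ = 1 → u⁻¹ ∈ fixedIntegers Q T := fun u hu h =>
    ⟨by rw [norm_inv, h, inv_one], fun t ht => by rw [smul_inv₀', hu.2 t ht]⟩
  let W : ℕ → Subgroup Qˣ := fun n =>
    { carrier := {u | ∃ x ∈ Λ, (u : Q) = 1 + ϖ ^ (c + n + 1) * x}
      one_mem' := ⟨0, zero_mem _, by simp⟩
      mul_mem' := by
        rintro u v ⟨x, hx, hu⟩ ⟨y, hy, hv⟩
        refine ⟨x + y + ϖ ^ (c + n + 1) * (x * y), add_mem (add_mem hx hy)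
          (hOΛ _ (by omega) _ (mul_mem (hΛO x hx) (hΛO y hy))), ?_⟩
        rw [Units.val_mul, hu, hv]
        ring
      inv_mem' := by
        rintro u ⟨x, hx, hu⟩
        have hn := hnorm (c + n) x hx
        have hO : 1 + ϖ ^ (c + n + 1) * x ∈ fixedIntegers Q T :=
          add_mem (one_mem _) (hΛO _ (hΛp _ x hx))
        refine ⟨-x + ϖ ^ (c + n + 1) * (x ^ 2 * (1 + ϖ ^ (c + n + 1) * x)⁻¹),
          add_mem (neg_mem hx) (hOΛ _ (by omega) _ (mul_mem (pow_mem (hΛO x hx) 2)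
            (hinvO _ hO hn))), ?_⟩
        have hne : 1 + ϖ ^ (c + n + 1) * x ≠ 0 := hu ▸ u.ne_zero
        rw [Units.val_inv_eq_inv_val, hu]
        field_simp
        ring }
  have hW : ∀ {n : ℕ} {u : Qˣ}, u ∈ W n ↔ ∃ x ∈ Λ, (u : Q) = 1 + ϖ ^ (c + n + 1) * x :=
    fun {n u} => Iff.rfl
  have hmk : ∀ n, ∀ x ∈ Λ, ∃ w ∈ W n, (w : Q) = 1 + ϖ ^ (c + n + 1) * x := by
    intro n x hx
    have hne : 1 + ϖ ^ (c + n + 1) * x ≠ 0 := by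
      rw [← norm_ne_zero_iff, hnorm _ x hx]; exact one_ne_zero
    exact ⟨Units.mk0 _ hne, ⟨x, hx, rfl⟩, rfl⟩
  have hanti : ∀ n, W (n + 1) ≤ W n := by
    rintro n u ⟨x, hx, hu⟩
    exact ⟨ϖ ^ 1 * x, hΛp 1 x hx, by rw [hu]; ring⟩
  have hle : ∀ n, W n ≤ W 0 := fun n => by
    induction n with
    | zero => exact le_rfl
    | succ n ih => exact (hanti n).trans ih
  have hsph : W 0 ≤ unitSphere Q T := by
    rintro u ⟨x, hx, hu⟩
    rw [mem_unitSphere, hu]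
    refine ⟨(add_mem (one_mem _) (hΛO _ (hΛp _ x hx)) : _ ∈ fixedIntegers Q T).2, hnorm _ x hx⟩
  have hWσ : ∀ n, ∀ u ∈ W n, unitsSmul σ u ∈ W n := by
    rintro n u ⟨x, hx, hu⟩
    exact ⟨σ • x, hΛσ x hx, by rw [coe_unitsSmul, hu, smul_add, smul_one, smul_mul', hpow]⟩
  have hWN : ∀ n, ∀ u ∈ W n, unitsPartialNorm σ m u ∈ W n := by
    intro n u hu
    rw [unitsPartialNorm_eq_prod]
    refine Subgroup.prod_mem _ fun i hi => ?_
    clear hi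
    induction i with
    | zero =>
      have : unitsSmul (σ ^ 0) u = u := by ext; simp
      rwa [this]
    | succ i ih =>
      have : unitsSmul (σ ^ (i + 1)) u = unitsSmul σ (unitsSmul (σ ^ i) u) := by
        ext; simp [pow_succ', mul_smul]
      rw [this]
      exact hWσ n _ ih
  have hΛW : ∀ n, ∀ u ∈ W n, ∀ x ∈ Λ, x * (u : Q) ∈ Λ := by
    rintro n u ⟨y, hy, hu⟩ x hx
    rw [hu, mul_add, mul_one, mul_left_comm]
    exact add_mem hx (hOΛ _ (by omega) _ (mul_mem (hΛO x hx) (hΛO y hy)))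
  have hclose : ∀ n, ∀ u v : Qˣ, v ∈ W n → ∀ x ∈ Λ, (u : Q) - v = ϖ ^ (c + 2 * n + 2) * x →
      u / v ∈ W (n + 1) := by
    intro n u v hv x hx h
    refine ⟨ϖ ^ n * (x * ((v⁻¹ : Qˣ) : Q)), hΛp n _ (hΛW n _ (inv_mem hv) x hx), ?_⟩
    have : (u : Q) = v + ϖ ^ (c + 2 * n + 2) * x := by rw [← h]; ring
    rw [Units.val_div_eq_div_val, this, Units.val_inv_eq_inv_val]
    field_simp
    ring
  have hWn : ∀ n, ∀ w ∈ W n, ‖(w : Q) - 1‖ ≤ ‖ϖ‖ ^ n := by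
    rintro n w ⟨x, hx, hw⟩
    rw [hw, add_sub_cancel_left, norm_mul, norm_pow]
    calc _ ≤ ‖ϖ‖ ^ (c + n + 1) * 1 := by gcongr; exact hΛ1 x hx
      _ = ‖ϖ‖ ^ (c + n + 1) := mul_one _
      _ ≤ ‖ϖ‖ ^ n := pow_le_pow_of_le_one hr0.le h1.le (by omega)
  have hcont : ∀ g : G, Continuous fun x : Q => g • x := fun g =>
    (AddMonoidHomClass.isometry_of_norm (DistribSMul.toAddMonoidHom Q g) (hiso g)).continuous
  have hclosed : IsClosed (Λ : Set Q) := by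
    refine isClosed_of_closure_subset fun x hx => ?_
    have hxT : ∀ t ∈ T, t • x = x := by
      intro t ht
      have hcl : IsClosed {x : Q | t • x = x} := isClosed_eq (hcont t) continuous_id
      exact closure_minimal (fun y hy => hΛT y hy t ht) hcl hx
    obtain ⟨y, hy, hxy⟩ := Metric.mem_closure_iff.1 hx (‖ϖ‖ ^ c) (by positivity)
    rw [dist_eq_norm] at hxy
    have := hΛ2 (x - y) (fun t ht => by rw [smul_sub, hxT t ht, hΛT y hy t ht]) hxy.le
    have := add_mem this hy
    rwa [sub_add_cancel] at this
  have himage : (fun u : Qˣ => (u : Q)) '' (W 0 : Set Qˣ) =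
      (fun q : Q => (q - 1) / ϖ ^ (c + 1)) ⁻¹' Λ := by
    have hp : ϖ ^ (c + 1) ≠ 0 := pow_ne_zero _ h0
    ext q
    constructor
    · rintro ⟨u, ⟨x, hx, hu⟩, rfl⟩
      show ((u : Q) - 1) / ϖ ^ (c + 1) ∈ Λ
      rw [hu, add_sub_cancel_left, add_zero, mul_div_cancel_left₀ _ hp]
      exact hx
    · intro hq
      obtain ⟨w, hw, h⟩ := hmk 0 _ hq
      refine ⟨w, hw, ?_⟩
      simp only
      rw [h, add_zero, mul_div_cancel₀ _ hp]
      ring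
  have hcpt : IsCompact ((fun u : Qˣ => (u : Q)) '' (W 0 : Set Qˣ)) := by
    refine (isCompact_closedBall (0 : Q) 1).of_isClosed_subset ?_ ?_
    · rw [himage]
      exact hclosed.preimage (by fun_prop)
    · rintro _ ⟨u, hu, rfl⟩
      rw [mem_closedBall_zero_iff]
      exact (mem_unitSphere.1 (hsph hu)).2.le
  have hexp : ∀ n, ∀ x ∈ Λ, ∃ y ∈ Λ, partialNorm σ m (1 + ϖ ^ (c + n + 1) * x) =
      1 + ϖ ^ (c + n + 1) * ∑ i ∈ Finset.range m, σ ^ i • x + ϖ ^ (c + 2 * n + 2) * y := by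
    intro n x hx
    obtain ⟨z, hz, h⟩ := partialNorm_one_add hiso σ (hpow (c + n + 1)) (hpow1 _) (hΛO x hx) m
    refine ⟨ϖ ^ c * z, hOΛ c le_rfl z hz, ?_⟩
    rw [h]
    ring
  have hNcont : Continuous fun x : Q => partialNorm σ m x :=
    continuous_finsetProd _ fun i _ => hcont _
  have hdivn : ∀ (a b : Qˣ), a ∈ W 0 → b ∈ W 0 → ‖(b : Q) - a‖ = ‖((a / b : Qˣ) : Q) - 1‖ := by
    intro a b ha hb
    have e : ((a / b : Qˣ) : Q) - 1 = (a - b) / b := by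
      rw [Units.val_div_eq_div_val, sub_div, div_self b.ne_zero]
    rw [e, norm_div, (mem_unitSphere.1 (hsph hb)).2, div_one, norm_sub_rev]
  refine ⟨W 0, hsph, hWσ 0, ?_, ?_, ‖ϖ‖ ^ (2 * c + 1), by positivity, ?_⟩
  · intro v hv hv1
    refine exists_map_eq_of_approx (Z := (unitsSmulDiv σ).ker) hanti h1 hWn hcpt ?_ hv hv1
      (F := fun x => partialNorm σ m x - v) (hNcont.sub continuous_const) ?_
    · rintro n u ⟨x, hx, hu⟩ hu1
      have hσu : σ • (u : Q) = u := by
        have := congr_arg (fun y : Qˣ => (y : Q)) (MonoidHom.mem_ker.1 hu1)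
        simpa [div_eq_one_iff_eq u.ne_zero] using this
      have hσx : σ • x = x := by
        rw [hu, smul_add, smul_one, smul_mul', hpow] at hσu
        exact mul_left_cancel₀ (pow_ne_zero _ h0) (add_left_cancel hσu)
      obtain ⟨y, hy, hyx⟩ := hΛ4 x hx hσx
      obtain ⟨w, hw, hwy⟩ := hmk n y hy
      obtain ⟨z, hz, hNw⟩ := hexp n y hy
      refine ⟨w, hw, hclose n _ _ (hWN n w hw) (-z) (neg_mem hz) ?_, ?_⟩
      · rw [coe_unitsPartialNorm, hwy, hNw, hyx, hu]
        ring
      · have h2 : unitsPartialNorm σ m w ∈ (unitsSmulDiv σ).ker := by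
          rw [MonoidHom.mem_ker, Units.ext_iff, coe_unitsSmulDiv, coe_unitsPartialNorm,
            smul_self_partialNorm σ m ((mem_unitSphere.1 (hsph (hle n hw))).1 _
              ((hσ m).2 dvd_rfl)), div_self (partialNorm_ne_zero _ _ w.ne_zero), Units.val_one]
        exact div_mem hu1 h2
    · intro w hw
      exact hdivn _ _ hv (hWN 0 w hw)
  · intro v hv hv1
    have hWD : ∀ n, ∀ w ∈ W n, unitsSmulDiv σ w ∈ W n := fun n w hw =>
      div_mem (hWσ n w hw) hw
    refine exists_map_eq_of_approx (Z := (unitsPartialNorm σ m).ker) hanti h1 hWn hcpt ?_ hv hv1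
      (F := fun x => σ • x - v * x) ((hcont σ).sub (continuous_const.mul continuous_id)) ?_
    · rintro n u ⟨x, hx, hu⟩ hu1
      obtain ⟨z, hz, hN⟩ := hexp n x hx
      have hN1 : partialNorm σ m (u : Q) = 1 := congr_arg (fun y : Qˣ => (y : Q)) hu1
      have hp : ∀ j, ϖ ^ j ≠ 0 := fun j => pow_ne_zero _ h0
      set s := ∑ i ∈ Finset.range m, σ ^ i • x with hs
      have hsz : s = -(ϖ ^ (n + 1) * z) := by
        rw [hu, hN, add_assoc, add_eq_left] at hN1
        apply mul_left_cancel₀ (hp (c + n + 1))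
        rw [eq_neg_of_add_eq_zero_left hN1]
        ring
      have hσs : σ • s = s := by
        have hxm : σ ^ m • x = x := hΛT x hx _ ((hσ m).2 dvd_rfl)
        have h2 := Finset.sum_range_succ (fun i => σ ^ i • x) m
        rw [Finset.sum_range_succ', hxm, pow_zero, one_smul] at h2
        rw [hs, Finset.smul_sum, ← add_right_cancel h2]
        exact Finset.sum_congr rfl fun i _ => by rw [smul_smul, pow_succ']
      have hσz : σ • z = z := by
        rw [hsz, smul_neg, smul_mul', hpow, neg_inj] at hσs
        exact mul_left_cancel₀ (hp _) hσs
      obtain ⟨y', hy', hyz⟩ := hΛ4 z hz hσz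
      obtain ⟨y, hy, hyx⟩ := hΛ5 (x + ϖ ^ (n + 1) * y') (add_mem hx (hΛp _ _ hy')) (by
        simp only [smul_add, smul_mul', hpow, Finset.sum_add_distrib, ← Finset.mul_sum, hyz]
        rw [← hs, hsz, neg_add_cancel])
      obtain ⟨w, hw, hwy⟩ := hmk n y hy
      refine ⟨w, hw, hclose n _ _ (hWD n w hw) _ (hΛW n _ (inv_mem hw)
        (ϖ ^ (c + 0) * (x * y) - y') (sub_mem (hOΛ _ (by omega) _ (mul_mem (hΛO x hx) (hΛO y hy)))
          hy')) ?_, ?_⟩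
      · have hσy : σ • y = y + (x + ϖ ^ (n + 1) * y') := by rw [← hyx]; ring
        rw [coe_unitsSmulDiv, Units.val_inv_eq_inv_val]
        rw [sub_eq_iff_eq_add, ← mul_assoc, ← div_eq_mul_inv, ← add_div, eq_div_iff w.ne_zero, hwy,
          hu, smul_add, smul_one, smul_mul', hpow, hσy]
        ring
      · refine div_mem hu1 ?_
        have hwm : σ ^ m • (w : Q) = w :=
          (mem_unitSphere.1 (hsph (hle n hw))).1 _ ((hσ m).2 dvd_rfl)
        rw [MonoidHom.mem_ker, Units.ext_iff, coe_unitsPartialNorm, coe_unitsSmulDiv,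
          div_eq_mul_inv, partialNorm_mul, partialNorm_inv, ← smul_partialNorm,
          smul_self_partialNorm σ m hwm, mul_inv_cancel₀ (partialNorm_ne_zero _ _ w.ne_zero),
          Units.val_one]
    · intro w hw
      rw [← hdivn _ _ hv (hWD 0 w hw), coe_unitsSmulDiv]
      have e : σ • (w : Q) - v * w = (σ • (w : Q) / w - v) * w := by
        rw [sub_mul, div_mul_cancel₀ _ w.ne_zero]
      rw [e, norm_mul, (mem_unitSphere.1 (hsph hw)).2, mul_one]
  · intro u hu hlt
    have hp : ϖ ^ (c + 1) ≠ 0 := pow_ne_zero _ h0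
    refine ⟨((u : Q) - 1) / ϖ ^ (c + 1), hΛ2 _ ?_ ?_, ?_⟩
    · intro t ht
      rw [div_eq_mul_inv, smul_mul', smul_inv₀', hpow, smul_sub, smul_one,
        (mem_unitSphere.1 hu).1 t ht]
    · rw [norm_div, norm_pow, div_le_iff₀ (by positivity), ← pow_add]
      exact hlt.le.trans (by rw [two_mul, add_assoc])
    · rw [add_zero, mul_div_cancel₀ _ hp]
      ring

end Trivial

section HerbrandQuotient

variable {G Q : Type*} [CommGroup G] [NormedField Q] [MulSemiringAction G Q]

theorem relIndex_map_map_of_le {X Y : Type*} [CommGroup X] [Group Y] (f : X →* Y)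
    {H K : Subgroup X} (hHK : H ≤ K) :
    (H.map f).relIndex (K.map f) = (H ⊔ (f.ker ⊓ K)).relIndex K := by
  rw [Subgroup.relIndex_map_map, ← sup_inf_assoc_of_le _ hHK, Subgroup.inf_relIndex_right]
  have : K ⊔ f.ker = (H ⊔ f.ker) ⊔ K := by
    rw [sup_right_comm, sup_eq_right.2 hHK]
  rw [this, Subgroup.relIndex_sup_left]

theorem mem_fixedUnits_sup {T : Subgroup G} {σ : G} {u : Qˣ} :
    u ∈ fixedUnits Q (T ⊔ Subgroup.zpowers σ) ↔ u ∈ fixedUnits Q T ∧ σ • (u : Q) = u := by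
  constructor
  · intro h
    exact ⟨fun t ht => h t (Subgroup.mem_sup_left ht),
      h σ (Subgroup.mem_sup_right (Subgroup.mem_zpowers σ))⟩
  · rintro ⟨h1, h2⟩
    have hle : T ⊔ Subgroup.zpowers σ ≤ MulAction.stabilizer G (u : Q) :=
      sup_le h1 (by rwa [Subgroup.zpowers_le])
    exact fun t ht => hle ht

theorem mem_ker_unitsSmulDiv {σ : G} {u : Qˣ} :
    u ∈ (unitsSmulDiv σ : Qˣ →* Qˣ).ker ↔ σ • (u : Q) = u := by
  rw [MonoidHom.mem_ker, Units.ext_iff, coe_unitsSmulDiv, Units.val_one,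
    div_eq_one_iff_eq u.ne_zero]

theorem fixedUnits_anti {S T : Subgroup G} (h : T ≤ S) : fixedUnits Q S ≤ fixedUnits Q T :=
  fun _ hu t ht => hu t (h ht)

theorem smul_mem_fixedUnits {T : Subgroup G} (g : G) {u : Qˣ} (hu : u ∈ fixedUnits Q T) :
    unitsSmul g u ∈ fixedUnits Q T := fun t ht => by
  rw [coe_unitsSmul, smul_smul, mul_comm, mul_smul, hu t ht]

theorem smul_mem_unitSphere (hiso : ∀ (g : G) (x : Q), ‖g • x‖ = ‖x‖) {T : Subgroup G} (g : G)
    {u : Qˣ} (hu : u ∈ unitSphere Q T) : unitsSmul g u ∈ unitSphere Q T := by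
  rw [mem_unitSphere] at hu ⊢
  exact ⟨smul_mem_fixedUnits g hu.1, by rw [coe_unitsSmul, hiso, hu.2]⟩

theorem unitsPartialNorm_mem_unitSphere (hiso : ∀ (g : G) (x : Q), ‖g • x‖ = ‖x‖)
    {T : Subgroup G} (σ : G) (m : ℕ) {u : Qˣ} (hu : u ∈ unitSphere Q T) :
    unitsPartialNorm σ m u ∈ unitSphere Q T := by
  rw [unitsPartialNorm_eq_prod]
  exact Subgroup.prod_mem _ fun i _ => smul_mem_unitSphere hiso _ hu

variable [IsUltrametricDist Q] [ProperSpace Q]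

theorem finiteIndex_of_ball {T : Subgroup G} {V : Subgroup Qˣ} {ε : ℝ} (hε : 0 < ε)
    (hV : ∀ u ∈ unitSphere Q T, ‖(u : Q) - 1‖ < ε → u ∈ V) :
    (V.subgroupOf (unitSphere Q T)).FiniteIndex := by
  obtain ⟨t, ht, hcov⟩ := Metric.totallyBounded_iff.1
    (isCompact_closedBall (0 : Q) 1).totallyBounded ε hε
  have hc : ∀ u : unitSphere Q T, ∃ y ∈ t, ‖((u : Qˣ) : Q) - y‖ < ε := by
    intro u
    have h1 : ((u : Qˣ) : Q) ∈ Metric.closedBall (0 : Q) 1 := by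
      rw [mem_closedBall_zero_iff]; exact (mem_unitSphere.1 u.2).2.le
    obtain ⟨y, hy, h2⟩ := Set.mem_iUnion₂.1 (hcov h1)
    exact ⟨y, hy, by rwa [← dist_eq_norm]⟩
  choose y hy hyε using hc
  have := ht.to_subtype
  have : Finite (unitSphere Q T ⧸ V.subgroupOf (unitSphere Q T)) := by
    refine Finite.of_injective (fun q => (⟨y q.out, hy q.out⟩ : t)) fun a b hab => ?_
    have hab' : y a.out = y b.out := congr_arg Subtype.val hab
    have h3 : ‖((a.out : Qˣ) : Q) - ((b.out : Qˣ) : Q)‖ < ε := by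
      have : ((a.out : Qˣ) : Q) - ((b.out : Qˣ) : Q) =
        (((a.out : Qˣ) : Q) - y a.out) - (((b.out : Qˣ) : Q) - y b.out) := by
        rw [hab']; ring
      rw [this]
      rw [sub_eq_add_neg]
      exact (IsUltrametricDist.norm_add_le_max _ _).trans_lt
        (max_lt (hyε _) (by rw [norm_neg]; exact hyε _))
    rw [← Quotient.out_eq a, ← Quotient.out_eq b]
    refine (QuotientGroup.eq (s := V.subgroupOf (unitSphere Q T))).2 ?_
    rw [Subgroup.mem_subgroupOf]
    refine hV _ (SetLike.coe_mem _) ?_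
    have h4 : (((a.out⁻¹ * b.out : unitSphere Q T) : Qˣ) : Q) - 1 =
        (((b.out : Qˣ) : Q) - ((a.out : Qˣ) : Q)) / ((a.out : Qˣ) : Q) := by
      rw [sub_div, div_self (Units.ne_zero _)]
      push_cast
      rw [mul_comm, div_eq_mul_inv]
    rw [h4, norm_div, (mem_unitSphere.1 a.out.2).2, div_one, norm_sub_rev]
    exact h3
  exact Subgroup.finiteIndex_of_finite_quotient

variable [Finite G] [FaithfulSMul G Q]

/-- The norm index of units in a cyclic extension is its ramification index. -/
theorem relIndex_unitsPartialNorm (hiso : ∀ (g : G) (x : Q), ‖g • x‖ = ‖x‖) {ϖ : Q}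
    (hϖ : ∀ g : G, g • ϖ = ϖ) (h0 : ϖ ≠ 0) (h1 : ‖ϖ‖ < 1)
    {T : Subgroup G} {σ : G} {m : ℕ} (hm : 0 < m) (hσ : ∀ i : ℕ, σ ^ i ∈ T ↔ m ∣ i) :
    ((unitSphere Q T).map (unitsPartialNorm σ m)).relIndex
        (unitSphere Q (T ⊔ Subgroup.zpowers σ)) =
      (normGroup Q (T ⊔ Subgroup.zpowers σ)).relIndex (normGroup Q T) ∧
    ((unitSphere Q T).map (unitsPartialNorm σ m)).relIndex
        (unitSphere Q (T ⊔ Subgroup.zpowers σ)) ≠ 0 := by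
  obtain ⟨V, hVU, hVσ, hV1, hV2, ε, hε, hVε⟩ :=
    exists_trivial_subgroup (Q := Q) hiso hϖ h0 h1 hm hσ
  set U := unitSphere Q T with hU
  have hUD : ∀ u ∈ U, unitsSmulDiv σ u ∈ U := fun u hu =>
    div_mem (smul_mem_unitSphere hiso σ hu) hu
  have hUN : ∀ u ∈ U, unitsPartialNorm σ m u ∈ U := fun u hu =>
    unitsPartialNorm_mem_unitSphere hiso σ m hu
  have hfix : ∀ u ∈ fixedUnits Q T, σ ^ m • (u : Q) = u := fun u hu => hu _ ((hσ m).2 dvd_rfl)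
  have hDN : ∀ u ∈ fixedUnits Q T, unitsSmulDiv σ (unitsPartialNorm σ m u) = 1 := fun u hu => by
    rw [← MonoidHom.mem_ker, mem_ker_unitsSmulDiv]
    exact smul_self_partialNorm σ m (hfix u hu)
  have hND : ∀ u ∈ fixedUnits Q T, unitsPartialNorm σ m (unitsSmulDiv σ u) = 1 := fun u hu => by
    rw [Units.ext_iff, coe_unitsPartialNorm, coe_unitsSmulDiv,
      div_eq_mul_inv, partialNorm_mul, partialNorm_inv, ← smul_partialNorm,
      smul_self_partialNorm σ m (hfix u hu),
      mul_inv_cancel₀ (partialNorm_ne_zero _ _ u.ne_zero), Units.val_one]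
  let D : U →* U := ((unitsSmulDiv σ).comp U.subtype).codRestrict U fun u => hUD u u.2
  let N : U →* U := ((unitsPartialNorm σ m).comp U.subtype).codRestrict U fun u => hUN u u.2
  have hVN : ∀ u ∈ V, unitsPartialNorm σ m u ∈ V := by
    intro u hu
    rw [unitsPartialNorm_eq_prod]
    refine Subgroup.prod_mem _ fun i hi => ?_
    clear hi
    induction i with
    | zero =>
      have : unitsSmul (σ ^ 0) u = u := by ext; simp
      rwa [this]
    | succ i ih =>
      have : unitsSmul (σ ^ (i + 1)) u = unitsSmul σ (unitsSmul (σ ^ i) u) := by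
        ext; simp [pow_succ', mul_smul]
      rw [this]
      exact hVσ _ ih
  have := finiteIndex_of_ball hε hVε
  have main := relIndex_range_ker_eq D N (V.subgroupOf U)
    (fun u => Subtype.ext (hND u (mem_unitSphere.1 u.2).1))
    (fun u => Subtype.ext (hDN u (mem_unitSphere.1 u.2).1))
    (fun v hv => hVN _ hv) (fun v hv => div_mem (hVσ _ hv) hv)
    (fun v hv h => by
      obtain ⟨w, hw, h'⟩ := hV1 v hv (congr_arg Subtype.val h)
      exact ⟨⟨w, hVU hw⟩, hw, Subtype.ext h'⟩)
    (fun v hv h => by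
      obtain ⟨w, hw, h'⟩ := hV2 v hv (congr_arg Subtype.val h)
      exact ⟨⟨w, hVU hw⟩, hw, Subtype.ext h'⟩)
  have hrange : ∀ (f : Qˣ →* Qˣ) (g : U →* U), (∀ u, (g u : Qˣ) = f u) →
      g.range.map U.subtype = U.map f := by
    intro f g hfg
    ext x
    constructor
    · rintro ⟨_, ⟨u, rfl⟩, rfl⟩
      exact ⟨u, u.2, (hfg u).symm⟩
    · rintro ⟨u, hu, rfl⟩
      exact ⟨_, ⟨⟨u, hu⟩, rfl⟩, hfg _⟩
  have hker : ∀ (f : Qˣ →* Qˣ) (g : U →* U), (∀ u, (g u : Qˣ) = f u) →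
      g.ker.map U.subtype = f.ker ⊓ U := by
    intro f g hfg
    ext x
    constructor
    · rintro ⟨u, hu, rfl⟩
      exact ⟨(hfg u).symm.trans (congr_arg Subtype.val hu), u.2⟩
    · rintro ⟨h, hu⟩
      exact ⟨⟨x, hu⟩, Subtype.ext ((hfg _).trans h), rfl⟩
  have hS : (unitsSmulDiv σ).ker ⊓ U = unitSphere Q (T ⊔ Subgroup.zpowers σ) := by
    ext u
    rw [Subgroup.mem_inf, mem_ker_unitsSmulDiv, hU, unitSphere, unitSphere, Subgroup.mem_inf,
      Subgroup.mem_inf, mem_fixedUnits_sup]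
    tauto
  have hN90 : (unitsPartialNorm σ m).ker ⊓ U = (fixedUnits Q T).map (unitsSmulDiv σ) := by
    ext u
    constructor
    · rintro ⟨h2, h3⟩
      obtain ⟨y, hy0, hyT, hy⟩ := exists_eq_smul_div (Q := Q) hm hσ u.ne_zero
        (mem_unitSphere.1 h3).1 (congr_arg Units.val h2)
      refine ⟨Units.mk0 y hy0, hyT, ?_⟩
      rw [Units.ext_iff, coe_unitsSmulDiv, Units.val_mk0, hy, mul_div_cancel_right₀ _ hy0]
    · rintro ⟨y, hy, rfl⟩
      refine ⟨hND y hy, ?_⟩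
      refine mem_unitSphere.2 ⟨div_mem (smul_mem_fixedUnits σ hy) hy, ?_⟩
      rw [coe_unitsSmulDiv, norm_div, hiso, div_self (norm_ne_zero_iff.2 y.ne_zero)]
  have e1 : N.range.relIndex D.ker = (U.map (unitsPartialNorm σ m)).relIndex
      (unitSphere Q (T ⊔ Subgroup.zpowers σ)) := by
    rw [← Subgroup.relIndex_map_map_of_injective _ _ U.subtype_injective, hrange (unitsPartialNorm σ m) N fun _ => rfl, hker (unitsSmulDiv σ) D fun _ => rfl,
      hS]
  have e2 : D.range.relIndex N.ker = (normGroup Q (T ⊔ Subgroup.zpowers σ)).relIndex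
      (normGroup Q T) := by
    rw [← Subgroup.relIndex_map_map_of_injective _ _ U.subtype_injective, hrange (unitsSmulDiv σ) D fun _ => rfl, hker (unitsPartialNorm σ m) N fun _ => rfl,
      hN90, relIndex_map_map_of_le _ (hU.trans_le inf_le_left), normGroup, normGroup,
      relIndex_map_map_of_le _ (fixedUnits_anti le_sup_left)]
    congr 1
    have h5 : (unitsSmulDiv σ).ker ⊓ fixedUnits Q T = fixedUnits Q (T ⊔ Subgroup.zpowers σ) := by
      ext u
      rw [Subgroup.mem_inf, mem_ker_unitsSmulDiv, mem_fixedUnits_sup, and_comm]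
    rw [h5, hU, unitSphere, sup_comm, inf_comm]
  rw [← e1, ← e2]
  exact main

end HerbrandQuotient

/-- A finite abelian group of isometries of a local field, decomposed as the product of a subgroup
`N` and a cyclic group generated by `φ` such that the extensions obtained by adding `φ` are
unramified and the fixed field of `φ` is totally ramified. -/
structure UnramifiedSplitting {G Q : Type*} [CommGroup G] [NormedField Q] [MulSemiringAction G Q]
    (N : Subgroup G) (φ : G) (pr : G →* G) (r n : ℕ) (ϖ : Q) : Prop where
  norm_smul : ∀ (g : G) (x : Q), ‖g • x‖ = ‖x‖
  smul_unif : ∀ g : G, g • ϖ = ϖ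
  unif_ne_zero : ϖ ≠ 0
  norm_unif_lt_one : ‖ϖ‖ < 1
  pr_mem : ∀ g, pr g ∈ N
  pr_of_mem : ∀ g ∈ N, pr g = g
  pr_frob : pr φ = 1
  exists_pow : ∀ g, ∃ i : ℕ, g = pr g * φ ^ i
  pow_eq_one_iff : ∀ i : ℕ, φ ^ i = 1 ↔ r ∣ i
  order_pos : 0 < r
  card_dvd : Nat.card N ∣ r
  exp_pos : 0 < n
  pow_exp : ∀ g ∈ N, g ^ n = 1
  unram : ∀ H ≤ N, normGroup Q H ≤ normGroup Q (H ⊔ Subgroup.zpowers φ)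
  ram : ∀ H : Subgroup G, φ ∈ H → normGroup Q H ≤ normGroup Q (⊤ : Subgroup G) → H = ⊤

namespace UnramifiedSplitting

variable {G Q : Type*} [CommGroup G] [NormedField Q] [MulSemiringAction G Q]
  {N : Subgroup G} {φ : G} {pr : G →* G} {r n : ℕ} {ϖ : Q}

theorem pow_mem_iff (h : UnramifiedSplitting N φ pr r n ϖ) {H : Subgroup G} (hH : H ≤ N) (i : ℕ) :
    φ ^ i ∈ H ↔ r ∣ i := by
  rw [← h.pow_eq_one_iff]
  constructor
  · intro hi
    rw [← h.pr_of_mem _ (hH hi), map_pow, h.pr_frob, one_pow]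
  · intro hi
    rw [hi]
    exact one_mem _

theorem sup_zpowers (h : UnramifiedSplitting N φ pr r n ϖ) : N ⊔ Subgroup.zpowers φ = ⊤ := by
  rw [eq_top_iff]
  intro g _
  obtain ⟨i, hi⟩ := h.exists_pow g
  rw [hi]
  exact Subgroup.mul_mem_sup (h.pr_mem g) (Subgroup.pow_mem _ (Subgroup.mem_zpowers φ) i)

theorem pr_mem_of_mem_sup (h : UnramifiedSplitting N φ pr r n ϖ) {T : Subgroup G} (hT : T ≤ N)
    {g : G} (hg : g ∈ T ⊔ Subgroup.zpowers φ) : pr g ∈ T := by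
  have : T ⊔ Subgroup.zpowers φ ≤ T.comap pr := by
    refine sup_le (fun t ht => ?_) ?_
    · rw [Subgroup.mem_comap, h.pr_of_mem t (hT ht)]
      exact ht
    · rw [Subgroup.zpowers_le, Subgroup.mem_comap, h.pr_frob]
      exact one_mem _
  exact this hg

theorem pow_mem_sup_iff (h : UnramifiedSplitting N φ pr r n ϖ) {T : Subgroup G} (hT : T ≤ N)
    {σ : G} (hσN : σ ∈ N) {m : ℕ} (hσ : ∀ i : ℕ, σ ^ i ∈ T ↔ m ∣ i) (i : ℕ) :
    σ ^ i ∈ T ⊔ Subgroup.zpowers φ ↔ m ∣ i := by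
  rw [← hσ]
  refine ⟨fun hi => ?_, fun hi => Subgroup.mem_sup_left hi⟩
  rw [← h.pr_of_mem _ (N.pow_mem hσN i)]
  exact h.pr_mem_of_mem_sup hT hi

theorem sup_sup_eq_top (h : UnramifiedSplitting N φ pr r n ϖ) {T : Subgroup G} {σ : G}
    (hTσ : T ⊔ Subgroup.zpowers σ = N) :
    T ⊔ Subgroup.zpowers φ ⊔ Subgroup.zpowers σ = ⊤ := by
  rw [sup_right_comm, hTσ, h.sup_zpowers]

theorem normGroup_anti {S T : Subgroup G} (h : T ≤ S) : normGroup Q S ≤ normGroup Q T :=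
  Subgroup.map_mono (fixedUnits_anti h)

variable [Finite G] [IsUltrametricDist Q] [ProperSpace Q] [FaithfulSMul G Q]

/-- Units are norms in unramified extensions. -/
theorem exists_unitsPartialNorm_frob_eq (h : UnramifiedSplitting N φ pr r n ϖ) {u : Qˣ}
    (hu : u ∈ unitSphere Q (⊤ : Subgroup G)) :
    ∃ v ∈ unitSphere Q N, unitsPartialNorm φ r v = u := by
  have := (relIndex_unitsPartialNorm h.norm_smul h.smul_unif h.unif_ne_zero h.norm_unif_lt_one
    h.order_pos (h.pow_mem_iff le_rfl)).1
  rw [Subgroup.relIndex_eq_one.2 (h.unram N le_rfl), Subgroup.relIndex_eq_one, h.sup_zpowers]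
    at this
  exact this hu

theorem exists_unitsPartialNorm_eq (h : UnramifiedSplitting N φ pr r n ϖ) {T : Subgroup G}
    {σ : G} {m : ℕ} (hm : 0 < m) (hσ : ∀ i : ℕ, σ ^ i ∈ T ↔ m ∣ i)
    (hTσ : T ⊔ Subgroup.zpowers σ = N) (hmr : m ∣ r) {u : Qˣ}
    (hu : u ∈ unitSphere Q (⊤ : Subgroup G)) :
    ∃ v ∈ unitSphere Q T, unitsPartialNorm σ m v = u := by
  have hT : T ≤ N := hTσ ▸ le_sup_left
  have hσN : σ ∈ N := hTσ ▸ Subgroup.mem_sup_right (Subgroup.mem_zpowers σ)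
  have e1 := relIndex_unitsPartialNorm h.norm_smul h.smul_unif h.unif_ne_zero h.norm_unif_lt_one
    hm hσ
  have e2 := (relIndex_unitsPartialNorm h.norm_smul h.smul_unif h.unif_ne_zero h.norm_unif_lt_one
    hm (h.pow_mem_sup_iff hT hσN hσ)).1
  rw [h.sup_sup_eq_top hTσ] at e2
  rw [hTσ] at e1
  have hn1 : normGroup Q (T ⊔ Subgroup.zpowers φ) = normGroup Q T :=
    le_antisymm (normGroup_anti le_sup_left) (h.unram T hT)
  have hn2 : normGroup Q (⊤ : Subgroup G) = normGroup Q N :=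
    le_antisymm (normGroup_anti le_top) (h.sup_zpowers ▸ h.unram N le_rfl)
  rw [hn1, hn2, ← e1.1] at e2
  set A := unitSphere Q N
  set A' := unitSphere Q (⊤ : Subgroup G)
  set B := (unitSphere Q T).map (unitsPartialNorm σ m)
  set B' := (unitSphere Q (T ⊔ Subgroup.zpowers φ)).map (unitsPartialNorm σ m)
  have hcomm : ∀ v : Qˣ, unitsPartialNorm φ r (unitsPartialNorm σ m v) =
      unitsPartialNorm σ m (unitsPartialNorm φ r v) := by
    intro v
    rw [unitsPartialNorm_eq_prod φ, unitsPartialNorm_eq_prod φ, map_prod]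
    refine Finset.prod_congr rfl fun i _ => ?_
    ext
    exact smul_partialNorm _ _ _ _
  have hsup : ∀ {H : Subgroup G}, H ≤ N → ∀ v ∈ unitSphere Q H,
      unitsPartialNorm φ r v ∈ unitSphere Q (H ⊔ Subgroup.zpowers φ) := by
    intro H hH v hv
    have h1 := unitsPartialNorm_mem_unitSphere h.norm_smul φ r hv
    rw [mem_unitSphere] at h1 ⊢
    refine ⟨mem_fixedUnits_sup.2 ⟨h1.1, ?_⟩, h1.2⟩
    rw [coe_unitsPartialNorm]
    exact smul_self_partialNorm φ r ((mem_unitSphere.1 hv).1 _ ((h.pow_mem_iff hH r).2 dvd_rfl))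
  have hAA' : A.map (unitsPartialNorm φ r) = A' := by
    apply le_antisymm
    · rintro _ ⟨v, hv, rfl⟩
      have := hsup le_rfl v hv
      rwa [h.sup_zpowers] at this
    · intro w hw
      obtain ⟨v, hv, hvw⟩ := h.exists_unitsPartialNorm_frob_eq hw
      exact ⟨v, hv, hvw⟩
  let C := B'.comap (unitsPartialNorm φ r) ⊓ A
  have hBC : B ≤ C := by
    rintro _ ⟨v, hv, rfl⟩
    refine ⟨?_, ?_⟩
    · show unitsPartialNorm φ r (unitsPartialNorm σ m v) ∈ B'
      rw [hcomm]
      exact ⟨_, hsup hT v hv, rfl⟩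
    · have h1 := unitsPartialNorm_mem_unitSphere h.norm_smul σ m hv
      rw [mem_unitSphere] at h1
      refine mem_unitSphere.2 ⟨?_, h1.2⟩
      rw [← hTσ]
      refine mem_fixedUnits_sup.2 ⟨h1.1, ?_⟩
      rw [coe_unitsPartialNorm]
      exact smul_self_partialNorm σ m ((mem_unitSphere.1 hv).1 _ ((hσ m).2 dvd_rfl))
  have hCA : C.relIndex A = B.relIndex A := by
    rw [Subgroup.inf_relIndex_right, Subgroup.relIndex_comap, hAA', e2]
  have hCB : C ≤ B := by
    rw [← Subgroup.relIndex_eq_one]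
    have := Subgroup.relIndex_mul_relIndex B C A hBC inf_le_right
    rw [hCA] at this
    exact Nat.eq_of_mul_eq_mul_right (Nat.pos_of_ne_zero e1.2) (by rw [this, one_mul])
  obtain ⟨q, hq⟩ := hmr
  have hfix : ∀ g : G, g • (u : Q) = u := fun g => (mem_unitSphere.1 hu).1 g (Subgroup.mem_top g)
  have huC : u ∈ C := by
    refine ⟨?_, ?_⟩
    · refine ⟨u ^ q, pow_mem ?_ q, ?_⟩
      · exact mem_unitSphere.2 ⟨fun t _ => hfix t, (mem_unitSphere.1 hu).2⟩
      · ext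
        rw [coe_unitsPartialNorm, coe_unitsPartialNorm, partialNorm_of_fixed _ _ (hfix φ),
          partialNorm_of_fixed _ _ (by rw [Units.val_pow_eq_pow_val, smul_pow', hfix]), hq,
          Units.val_pow_eq_pow_val, ← pow_mul, mul_comm]
    · exact mem_unitSphere.2 ⟨fun t _ => hfix t, (mem_unitSphere.1 hu).2⟩
  obtain ⟨v, hv, hvu⟩ := hCB huC
  exact ⟨v, hv, hvu⟩

end UnramifiedSplitting

/-- The kernel of a character restricted to a subgroup is the kernel of a cyclic quotient. -/
theorem exists_ker_character {G : Type*} [CommGroup G] [Finite G] (N : Subgroup G)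
    (χ : G →* ℂˣ) : ∃ (T : Subgroup G) (σ : G) (m : ℕ), T ≤ N ∧ σ ∈ N ∧ 0 < m ∧
      (∀ i : ℕ, σ ^ i ∈ T ↔ m ∣ i) ∧ T ⊔ Subgroup.zpowers σ = N ∧ (∀ g ∈ N, g ∈ T ↔ χ g = 1) ∧
      orderOf (χ σ) = m ∧ m ∣ Nat.card N := by
  have hfin : Finite (N.map χ) := by
    have := Finite.of_surjective (fun x : N => (⟨χ x, x, x.2, rfl⟩ : N.map χ))
      (by rintro ⟨_, x, hx, rfl⟩; exact ⟨⟨x, hx⟩, rfl⟩)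
    exact this
  have hcyc : IsCyclic (N.map χ) := inferInstance
  obtain ⟨⟨_, σ, hσN, rfl⟩, hgen⟩ := hcyc.exists_generator
  have hiff : ∀ i : ℕ, σ ^ i ∈ χ.ker ⊓ N ↔ orderOf (χ σ) ∣ i := by
    intro i
    rw [orderOf_dvd_iff_pow_eq_one, ← map_pow, Subgroup.mem_inf, MonoidHom.mem_ker]
    exact ⟨fun h => h.1, fun h => ⟨h, N.pow_mem hσN i⟩⟩
  refine ⟨χ.ker ⊓ N, σ, orderOf (χ σ), inf_le_right, hσN, ?_, hiff, ?_, ?_, rfl, ?_⟩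
  · rw [orderOf_pos_iff]
    exact χ.isOfFinOrder (isOfFinOrder_of_finite σ)
  · apply le_antisymm (sup_le inf_le_right (by rwa [Subgroup.zpowers_le]))
    intro g hg
    obtain ⟨k, hk⟩ := hgen ⟨χ g, g, hg, rfl⟩
    have hk' : χ σ ^ k = χ g := congr_arg Subtype.val hk
    have : g = (g * (σ ^ k)⁻¹) * σ ^ k := by group
    rw [this]
    refine Subgroup.mul_mem_sup ⟨?_, N.mul_mem hg (N.inv_mem (N.zpow_mem hσN k))⟩
      (Subgroup.zpow_mem _ (Subgroup.mem_zpowers σ) k)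
    show χ _ = 1
    rw [map_mul, map_inv, map_zpow, hk', mul_inv_cancel]
  · intro g hg
    rw [Subgroup.mem_inf, MonoidHom.mem_ker]
    exact ⟨fun h => h.1, fun h => ⟨h, hg⟩⟩
  · exact (orderOf_map_dvd χ σ).trans (Subgroup.orderOf_dvd_natCard N hσN)

variable {G Q : Type*} [CommGroup G] [NormedField Q] [MulSemiringAction G Q]

theorem unitsSmul_unitsSmul (g h : G) (x : Qˣ) :
    unitsSmul g (unitsSmul h x) = unitsSmul (g * h) x := by
  ext
  simp [mul_smul]

theorem unitsSmul_one (x : Qˣ) : unitsSmul (1 : G) x = x := by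
  ext
  simp

theorem unitsSmulDiv_apply (g : G) (x : Qˣ) : unitsSmulDiv g x = unitsSmul g x / x := rfl

/-- `c` is a trivialisation over `N` of the cup product of the unit `u` with the cocycle defined by
the exponents `ℓ` modulo `n`, whose Frobenius coboundary is the coboundary of `y`. -/
def IsCupTrivialisation (N : Subgroup G) (φ : G) (n : ℕ) (ℓ : G → ℤ) (u y : Qˣ) (c : G → Qˣ) :
    Prop :=
  (∀ g ∈ N, ∀ h ∈ N, ∀ d : ℤ, ℓ g + ℓ h = ℓ (g * h) + n * d →
    c g * unitsSmul g (c h) = c (g * h) * u ^ d) ∧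
  ∀ g ∈ N, unitsSmulDiv φ (c g) = unitsSmulDiv g y

namespace IsCupTrivialisation

variable {N : Subgroup G} {φ : G} {n : ℕ} {ℓ : G → ℤ} {u u' y y' : Qˣ} {c c' : G → Qˣ}

theorem mul (h : IsCupTrivialisation N φ n ℓ u y c) (h' : IsCupTrivialisation N φ n ℓ u' y' c') :
    IsCupTrivialisation N φ n ℓ (u * u') (y * y') (c * c') := by
  refine ⟨fun a ha b hb d hd => ?_, fun a ha => ?_⟩
  · simp only [Pi.mul_apply, map_mul, mul_zpow]
    rw [mul_mul_mul_comm, h.1 a ha b hb d hd, h'.1 a ha b hb d hd, mul_mul_mul_comm]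
  · simp only [Pi.mul_apply, map_mul]
    rw [h.2 a ha, h'.2 a ha]

theorem inv (h : IsCupTrivialisation N φ n ℓ u y c) :
    IsCupTrivialisation N φ n ℓ u⁻¹ y⁻¹ c⁻¹ := by
  refine ⟨fun a ha b hb d hd => ?_, fun a ha => ?_⟩
  · simp only [Pi.inv_apply, map_inv, inv_zpow, ← mul_inv]
    rw [h.1 a ha b hb d hd]
  · simp only [Pi.inv_apply, map_inv]
    rw [h.2 a ha]

theorem add_exponents (hn : 0 < n) {ℓ' ℓ'' k : G → ℤ} (hu : ∀ g : G, unitsSmul g u = u)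
    (hℓ : ∀ g h : G, (n : ℤ) ∣ ℓ g + ℓ h - ℓ (g * h))
    (hℓ' : ∀ g h : G, (n : ℤ) ∣ ℓ' g + ℓ' h - ℓ' (g * h))
    (hk : ∀ g, ℓ g + ℓ' g = ℓ'' g + n * k g)
    (h : IsCupTrivialisation N φ n ℓ u y c) (h' : IsCupTrivialisation N φ n ℓ' u y' c') :
    IsCupTrivialisation N φ n ℓ'' u (y * y') (fun g => c g * c' g * u ^ (-k g)) := by
  refine ⟨fun a ha b hb d hd => ?_, fun a ha => ?_⟩
  · obtain ⟨d1, hd1⟩ := hℓ a b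
    obtain ⟨d2, hd2⟩ := hℓ' a b
    have e1 := h.1 a ha b hb d1 (by linarith)
    have e2 := h'.1 a ha b hb d2 (by linarith)
    have hd' : d = d1 + d2 - k a - k b + k (a * b) := by
      have hn' : (n : ℤ) ≠ 0 := by exact_mod_cast hn.ne'
      apply mul_left_cancel₀ hn'
      linear_combination hd1 + hd2 - hd - hk a - hk b + hk (a * b)
    simp only [map_mul, map_zpow, hu]
    rw [hd']
    have e3 := congr_arg Additive.ofMul e1
    have e4 := congr_arg Additive.ofMul e2
    apply Additive.ofMul.injective
    simp only [ofMul_mul, ofMul_zpow] at e3 e4 ⊢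
    linear_combination (norm := module) e3 + e4
  · simp only [map_mul, map_zpow]
    rw [h.2 a ha, h'.2 a ha, unitsSmulDiv_apply φ u, hu, div_self', one_zpow, mul_one]

end IsCupTrivialisation

namespace UnramifiedSplitting

variable {N : Subgroup G} {φ : G} {pr : G →* G} {r n : ℕ} {ϖ : Q}
  {ℓ : G → ℤ} {u y : Qˣ} {c : G → Qˣ}

theorem normGroup_sup_eq (h : UnramifiedSplitting N φ pr r n ϖ) {T : Subgroup G} (hT : T ≤ N) :
    normGroup Q (T ⊔ Subgroup.zpowers φ) = normGroup Q T :=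
  le_antisymm (normGroup_anti le_sup_left) (h.unram T hT)

variable [Finite G] [FaithfulSMul G Q]

/-- Hilbert 90 for a subgroup, in terms of units. -/
theorem exists_units_cocycle (T : Subgroup G) (c : G → Qˣ)
    (hc : ∀ g ∈ T, ∀ h ∈ T, c (g * h) = c g * unitsSmul g (c h)) :
    ∃ b : Qˣ, ∀ g ∈ T, c g * unitsSmul g b = b := by
  have : FaithfulSMul T Q := ⟨fun {a b} hab =>
    Subtype.ext (FaithfulSMul.eq_of_smul_eq_smul (α := Q) fun x => hab x)⟩
  obtain ⟨b, hb, hcb⟩ := exists_mul_smul_eq_of_cocycle (H := T) (fun g => (c g : Q))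
    (fun g => (c g).ne_zero) (fun g h => by
      have := congr_arg Units.val (hc g g.2 h h.2)
      exact this)
  refine ⟨Units.mk0 b hb, fun g hg => ?_⟩
  ext
  exact hcb ⟨g, hg⟩

theorem unitsNorm_mem_of_isCupTrivialisation_one (h : UnramifiedSplitting N φ pr r n ϖ)
    (hℓ : ∀ g h : G, (n : ℤ) ∣ ℓ g + ℓ h - ℓ (g * h))
    (hc : IsCupTrivialisation N φ n ℓ 1 y c) : unitsNorm Q y ∈ normGroup Q (⊤ : Subgroup G) := by
  obtain ⟨b, hb⟩ := exists_units_cocycle N c (fun g hg k hk => by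
    obtain ⟨d, hd⟩ := hℓ g k
    have := hc.1 g hg k hk d (by linarith)
    rw [one_zpow, mul_one] at this
    exact this.symm)
  have key : y * (unitsSmul φ b / b) ∈ fixedUnits Q N := by
    rw [mem_fixedUnits]
    intro g hg
    have e1 := hc.2 g hg
    have e2 := hb g hg
    have e3 : c g = b / unitsSmul g b := eq_div_of_mul_eq' e2
    rw [e3] at e1
    simp only [unitsSmulDiv_apply, map_div, unitsSmul_unitsSmul] at e1
    rw [← coe_unitsSmul]
    congr 1
    simp only [map_mul, map_div, unitsSmul_unitsSmul]
    rw [mul_comm g φ]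
    have e4 := congr_arg Additive.ofMul e1
    apply Additive.ofMul.injective
    simp only [ofMul_mul, ofMul_div] at e4 ⊢
    linear_combination (norm := module) -e4
  have : unitsNorm Q y = unitsNorm Q (y * (unitsSmul φ b / b)) := by
    ext
    simp [h.norm_smul]
  rw [this, ← h.sup_zpowers, h.normGroup_sup_eq le_rfl]
  exact ⟨_, key, rfl⟩

end UnramifiedSplitting

variable {G Q : Type*} [CommGroup G] [NormedField Q] [MulSemiringAction G Q]

theorem unitsSmulDiv_comm (g h : G) (x : Qˣ) :
    unitsSmulDiv g (unitsSmulDiv h x) = unitsSmulDiv h (unitsSmulDiv g x) := by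
  simp only [unitsSmulDiv_apply, map_div, unitsSmul_unitsSmul, mul_comm g h]
  apply Additive.ofMul.injective
  simp only [ofMul_div]
  module

theorem unitsPartialNorm_unitsSmulDiv (σ g : G) (a : ℕ) (x : Qˣ) :
    unitsPartialNorm σ a (unitsSmulDiv g x) = unitsSmulDiv g (unitsPartialNorm σ a x) := by
  rw [unitsSmulDiv_apply, unitsSmulDiv_apply, map_div]
  congr 1
  ext
  exact (smul_partialNorm _ _ _ _).symm

theorem unitsPartialNorm_succ (σ : G) (a : ℕ) (x : Qˣ) :
    unitsPartialNorm σ (a + 1) x = x * unitsSmul σ (unitsPartialNorm σ a x) := by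
  ext
  have := partialNorm_add σ 1 a (x : Q)
  rw [add_comm a, coe_unitsPartialNorm, this]
  simp [partialNorm]

theorem unitsPartialNorm_unitsSmulDiv_self (σ : G) (a : ℕ) (x : Qˣ) :
    unitsPartialNorm σ a (unitsSmulDiv σ x) = unitsSmulDiv (σ ^ a) x := by
  induction a with
  | zero =>
    ext
    simp [partialNorm, unitsSmulDiv_apply]
  | succ a ih =>
    rw [unitsPartialNorm_succ, ih]
    simp only [unitsSmulDiv_apply, map_div, unitsSmul_unitsSmul, pow_succ']
    apply Additive.ofMul.injective
    simp only [ofMul_div, ofMul_mul]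
    module

theorem dvd_exponent {n : ℕ} {χ : G →* ℂˣ} {ζ : ℂˣ}
    (hζ : IsPrimitiveRoot ζ n) {L : ℂˣ → ℤ} (hL : ∀ a : ℂˣ, a ^ n = 1 → ζ ^ L a = a)
    (hχ : ∀ g, χ g ^ n = 1) (g k : G) : (n : ℤ) ∣ L (χ g) + L (χ k) - L (χ (g * k)) := by
  rw [← hζ.zpow_eq_one_iff_dvd, zpow_sub, zpow_add, hL _ (hχ _), hL _ (hχ _), hL _ (hχ _), map_mul,
    mul_inv_cancel]

namespace UnramifiedSplitting

variable {N : Subgroup G} {φ : G} {pr : G →* G} {r n : ℕ} {ϖ : Q}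

variable [Finite G] [FaithfulSMul G Q] [IsUltrametricDist Q] [ProperSpace Q] {u : Qˣ}

theorem exists_isCupTrivialisation (h : UnramifiedSplitting N φ pr r n ϖ) {χ : G →* ℂˣ} {ζ : ℂˣ}
    (hζ : IsPrimitiveRoot ζ n) {L : ℂˣ → ℤ} (hL : ∀ a : ℂˣ, a ^ n = 1 → ζ ^ L a = a)
    (hχ : ∀ g, χ g ^ n = 1) (hu : u ∈ unitSphere Q (⊤ : Subgroup G)) :
    ∃ y c, IsCupTrivialisation N φ n (fun g => L (χ g)) u y c := by
  obtain ⟨T, σ, m, hTN, hσN, hm, hσ, hTσ, hTχ, hord, hmN⟩ := exists_ker_character N χ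
  obtain ⟨v, hv, hvu⟩ := h.exists_unitsPartialNorm_eq hm hσ hTσ (hmN.trans h.card_dvd) hu
  obtain ⟨j, hj⟩ := exists_coset_index T σ m hm hσ
  have hvT : ∀ t ∈ T, t • (v : Q) = v := (mem_unitSphere.1 hv).1
  have hufix : ∀ g : G, unitsSmul g u = u := fun g => by
    ext
    exact (mem_unitSphere.1 hu).1 g (Subgroup.mem_top g)
  set s := L (χ σ) with hs
  obtain ⟨w, hw⟩ : (n : ℤ) ∣ s * m := by
    rw [← hζ.zpow_eq_one_iff_dvd, zpow_mul, hL _ (hχ _), zpow_natCast, ← hord, pow_orderOf_eq_one]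
  have hχj : ∀ g ∈ N, χ g = χ σ ^ j g := by
    intro g hg
    obtain ⟨-, t, ht, hgt⟩ := hj g (hTσ ▸ hg)
    conv_lhs => rw [hgt]
    rw [map_mul, map_pow, (hTχ t (hTN ht)).1 ht, mul_one]
  have hk : ∀ g, ∃ k : ℤ, g ∈ N → L (χ g) = s * j g + n * k := by
    intro g
    by_cases hg : g ∈ N
    · have : (n : ℤ) ∣ L (χ g) - s * j g := by
        rw [← hζ.zpow_eq_one_iff_dvd, zpow_sub, zpow_mul, hL _ (hχ _), hL _ (hχ _), zpow_natCast,
          hχj g hg, mul_inv_cancel]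
      obtain ⟨k, hk⟩ := this
      exact ⟨k, fun _ => by linarith⟩
    · exact ⟨0, fun h => absurd h hg⟩
  choose k hk using hk
  have hx1 : unitsPartialNorm σ m (unitsSmulDiv φ v) = 1 := by
    rw [unitsPartialNorm_unitsSmulDiv, hvu, unitsSmulDiv_apply, hufix, div_self']
  obtain ⟨x, hx0, hxT, hxσ⟩ := exists_eq_smul_div hm hσ (x := ((unitsSmulDiv φ v : Qˣ) : Q))
    (Units.ne_zero _) (fun t ht => by
      rw [coe_unitsSmulDiv, smul_div₀', smul_comm, hvT t ht])
    (congr_arg Units.val hx1)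
  have hxσ' : unitsSmulDiv σ (Units.mk0 x hx0) = unitsSmulDiv φ v := by
    rw [unitsSmulDiv_apply, div_eq_iff_eq_mul]
    ext
    exact hxσ
  refine ⟨Units.mk0 x hx0 ^ w, fun g => unitsPartialNorm σ (j g) v ^ w * u ^ k g,
    fun a ha b hb d hd => ?_, fun a ha => ?_⟩
  · obtain ⟨e, he, he'⟩ := partialNorm_cocycle hσ hj hvT (hTσ.symm ▸ ha) (hTσ.symm ▸ hb)
    have he'' : unitsPartialNorm σ (j a) v * unitsSmul a (unitsPartialNorm σ (j b) v) =
        unitsPartialNorm σ (j (a * b)) v * u ^ e := by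
      rw [← hvu]
      ext
      exact he'
    have hd' : d = e * w + k a + k b - k (a * b) := by
      have hn' : (n : ℤ) ≠ 0 := by exact_mod_cast h.exp_pos.ne'
      apply mul_left_cancel₀ hn'
      simp only [hk a ha, hk b hb, hk _ (N.mul_mem ha hb)] at hd
      have he2 : (j a : ℤ) + j b = j (a * b) + m * e := by exact_mod_cast he
      linear_combination -hd + s * he2 + e * hw
    simp only [map_mul, map_zpow, hufix]
    rw [hd']
    have e3 := congr_arg Additive.ofMul he''
    apply Additive.ofMul.injective
    simp only [ofMul_mul, ofMul_zpow, ofMul_pow] at e3 ⊢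
    linear_combination (norm := module) w • e3
  · simp only [map_mul, map_zpow]
    rw [unitsSmulDiv_apply φ u, hufix, div_self', one_zpow, mul_one,
      ← unitsPartialNorm_unitsSmulDiv, ← hxσ', unitsPartialNorm_unitsSmulDiv_self]
    congr 1
    obtain ⟨-, t, ht, hgt⟩ := hj a (hTσ ▸ ha)
    conv_rhs => rw [hgt]
    rw [unitsSmulDiv_apply, unitsSmulDiv_apply, ← unitsSmul_unitsSmul]
    congr 2
    ext
    exact (hxT t ht).symm

/-- The kernel of the pairing is trivial. -/
theorem character_eq_one_of_forall_norm_mem (h : UnramifiedSplitting N φ pr r n ϖ) {χ : G →* ℂˣ}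
    {ζ : ℂˣ} (hζ : IsPrimitiveRoot ζ n) {L : ℂˣ → ℤ} (hL : ∀ a : ℂˣ, a ^ n = 1 → ζ ^ L a = a)
    (hL1 : L 1 = 0) (hχ : ∀ g, χ g ^ n = 1) (hχφ : χ φ = 1)
    (hy : ∀ u ∈ unitSphere Q (⊤ : Subgroup G), ∃ y c,
      IsCupTrivialisation N φ n (fun g => L (χ g)) u y c ∧
      unitsNorm Q y ∈ normGroup Q (⊤ : Subgroup G)) :
    ∀ g ∈ N, χ g = 1 := by
  obtain ⟨T, σ, m, hTN, hσN, hm, hσ, hTσ, hTχ, hord, hmN⟩ := exists_ker_character N χ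
  have hn' : (n : ℤ) ≠ 0 := by exact_mod_cast h.exp_pos.ne'
  have hσ' := h.pow_mem_sup_iff hTN hσN hσ
  have htop := h.sup_sup_eq_top hTσ
  have hφpow : ∀ i : ℕ, φ ^ i ∈ (⊥ : Subgroup G) ↔ r ∣ i := h.pow_mem_iff bot_le
  have hφr : φ ^ r = 1 := by simpa using (hφpow r).2 dvd_rfl
  have hχpr : ∀ g, χ (pr g) = χ g := by
    intro g
    obtain ⟨i, hi⟩ := h.exists_pow g
    conv_rhs => rw [hi]
    rw [map_mul, map_pow, hχφ, one_pow, mul_one]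
  have hχT : ∀ t ∈ T ⊔ Subgroup.zpowers φ, χ t = 1 := fun t ht => by
    rw [← hχpr]
    exact (hTχ _ (h.pr_mem t)).1 (h.pr_mem_of_mem_sup hTN ht)
  have hle : unitSphere Q (⊤ : Subgroup G) ≤
      (unitSphere Q (T ⊔ Subgroup.zpowers φ)).map (unitsPartialNorm σ m) := by
    intro u hu
    have hufix : ∀ g : G, unitsSmul g u = u := fun g => by
      ext
      exact (mem_unitSphere.1 hu).1 g (Subgroup.mem_top g)
    obtain ⟨y, c, ⟨hc1, hc2⟩, w, hw, hwy⟩ := hy u hu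
    -- make `y` a norm-one unit with trivial `φ`-norm
    have hwfix : ∀ g : G, unitsSmul g w = w := fun g => by
      ext
      exact mem_fixedUnits.1 hw g (Subgroup.mem_top g)
    set b := unitsPartialNorm φ r (y / w) with hb
    have hbN : ∀ g ∈ N, unitsSmulDiv g b = 1 := by
      intro g hg
      rw [hb, ← unitsPartialNorm_unitsSmulDiv, map_div, ← hc2 g hg, unitsSmulDiv_apply g w, hwfix,
        div_self', div_one, unitsPartialNorm_unitsSmulDiv_self, hφr, unitsSmulDiv_apply,
        unitsSmul_one, div_self']
    have hbφ : unitsSmulDiv φ b = 1 := by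
      rw [hb, ← unitsPartialNorm_unitsSmulDiv, unitsPartialNorm_unitsSmulDiv_self, hφr,
        unitsSmulDiv_apply, unitsSmul_one, div_self']
    have hdiv : ∀ (g : G) (x : Qˣ), unitsSmulDiv g x = 1 → g • (x : Q) = x := by
      intro g x hx
      rw [unitsSmulDiv_apply, div_eq_one] at hx
      exact congr_arg Units.val hx
    have hyw : y / w ∈ unitSphere Q (⊥ : Subgroup G) := by
      rw [mem_unitSphere]
      refine ⟨fun t ht => by rw [Subgroup.mem_bot.1 ht, one_smul], ?_⟩
      have := congr_arg Units.val hwy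
      simp only [coe_unitsNorm] at this
      rw [Units.val_div_eq_div_val, norm_div, this, div_self (norm_ne_zero_iff.2 y.ne_zero)]
    have hbU : b ∈ unitSphere Q (⊤ : Subgroup G) := by
      rw [mem_unitSphere]
      refine ⟨?_, (mem_unitSphere.1 (unitsPartialNorm_mem_unitSphere h.norm_smul φ r hyw)).2⟩
      rw [← h.sup_zpowers]
      exact mem_fixedUnits_sup.2 ⟨fun g hg => hdiv g b (hbN g hg), hdiv φ b hbφ⟩
    obtain ⟨y0, hy0, hy0b⟩ := h.exists_unitsPartialNorm_frob_eq hbU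
    obtain ⟨z', hz0, -, hz⟩ := exists_eq_smul_div h.order_pos hφpow
      (x := ((y / w / y0 : Qˣ) : Q)) (Units.ne_zero _)
      (fun t ht => by rw [Subgroup.mem_bot.1 ht, one_smul])
      (congr_arg Units.val (by rw [map_div, ← hb, hy0b, div_self'] :
        unitsPartialNorm φ r (y / w / y0) = 1))
    set z := Units.mk0 z' hz0
    have hz : unitsSmulDiv φ z = y / w / y0 := by
      rw [unitsSmulDiv_apply, div_eq_iff_eq_mul]
      ext
      exact hz
    have hzg : ∀ g ∈ N, unitsSmulDiv φ (unitsSmulDiv g z) = unitsSmulDiv g y := by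
      intro g hg
      have : unitsSmul g y0 = y0 := by
        ext
        exact (mem_unitSphere.1 hy0).1 g hg
      rw [unitsSmulDiv_comm, hz, map_div, map_div, unitsSmulDiv_apply g y0, this,
        unitsSmulDiv_apply g w, hwfix, div_self', div_self', div_one, div_one]
    -- the trivialisation, made invariant under `φ`
    let c' : G → Qˣ := fun g => c (pr g) / unitsSmulDiv (pr g) z
    have hc'φ : ∀ g, unitsSmul φ (c' g) = c' g := by
      intro g
      rw [← div_eq_one, ← unitsSmulDiv_apply, map_div, hc2 _ (h.pr_mem g), hzg _ (h.pr_mem g),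
        div_self']
    have hc'φi : ∀ (i : ℕ) (g : G), unitsSmul (φ ^ i) (c' g) = c' g := by
      intro i g
      induction i with
      | zero => rw [pow_zero, unitsSmul_one]
      | succ i ih => rw [pow_succ, ← unitsSmul_unitsSmul, hc'φ, ih]
    have hc' : ∀ a b : G, ∀ d : ℤ, L (χ a) + L (χ b) = L (χ (a * b)) + n * d →
        c' a * unitsSmul a (c' b) = c' (a * b) * u ^ d := by
      intro a b d hd
      have e1 : unitsSmul a (c' b) = unitsSmul (pr a) (c' b) := by
        obtain ⟨i, hi⟩ := h.exists_pow a
        conv_lhs => rw [hi]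
        rw [← unitsSmul_unitsSmul, hc'φi]
      rw [e1]
      have e2 := hc1 (pr a) (h.pr_mem a) (pr b) (h.pr_mem b) d (by
        simp only [← map_mul pr]
        simpa only [hχpr] using hd)
      have e3 := congr_arg Additive.ofMul e2
      apply Additive.ofMul.injective
      simp only [c', unitsSmulDiv_apply, map_div, map_mul pr, ofMul_mul, ofMul_div, ofMul_zpow,
        unitsSmul_unitsSmul] at e3 ⊢
      linear_combination (norm := module) e3
    obtain ⟨b', hb'⟩ := exists_units_cocycle (T ⊔ Subgroup.zpowers φ) c' (fun g hg k hk => by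
      have := hc' g k 0 (by
        rw [hχT _ hg, hχT _ hk, hχT _ (mul_mem hg hk), hL1]
        simp)
      rw [zpow_zero, mul_one] at this
      exact this.symm)
    let e : G → Qˣ := fun g => c' g * unitsSmulDiv g b'
    have he : ∀ a b : G, ∀ d : ℤ, L (χ a) + L (χ b) = L (χ (a * b)) + n * d →
        e a * unitsSmul a (e b) = e (a * b) * u ^ d := by
      intro a b d hd
      have e3 := congr_arg Additive.ofMul (hc' a b d hd)
      apply Additive.ofMul.injective
      simp only [e, unitsSmulDiv_apply, map_div, map_mul, ofMul_mul, ofMul_div, ofMul_zpow,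
        unitsSmul_unitsSmul] at e3 ⊢
      linear_combination (norm := module) e3
    have heT : ∀ t ∈ T ⊔ Subgroup.zpowers φ, e t = 1 := by
      intro t ht
      show c' t * unitsSmulDiv t b' = 1
      rw [unitsSmulDiv_apply, ← mul_div_assoc, hb' t ht, div_self']
    have hvfix : ∀ t ∈ T ⊔ Subgroup.zpowers φ, unitsSmul t (e σ) = e σ := by
      intro t ht
      have e1 := he t σ 0 (by rw [map_mul, hχT t ht, hL1, one_mul]; simp)
      have e2 := he σ t 0 (by rw [map_mul, hχT t ht, hL1, mul_one]; simp)
      rw [heT t ht, one_mul] at e1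
      rw [heT t ht, map_one, mul_one, mul_comm σ t] at e2
      rw [e1, e2]
    have hpn : ∀ a : ℕ, ∀ d : ℤ, a * L (χ σ) = L (χ (σ ^ a)) + n * d →
        unitsPartialNorm σ a (e σ) = e (σ ^ a) * u ^ d := by
      intro a
      induction a with
      | zero =>
        intro d hd
        rw [pow_zero, map_one, hL1] at hd
        have : d = 0 := by simpa [h.exp_pos.ne'] using hd.symm
        rw [this, zpow_zero, pow_zero, heT 1 (one_mem _)]
        ext
        simp [partialNorm]
      | succ a ih =>
        intro d hd
        obtain ⟨d1, hd1⟩ : (n : ℤ) ∣ a * L (χ σ) - L (χ (σ ^ a)) := by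
          rw [← hζ.zpow_eq_one_iff_dvd, zpow_sub, mul_comm (a : ℤ), zpow_mul, hL _ (hχ _),
            hL _ (hχ _),
            zpow_natCast, map_pow, mul_inv_cancel]
        rw [unitsPartialNorm_succ, ih d1 (by linarith), map_mul, map_zpow, hufix, ← mul_assoc,
          he σ (σ ^ a) (d - d1) (by
            rw [← pow_succ']
            push_cast at hd
            linear_combination hd - hd1), ← pow_succ', mul_assoc, ← zpow_add, sub_add_cancel]
    set s := L (χ σ) with hs
    obtain ⟨k, hk⟩ : (n : ℤ) ∣ m * s := by
      rw [← hζ.zpow_eq_one_iff_dvd, mul_comm, zpow_mul, hL _ (hχ _), zpow_natCast, ← hord,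
        pow_orderOf_eq_one]
    have hσm : σ ^ m ∈ T ⊔ Subgroup.zpowers φ := (hσ' m).2 dvd_rfl
    have hNv : unitsPartialNorm σ m (e σ) = u ^ k := by
      rw [hpn m k (by rw [hk, hχT _ hσm, hL1, zero_add]), heT _ hσm, one_mul]
    have hcop : IsCoprime k (m : ℤ) := by
      rw [Int.isCoprime_iff_gcd_eq_one]
      set g := Int.gcd k m
      obtain ⟨k', hk'⟩ : (g : ℤ) ∣ k := Int.gcd_dvd_left _ _
      obtain ⟨m', hm'⟩ : g ∣ m := by exact_mod_cast (Int.gcd_dvd_right k (m : ℤ))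
      have hg0 : 0 < g := Nat.pos_of_ne_zero (by rintro h0; rw [h0, zero_mul] at hm'; omega)
      have h1 : χ σ ^ m' = 1 := by
        rw [← hL _ (hχ σ), ← hs, ← zpow_natCast, ← zpow_mul, hζ.zpow_eq_one_iff_dvd]
        refine ⟨k', ?_⟩
        have hg' : (g : ℤ) ≠ 0 := by exact_mod_cast hg0.ne'
        apply mul_left_cancel₀ hg'
        have : (m : ℤ) = g * m' := by exact_mod_cast hm'
        rw [this] at hk
        linear_combination hk + n * hk'
      have h2 := orderOf_dvd_of_pow_eq_one h1
      rw [hord] at h2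
      have hm0 : 0 < m' := Nat.pos_of_ne_zero (by rintro rfl; omega)
      have h3 := Nat.le_of_dvd hm0 h2
      have : g * m' ≤ 1 * m' := by omega
      have := Nat.le_of_mul_le_mul_right this hm0
      omega
    have hmap : ∀ x ∈ unitSphere Q (T ⊔ Subgroup.zpowers φ), unitsPartialNorm σ m x ∈
        (unitSphere Q (T ⊔ Subgroup.zpowers φ)).map (unitsPartialNorm σ m) :=
      fun x hx => ⟨x, hx, rfl⟩
    have hk_mem := hmap (e σ) (by
      rw [mem_unitSphere]
      refine ⟨fun t ht => congr_arg Units.val (hvfix t ht), ?_⟩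
      have h1 := congr_arg (fun x : Qˣ => ‖(x : Q)‖) hNv
      have h2 : ∀ a : ℕ, ‖partialNorm σ a ((e σ : Qˣ) : Q)‖ = ‖((e σ : Qˣ) : Q)‖ ^ a := by
        intro a
        rw [partialNorm]
        simp [h.norm_smul]
      have h3 : ‖((e σ : Qˣ) : Q)‖ ^ m = 1 := by
        rw [← h2, ← coe_unitsPartialNorm]
        refine h1.trans ?_
        simp [(mem_unitSphere.1 hu).2]
      exact (pow_eq_one_iff_of_nonneg (norm_nonneg _) hm.ne').1 h3)
    have hm_mem := hmap u (mem_unitSphere.2 ⟨fun t _ => congr_arg Units.val (hufix t),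
      (mem_unitSphere.1 hu).2⟩)
    have hum : unitsPartialNorm σ m u = u ^ (m : ℤ) := by
      ext
      rw [coe_unitsPartialNorm, partialNorm_of_fixed _ _ (congr_arg Units.val (hufix σ))]
      simp
    rw [hNv] at hk_mem
    rw [hum] at hm_mem
    obtain ⟨α, β, hαβ⟩ := hcop
    have : u = (u ^ k) ^ α * (u ^ (m : ℤ)) ^ β := by
      rw [← zpow_mul, ← zpow_mul, ← zpow_add, mul_comm k, mul_comm (m : ℤ), hαβ, zpow_one]
    rw [this]
    exact mul_mem (zpow_mem hk_mem α) (zpow_mem hm_mem β)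
  have e2 := (relIndex_unitsPartialNorm h.norm_smul h.smul_unif h.unif_ne_zero h.norm_unif_lt_one
    hm hσ').1
  rw [htop, Subgroup.relIndex_eq_one.2 hle] at e2
  have e3 := h.ram _ (Subgroup.mem_sup_right (Subgroup.mem_zpowers φ))
    (Subgroup.relIndex_eq_one.1 e2.symm)
  exact fun g _ => hχT g (e3 ▸ Subgroup.mem_top g)

end UnramifiedSplitting

variable {G Q : Type*} [CommGroup G] [NormedField Q] [MulSemiringAction G Q]

/-- A character of the multiplicative group detecting the value group of the fixed field. -/
theorem exists_norm_character {ϖ : Q} (hϖ : ∀ g : G, g • ϖ = ϖ) (h0 : ϖ ≠ 0) (h1 : ‖ϖ‖ < 1)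
    (hval : ∀ x ∈ fixedUnits Q (⊤ : Subgroup G), ∃ k : ℤ, ‖(x : Q)‖ = ‖ϖ‖ ^ k) :
    ∃ κ : Qˣ →* ℂˣ, ∀ y, κ y = 1 ↔ unitsNorm Q y ∈ normGroup Q (⊤ : Subgroup G) := by
  have hpos : 0 < ‖ϖ‖ := norm_pos_iff.2 h0
  have hlog : Real.log ‖ϖ‖ ≠ 0 := (Real.log_neg hpos h1).ne
  let κ : Qˣ →* ℂˣ := MonoidHom.mk' (fun y => Units.mk0 (Complex.exp
    (2 * Real.pi * Complex.I * (Real.log ‖(y : Q)‖ / Real.log ‖ϖ‖ : ℝ))) (Complex.exp_ne_zero _))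
    (fun a b => by
      ext
      simp only [Units.val_mk0, Units.val_mul, norm_mul]
      rw [Real.log_mul (norm_ne_zero_iff.2 a.ne_zero) (norm_ne_zero_iff.2 b.ne_zero),
        ← Complex.exp_add]
      congr 1
      push_cast
      ring)
  refine ⟨κ, fun y => ?_⟩
  have hy : 0 < ‖(y : Q)‖ := norm_pos_iff.2 y.ne_zero
  have e1 : κ y = 1 ↔ ∃ k : ℤ, ‖(y : Q)‖ = ‖ϖ‖ ^ k := by
    rw [← Units.val_inj]
    show Complex.exp _ = 1 ↔ _
    rw [Complex.exp_eq_one_iff]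
    refine exists_congr fun k => ?_
    rw [mul_comm (k : ℂ), mul_right_inj' Complex.two_pi_I_ne_zero]
    rw [show ((k : ℂ)) = ((k : ℝ) : ℂ) by push_cast; rfl, Complex.ofReal_inj, div_eq_iff hlog,
      ← Real.log_zpow]
    exact Real.log_injOn_pos.eq_iff hy (zpow_pos hpos k)
  rw [e1]
  constructor
  · rintro ⟨k, hk⟩
    refine ⟨Units.mk0 ϖ h0 ^ k, ?_, ?_⟩
    · exact zpow_mem (mem_fixedUnits.2 fun g _ => hϖ g) k
    · ext
      simp [hk]
  · rintro ⟨x, hx, hxy⟩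
    obtain ⟨k, hk⟩ := hval x hx
    exact ⟨k, by rw [← hk]; exact (congr_arg Units.val hxy).symm⟩

namespace UnramifiedSplitting

variable {N : Subgroup G} {φ : G} {pr : G →* G} {r n : ℕ} {ϖ : Q}

variable [Finite G] [FaithfulSMul G Q] [IsUltrametricDist Q] [ProperSpace Q]

/-- The upper bound in local class field theory: `N` embeds in the dual of the group of units
modulo `n`-th powers. -/
theorem card_le_index (h : UnramifiedSplitting N φ pr r n ϖ)
    (hval : ∀ x ∈ fixedUnits Q (⊤ : Subgroup G), ∃ k : ℤ, ‖(x : Q)‖ = ‖ϖ‖ ^ k)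
    (hfin : (powMonoidHom n : unitSphere Q (⊤ : Subgroup G) →* _).range.FiniteIndex) :
    Nat.card N ≤ (powMonoidHom n : unitSphere Q (⊤ : Subgroup G) →* _).range.index := by
  obtain ⟨κ, hκ⟩ := exists_norm_character h.smul_unif h.unif_ne_zero h.norm_unif_lt_one hval
  have hn0 : NeZero n := ⟨h.exp_pos.ne'⟩
  obtain ⟨ζ, hζ⟩ : ∃ ζ : ℂˣ, IsPrimitiveRoot ζ n := by
    have := Complex.isPrimitiveRoot_exp n h.exp_pos.ne'
    exact ⟨_, this.isUnit_unit' h.exp_pos.ne'⟩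
  have hL' : ∀ a : ℂˣ, ∃ k : ℤ, (a ^ n = 1 → ζ ^ k = a) ∧ (a = 1 → k = 0) := by
    intro a
    by_cases ha1 : a = 1
    · exact ⟨0, fun _ => by rw [zpow_zero, ha1], fun _ => rfl⟩
    · by_cases ha : a ^ n = 1
      · obtain ⟨i, -, hi⟩ := hζ.eq_pow_of_mem_rootsOfUnity ((mem_rootsOfUnity n a).2 ha)
        exact ⟨i, fun _ => by rw [zpow_natCast, hi], fun h => absurd h ha1⟩
      · exact ⟨0, fun h => absurd h ha, fun _ => rfl⟩
  choose L hL hL1 using hL'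
  replace hL1 := hL1 1 rfl
  set U := unitSphere Q (⊤ : Subgroup G)
  let prN : G →* N := pr.codRestrict N h.pr_mem
  have hext : ∀ (χ : N →* ℂˣ) (g : G), χ.comp prN g ^ n = 1 := by
    intro χ g
    show χ (prN g) ^ n = 1
    rw [← map_pow]
    have : prN g ^ n = 1 := Subtype.ext (h.pow_exp _ (h.pr_mem g))
    rw [this, map_one]
  have hufix : ∀ (u : U) (g : G), unitsSmul g (u : Qˣ) = u := fun u g => by
    ext
    exact (mem_unitSphere.1 u.2).1 g (Subgroup.mem_top g)
  have hex := fun (χ : N →* ℂˣ) (u : U) =>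
    h.exists_isCupTrivialisation (χ := χ.comp prN) hζ hL (hext χ) u.2
  choose y c hc using hex
  have hdvd := fun χ : N →* ℂˣ => dvd_exponent hζ hL (hext χ)
  have hwd : ∀ (χ : N →* ℂˣ) (u : U) (y' : Qˣ) (c' : G → Qˣ),
      IsCupTrivialisation N φ n (fun g => L (χ.comp prN g)) u y' c' → κ y' = κ (y χ u) := by
    intro χ u y' c' hc'
    have h1 := hc'.mul (hc χ u).inv
    rw [mul_inv_cancel] at h1
    have := (hκ _).2 (h.unitsNorm_mem_of_isCupTrivialisation_one (hdvd χ) h1)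
    rwa [map_mul, map_inv, mul_inv_eq_one] at this
  let B : (N →* ℂˣ) →* (U →* ℂˣ) := MonoidHom.mk' (fun χ => MonoidHom.mk' (fun u => κ (y χ u))
      (fun u v => by
        rw [← map_mul, ← hwd χ (u * v) _ _ ((hc χ u).mul (hc χ v))]))
    (fun χ ψ => by
      ext u : 1
      show κ (y (χ * ψ) u) = κ (y χ u) * κ (y ψ u)
      have hk : ∀ g, ∃ k : ℤ, L (χ.comp prN g) + L (ψ.comp prN g) =
          L ((χ * ψ).comp prN g) + n * k := by
        intro g
        have : (n : ℤ) ∣ L (χ.comp prN g) + L (ψ.comp prN g) - L ((χ * ψ).comp prN g) := by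
          rw [← hζ.zpow_eq_one_iff_dvd, zpow_sub, zpow_add, hL _ (hext _ _), hL _ (hext _ _),
            hL _ (hext _ _), mul_inv_eq_one]
          rfl
        obtain ⟨k, hk⟩ := this
        exact ⟨k, by linarith⟩
      choose k hk using hk
      rw [← map_mul, ← hwd (χ * ψ) u _ _ (IsCupTrivialisation.add_exponents h.exp_pos (hufix u)
        (hdvd χ) (hdvd ψ) hk (hc χ u) (hc ψ u))])
  have hB : Function.Injective B := by
    rw [injective_iff_map_eq_one]
    intro χ hχ
    ext g
    have := h.character_eq_one_of_forall_norm_mem (χ := χ.comp prN) hζ hL hL1 (hext χ)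
      (by
        show χ (prN φ) = 1
        rw [show prN φ = 1 from Subtype.ext h.pr_frob, map_one])
      (fun u hu => ⟨y χ ⟨u, hu⟩, c χ ⟨u, hu⟩, hc χ ⟨u, hu⟩,
        (hκ _).1 (DFunLike.congr_fun hχ (⟨u, hu⟩ : U))⟩) g g.2
    have e : prN g = g := Subtype.ext (h.pr_of_mem g g.2)
    rw [MonoidHom.comp_apply, e] at this
    rw [this]
    rfl
  set P := (powMonoidHom n : U →* U).range
  have hBP : ∀ χ, P ≤ (B χ).ker := by
    rintro χ _ ⟨u, rfl⟩
    have : χ ^ n = 1 := by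
      ext g : 1
      have := h.pow_exp g g.2
      rw [MonoidHom.pow_apply, ← map_pow, show g ^ n = 1 from Subtype.ext this, map_one]
      rfl
    rw [MonoidHom.mem_ker, powMonoidHom_apply, map_pow, ← MonoidHom.pow_apply, ← map_pow, this,
      map_one]
    rfl
  have hfinQ : Finite (U ⧸ P) := Subgroup.finite_quotient_of_finiteIndex
  have hexp : NeZero (Monoid.exponent (U ⧸ P)) := ⟨Monoid.exponent_ne_zero_of_finite (G := U ⧸ P)⟩
  have hcard1 : Nat.card (N →* ℂˣ) = Nat.card N :=
    CommGroup.card_monoidHom_of_hasEnoughRootsOfUnity N ℂ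
  have hcard2 : Nat.card (U ⧸ P →* ℂˣ) = Nat.card (U ⧸ P) :=
    CommGroup.card_monoidHom_of_hasEnoughRootsOfUnity (U ⧸ P) ℂ
  have hfin2 : Finite (U ⧸ P →* ℂˣ) :=
    Nat.finite_of_card_ne_zero (by rw [hcard2]; exact Nat.card_pos.ne')
  rw [← hcard1]
  refine le_trans (Nat.card_le_card_of_injective (fun χ => QuotientGroup.lift P (B χ) (hBP χ)) ?_)
    hcard2.le
  intro χ ψ hχψ
  apply hB
  ext u : 1
  exact DFunLike.congr_fun hχψ (QuotientGroup.mk u)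

end UnramifiedSplitting

section RootsOfUnity

variable {Ω : Type*} [NormedField Ω]

theorem norm_eq_one_of_pow_eq_one' {x : Ω} {k : ℕ} (hk : k ≠ 0) (hx : x ^ k = 1) : ‖x‖ = 1 :=
  (pow_eq_one_iff_of_nonneg (norm_nonneg _) hk).1 (by rw [← norm_pow, hx, norm_one])

variable [IsUltrametricDist Ω]

theorem norm_sub_le_max_norm (x y : Ω) : ‖x - y‖ ≤ max ‖x‖ ‖y‖ := by
  rw [sub_eq_add_neg, ← norm_neg y]
  exact IsUltrametricDist.norm_add_le_max x (-y)

theorem norm_natCast_eq_one_of_not_dvd {p : ℕ} (hp : p.Prime) (hpn : ‖(p : Ω)‖ < 1) {k : ℕ}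
    (hk : ¬ p ∣ k) : ‖(k : Ω)‖ = 1 := by
  apply le_antisymm (IsUltrametricDist.norm_natCast_le_one Ω k)
  by_contra! hlt
  have hcop : IsCoprime (p : ℤ) (k : ℤ) := by
    rw [Nat.isCoprime_iff_coprime]
    exact (Nat.Prime.coprime_iff_not_dvd hp).2 hk
  obtain ⟨a, b, hab⟩ := hcop
  have h1 : (a : Ω) * p + b * k = 1 := by exact_mod_cast congr_arg (Int.cast : ℤ → Ω) hab
  have h2 : ‖(a : Ω) * p + b * k‖ < 1 := by
    refine lt_of_le_of_lt (IsUltrametricDist.norm_add_le_max _ _) (max_lt ?_ ?_)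
    · rw [norm_mul]
      exact mul_lt_one_of_nonneg_of_lt_one_right (IsUltrametricDist.norm_intCast_le_one Ω a)
        (norm_nonneg _) hpn
    · rw [norm_mul]
      exact mul_lt_one_of_nonneg_of_lt_one_right (IsUltrametricDist.norm_intCast_le_one Ω b)
        (norm_nonneg _) hlt
  rw [h1, norm_one] at h2
  exact lt_irrefl _ h2

/-- Distinct roots of unity of order prime to the residue characteristic are not congruent. -/
theorem eq_of_norm_sub_lt_one {p : ℕ} (hp : p.Prime) (hpn : ‖(p : Ω)‖ < 1) {k : ℕ}
    (hk : ¬ p ∣ k) {x y : Ω} (hx : x ^ k = 1) (hy : y ^ k = 1) (hxy : ‖x - y‖ < 1) : x = y := by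
  have hk0 : k ≠ 0 := by
    rintro rfl
    exact hk (dvd_zero p)
  have hy0 : y ≠ 0 := by
    rintro rfl
    rw [zero_pow hk0] at hy
    exact zero_ne_one hy
  have hw : ‖x / y - 1‖ < 1 := by
    rw [div_sub_one hy0, norm_div, norm_eq_one_of_pow_eq_one' hk0 hy, div_one]
    exact hxy
  by_contra hne
  have hw1 : x / y ≠ 1 := by rwa [Ne, div_eq_one_iff_eq hy0]
  have hgeom : ∑ i ∈ Finset.range k, (x / y) ^ i = 0 := by
    rw [geom_sum_eq hw1, div_pow, hx, hy, div_one, sub_self, zero_div]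
  have hsum : ‖∑ i ∈ Finset.range k, ((x / y) ^ i - 1)‖ < 1 := by
    obtain ⟨i, -, hi⟩ := IsUltrametricDist.exists_norm_finsetSum_le (Finset.range k)
      (fun i => (x / y) ^ i - 1)
    refine lt_of_le_of_lt hi ?_
    rw [← geom_sum_mul, norm_mul]
    refine mul_lt_one_of_nonneg_of_lt_one_right ?_ (norm_nonneg _) hw
    obtain ⟨j, -, hj⟩ := IsUltrametricDist.exists_norm_finsetSum_le (Finset.range i)
      (fun i => (x / y) ^ i)
    refine hj.trans ?_
    rw [norm_pow, norm_div, norm_eq_one_of_pow_eq_one' hk0 hy,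
      norm_eq_one_of_pow_eq_one' hk0 hx, div_one, one_pow]
  rw [Finset.sum_sub_distrib, hgeom, Finset.sum_const, Finset.card_range, zero_sub, norm_neg,
    nsmul_one, norm_natCast_eq_one_of_not_dvd hp hpn hk] at hsum
  exact lt_irrefl _ hsum

theorem norm_sub_eq_one_of_pow_eq_one {p : ℕ} (hp : p.Prime) (hpn : ‖(p : Ω)‖ < 1) {k : ℕ}
    (hk : ¬ p ∣ k) {x y : Ω} (hx : x ^ k = 1) (hy : y ^ k = 1) (hxy : x ≠ y) : ‖x - y‖ = 1 := by
  have hk0 : k ≠ 0 := by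
    rintro rfl
    exact hk (dvd_zero p)
  apply le_antisymm
  · refine (norm_sub_le_max_norm _ _).trans ?_
    rw [norm_eq_one_of_pow_eq_one' hk0 hx, norm_eq_one_of_pow_eq_one' hk0 hy, max_self]
  · by_contra! h
    exact hxy (eq_of_norm_sub_lt_one hp hpn hk hx hy h)

open Polynomial in
/-- A polynomial is bounded by its values at sufficiently many incongruent points. -/
theorem norm_coeff_le_of_norm_eval_le {C : ℝ} (hC : 0 ≤ C) (S : Finset Ω)
    (hS1 : ∀ x ∈ S, ‖x‖ ≤ 1) (hS : ∀ x ∈ S, ∀ y ∈ S, x ≠ y → ‖x - y‖ = 1) (P : Polynomial Ω)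
    (hdeg : P.degree < S.card) (hP : ∀ x ∈ S, ‖P.eval x‖ ≤ C) (i : ℕ) : ‖P.coeff i‖ ≤ C := by
  classical
  induction S using Finset.induction_on generalizing P i with
  | empty =>
    have : P = 0 := by
      rw [← Polynomial.degree_eq_bot]
      simpa using hdeg
    simpa [this] using hC
  | insert x S hx ih =>
    have hdiv : P = (X - Polynomial.C x) * (P /ₘ (X - Polynomial.C x)) +
        Polynomial.C (P.eval x) := by
      conv_lhs => rw [← Polynomial.modByMonic_add_div P (X - Polynomial.C x),
        Polynomial.modByMonic_X_sub_C_eq_C_eval, add_comm]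
    set P1 := P /ₘ (X - Polynomial.C x)
    have hP1 : ∀ y ∈ S, ‖P1.eval y‖ ≤ C := by
      intro y hy
      have hyx : y ≠ x := by
        rintro rfl
        exact hx hy
      have h1 : P.eval y - P.eval x = (y - x) * P1.eval y := by
        conv_lhs => rw [hdiv]
        simp
      have h2 : ‖P1.eval y‖ = ‖P.eval y - P.eval x‖ := by
        rw [h1, norm_mul, hS y (Finset.mem_insert_of_mem hy) x (Finset.mem_insert_self x S) hyx,
          one_mul]
      rw [h2]
      exact (norm_sub_le_max_norm _ _).trans
        (max_le (hP y (Finset.mem_insert_of_mem hy)) (hP x (Finset.mem_insert_self x S)))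
    have hdeg1 : P1.degree < S.card := by
      by_cases hP0 : P = 0
      · have : P1 = 0 := by simp [P1, hP0]
        rw [this, degree_zero]
        exact WithBot.bot_lt_coe _
      · by_cases hPd : 0 < P.degree
        · have hne : P1 ≠ 0 := by
            intro h0
            rw [h0, mul_zero, zero_add] at hdiv
            rw [hdiv] at hPd
            exact absurd hPd (not_lt.2 degree_C_le)
          have h3 : P.degree = (X - Polynomial.C x).degree + P1.degree := by
            rw [Polynomial.degree_add_divByMonic (monic_X_sub_C x)]
            rw [degree_X_sub_C]
            exact Nat.WithBot.one_le_iff_zero_lt.2 hPd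
          rw [degree_X_sub_C, degree_eq_natDegree hne] at h3
          rw [h3, Finset.card_insert_of_notMem hx] at hdeg
          rw [degree_eq_natDegree hne]
          have : 1 + P1.natDegree < S.card + 1 := by exact_mod_cast hdeg
          exact_mod_cast (by omega : P1.natDegree < S.card)
        · have : P1 = 0 := by
            rw [Polynomial.divByMonic_eq_zero_iff (monic_X_sub_C x), degree_X_sub_C]
            exact lt_of_le_of_lt (not_lt.1 hPd) (by norm_num)
          rw [this, degree_zero]
          exact WithBot.bot_lt_coe _
    have hc := ih (fun y hy => hS1 y (Finset.mem_insert_of_mem hy))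
      (fun y hy z hz => hS y (Finset.mem_insert_of_mem hy) z (Finset.mem_insert_of_mem hz)) P1
      hdeg1 hP1
    have hxc : ∀ j, ‖x * P1.coeff j‖ ≤ C := fun j => by
      rw [norm_mul]
      exact (mul_le_of_le_one_left (norm_nonneg _)
        (hS1 x (Finset.mem_insert_self x S))).trans (hc j)
    rw [hdiv, sub_mul, coeff_add, coeff_sub, coeff_C_mul]
    have hCx : ‖(Polynomial.C (P.eval x)).coeff i‖ ≤ C := by
      rw [coeff_C]
      split_ifs
      · exact hP x (Finset.mem_insert_self x S)
      · simpa using hC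
    refine (IsUltrametricDist.norm_add_le_max _ _).trans (max_le
      ((norm_sub_le_max_norm _ _).trans (max_le ?_ (hxc i))) hCx)
    cases i with
    | zero => simpa using hC
    | succ i => rw [coeff_X_mul]; exact hc i

end RootsOfUnity

section Unramified

variable {M Ω : Type*} [Field M] [NormedField Ω] [IsUltrametricDist Ω] [Algebra M Ω]
  [IsAlgClosed Ω] [CharZero Ω] [Algebra.IsAlgebraic M Ω]

open Polynomial in
/-- Adjoining a root of unity of order prime to `p` does not change the value group. -/
theorem exists_norm_eq_of_mem_adjoin_rootOfUnity {p : ℕ} (hp : p.Prime) (hpn : ‖(p : Ω)‖ < 1)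
    (hiso : ∀ (g : Ω ≃ₐ[M] Ω) (x : Ω), ‖g x‖ = ‖x‖) {k : ℕ} (hk : ¬ p ∣ k) {ζ : Ω}
    (hζ : ζ ^ k = 1) {x : Ω} (hx : x ∈ M⟮ζ⟯) : ∃ y : M, ‖x‖ = ‖algebraMap M Ω y‖ := by
  classical
  have hk0 : k ≠ 0 := by
    rintro rfl
    exact hk (dvd_zero p)
  have : CharZero M := (algebraMap M Ω).charZero_iff (algebraMap M Ω).injective |>.2 inferInstance
  have : Normal M Ω := normal_iff.2 fun x => ⟨Algebra.IsIntegral.isIntegral x,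
    IsAlgClosed.splits _⟩
  have hintegral : IsIntegral M ζ := Algebra.IsIntegral.isIntegral ζ
  obtain ⟨P0, hP0⟩ : ∃ P0 : Polynomial M, aeval ζ P0 = x := by
    have : x ∈ (M⟮ζ⟯).toSubalgebra := hx
    rw [IntermediateField.adjoin_simple_toSubalgebra_of_isAlgebraic hintegral.isAlgebraic,
      Algebra.adjoin_singleton_eq_range_aeval] at this
    exact this
  set f := minpoly M ζ
  have hf : f.Monic := minpoly.monic hintegral
  set P := P0 %ₘ f
  have hP : aeval ζ P = x := by
    rw [← hP0, Polynomial.aeval_modByMonic_eq_self_of_root (minpoly.aeval M ζ)]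
  have hPdeg : P.degree < f.degree := degree_modByMonic_lt _ hf
  set S : Finset Ω := (f.aroots Ω).toFinset
  have hcard : S.card = f.natDegree := by
    have hsep : f.Separable := (minpoly.irreducible hintegral).separable
    rw [Multiset.toFinset_card_of_nodup (nodup_aroots_iff_of_splits hf.ne_zero
      (IsAlgClosed.splits _) |>.2 hsep)]
    exact IsAlgClosed.card_aroots_eq_natDegree
  have hconj : ∀ y ∈ S, ∃ g : Ω ≃ₐ[M] Ω, g ζ = y := by
    intro y hy
    have hy' : aeval y f = 0 := (mem_aroots'.1 (Multiset.mem_toFinset.1 hy)).2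
    exact minpoly.exists_algEquiv_of_root' (Algebra.IsAlgebraic.isAlgebraic ζ) hy'
  have hSk : ∀ y ∈ S, y ^ k = 1 := by
    intro y hy
    obtain ⟨g, rfl⟩ := hconj y hy
    rw [← map_pow, hζ, map_one]
  have hle : ∀ i, ‖algebraMap M Ω (P.coeff i)‖ ≤ ‖x‖ := by
    intro i
    rw [← coeff_map]
    refine norm_coeff_le_of_norm_eval_le (norm_nonneg x) S
      (fun y hy => (norm_eq_one_of_pow_eq_one' hk0 (hSk y hy)).le)
      (fun y hy z hz => norm_sub_eq_one_of_pow_eq_one hp hpn hk (hSk y hy) (hSk z hz)) _ ?_ ?_ i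
    · rw [degree_map, hcard, ← degree_eq_natDegree hf.ne_zero]
      exact hPdeg
    · intro y hy
      obtain ⟨g, rfl⟩ := hconj y hy
      rw [eval_map_algebraMap, aeval_algHom_apply, hP]
      exact (hiso g x).le
  have hsum : x = ∑ i ∈ Finset.range (P.natDegree + 1), algebraMap M Ω (P.coeff i) * ζ ^ i := by
    rw [← hP, aeval_eq_sum_range]
    simp [Algebra.smul_def]
  obtain ⟨i, -, hi⟩ := IsUltrametricDist.exists_norm_finsetSum_le
    (Finset.range (P.natDegree + 1)) (fun i => algebraMap M Ω (P.coeff i) * ζ ^ i)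
  refine ⟨P.coeff i, le_antisymm ?_ (hle i)⟩
  rw [← hsum, norm_mul, norm_pow, norm_eq_one_of_pow_eq_one' hk0 hζ, one_pow, mul_one] at hi
  exact hi

end Unramified

/-- A uniformizer `ϖ` of a local field with residue field of cardinality `q`, a power of `p`. -/
structure LocalParam (p : ℕ) (F : Type*) [NormedField F] (ϖ : F) (q : ℕ) : Prop where
  prime : p.Prime
  norm_p_lt_one : ‖(p : F)‖ < 1
  unif_ne_zero : ϖ ≠ 0
  norm_unif_lt_one : ‖ϖ‖ < 1
  norm_eq_zpow : ∀ x : F, x ≠ 0 → ∃ k : ℤ, ‖x‖ = ‖ϖ‖ ^ k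
  eq_pow : ∃ s : ℕ, s ≠ 0 ∧ q = p ^ s
  pow_residue : ∀ x : F, ‖x‖ ≤ 1 → ‖x ^ q - x‖ < 1
  residue : ∃ T : Finset F, T.card = q ∧ (∀ x ∈ T, ‖x‖ ≤ 1) ∧
    (∀ x : F, ‖x‖ ≤ 1 → ∃ t ∈ T, ‖x - t‖ < 1) ∧ ∀ x ∈ T, ∀ y ∈ T, x ≠ y → ‖x - y‖ = 1

open scoped NormedField Valued in
theorem exists_localParam {p : ℕ} (hp : p.Prime) (F : Type*) [NontriviallyNormedField F]
    [IsUltrametricDist F] [ProperSpace F] (hpn : ‖(p : F)‖ < 1) :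
    ∃ (ϖ : F) (q : ℕ), LocalParam p F ϖ q := by
  classical
  have hcpt : CompactSpace 𝒪[F] := by
    have h : ((𝒪[F] : Subring F) : Set F) = Metric.closedBall 0 1 := by
      ext x
      simp [Valued.integer.mem_iff]
    refine isCompact_iff_compactSpace.1 (?_ : IsCompact ((𝒪[F] : Subring F) : Set F))
    rw [h]
    exact isCompact_closedBall (0 : F) 1
  have hrank : (Valued.v : Valuation F NNReal).RankOne :=
    inferInstanceAs (NormedField.valuation (K := F)).RankOne
  obtain ⟨-, hdvr, hfin⟩ :=
    Valued.integer.compactSpace_iff_completeSpace_and_isDiscreteValuationRing_and_finite_residueField.1 hcpt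
  obtain ⟨ϖ, hϖ⟩ := IsDiscreteValuationRing.exists_irreducible 𝒪[F]
  have hres : ∀ x : 𝒪[F], IsLocalRing.residue 𝒪[F] x = 0 ↔ ‖(x : F)‖ < 1 := by
    intro x
    rw [IsLocalRing.residue_eq_zero_iff, IsLocalRing.mem_maximalIdeal, mem_nonunits_iff,
      Valued.integer.isUnit_iff_norm_eq_one]
    exact (lt_iff_le_and_ne.trans (and_iff_right (Valued.integer.norm_le_one x))).symm
  have hsub : ∀ x y : 𝒪[F], IsLocalRing.residue 𝒪[F] x = IsLocalRing.residue 𝒪[F] y ↔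
      ‖(x : F) - y‖ < 1 := by
    intro x y
    rw [← sub_eq_zero, ← map_sub, hres]
    rfl
  have hϖ0 : (ϖ : F) ≠ 0 := fun h => hϖ.ne_zero (Subtype.ext h)
  have hpk : ((p : ℕ) : 𝓀[F]) = 0 := by
    have := (hres (p : 𝒪[F])).2 (by simpa using hpn)
    simpa using this
  have : Fact p.Prime := ⟨hp⟩
  have : CharP 𝓀[F] p := by
    have h := CharP.ringChar_of_prime_eq_zero hp hpk
    exact ringChar.of_eq h
  have : Fintype 𝓀[F] := Fintype.ofFinite _
  obtain ⟨s, -, hs⟩ := FiniteField.card 𝓀[F] p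
  refine ⟨ϖ, Fintype.card 𝓀[F], hp, hpn, hϖ0, Valued.integer.norm_irreducible_lt_one hϖ, ?_,
    ⟨s, s.ne_zero, hs⟩, ?_, ?_⟩
  · have key : ∀ x : F, x ≠ 0 → ‖x‖ ≤ 1 → ∃ k : ℕ, ‖x‖ = ‖(ϖ : F)‖ ^ k := by
      intro x hx hx1
      have hx0 : (⟨x, Valued.integer.mem_iff.2 hx1⟩ : 𝒪[F]) ≠ 0 := fun h =>
        hx (congrArg Subtype.val h)
      obtain ⟨k, u, hk⟩ := IsDiscreteValuationRing.eq_unit_mul_pow_irreducible hx0 hϖ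
      refine ⟨k, ?_⟩
      have h1 : x = (u : 𝒪[F]) * (ϖ : F) ^ k := congrArg Subtype.val hk
      rw [h1, norm_mul, norm_pow, Valued.integer.norm_coe_unit, one_mul]
    intro x hx
    rcases le_total ‖x‖ 1 with h | h
    · obtain ⟨k, hk⟩ := key x hx h
      exact ⟨k, by rw [hk, zpow_natCast]⟩
    · obtain ⟨k, hk⟩ := key x⁻¹ (inv_ne_zero hx) (by
        rw [norm_inv]
        exact inv_le_one_of_one_le₀ h)
      refine ⟨-k, ?_⟩
      rw [zpow_neg, zpow_natCast, ← hk, norm_inv, inv_inv]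
  · intro x hx
    have h := (hsub (⟨x, Valued.integer.mem_iff.2 hx⟩ ^ Fintype.card 𝓀[F])
      ⟨x, Valued.integer.mem_iff.2 hx⟩).1 (by rw [map_pow, FiniteField.pow_card])
    exact h
  · set σ := Function.surjInv (IsLocalRing.residue_surjective (R := 𝒪[F]))
    have hσ : ∀ a, IsLocalRing.residue 𝒪[F] (σ a) = a := Function.surjInv_eq _
    have hinj : Function.Injective fun a => ((σ a : 𝒪[F]) : F) := fun a b h => by
      rw [← hσ a, ← hσ b, Subtype.ext h]
    refine ⟨Finset.univ.image fun a => ((σ a : 𝒪[F]) : F), ?_, ?_, ?_, ?_⟩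
    · rw [Finset.card_image_of_injective _ hinj, Finset.card_univ]
    · intro x hx
      obtain ⟨a, -, rfl⟩ := Finset.mem_image.1 hx
      exact Valued.integer.norm_le_one (σ a)
    · intro x hx
      refine ⟨_, Finset.mem_image_of_mem _ (Finset.mem_univ
        (IsLocalRing.residue 𝒪[F] ⟨x, Valued.integer.mem_iff.2 hx⟩)), ?_⟩
      exact (hsub ⟨x, Valued.integer.mem_iff.2 hx⟩ _).1 (hσ _).symm
    · intro x hx y hy hxy
      obtain ⟨a, -, rfl⟩ := Finset.mem_image.1 hx
      obtain ⟨b, -, rfl⟩ := Finset.mem_image.1 hy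
      refine le_antisymm ((norm_sub_le_max_norm _ _).trans (max_le
        (Valued.integer.norm_le_one (σ a)) (Valued.integer.norm_le_one (σ b)))) ?_
      by_contra! hlt
      have := (hsub (σ a) (σ b)).2 hlt
      rw [hσ, hσ] at this
      exact hxy (by rw [this])

section GaloisTopology

theorem normal_of_isAlgClosed (F Ω : Type*) [Field F] [Field Ω] [Algebra F Ω]
    [Algebra.IsAlgebraic F Ω] [IsAlgClosed Ω] : Normal F Ω :=
  normal_iff.2 fun x => ⟨Algebra.IsIntegral.isIntegral x, IsAlgClosed.splits _⟩

variable {F Ω : Type*} [Field F] [Field Ω] [Algebra F Ω] [Algebra.IsAlgebraic F Ω]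

theorem isOpen_setOf_apply_eq (x y : Ω) : IsOpen {g : Ω ≃ₐ[F] Ω | g x = y} := by
  by_cases h : ∃ g0 : Ω ≃ₐ[F] Ω, g0 x = y
  · obtain ⟨g0, rfl⟩ := h
    have h1 : IsOpen (MulAction.stabilizer (Ω ≃ₐ[F] Ω) x : Set (Ω ≃ₐ[F] Ω)) :=
      stabilizer_isOpen_of_isIntegral x
    convert h1.preimage (continuous_const_mul g0⁻¹) using 1
    ext g
    change g x = g0 x ↔ g0.symm (g x) = x
    rw [AlgEquiv.symm_apply_eq]
  · convert isOpen_empty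
    ext g
    simpa using fun hg => h ⟨g, hg⟩

theorem isClosed_setOf_apply_eq (x y : Ω) : IsClosed {g : Ω ≃ₐ[F] Ω | g x = y} := by
  have : {g : Ω ≃ₐ[F] Ω | g x = y}ᶜ = ⋃ z ∈ ({y}ᶜ : Set Ω), {g | g x = z} := by
    ext g
    simp
  rw [← isOpen_compl_iff, this]
  exact isOpen_biUnion fun z _ => isOpen_setOf_apply_eq x z

end GaloisTopology

section NormClosure

variable {F Ω : Type*} [NontriviallyNormedField F] [IsUltrametricDist F] [ProperSpace F]
  [NontriviallyNormedField Ω] [NormedAlgebra F Ω] [Algebra.IsAlgebraic F Ω]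

theorem norm_algEquiv_apply (g : Ω ≃ₐ[F] Ω) (x : Ω) : ‖g x‖ = ‖x‖ := by
  rw [NormedAlgebra.norm_eq_spectralNorm F, NormedAlgebra.norm_eq_spectralNorm F, spectralNorm,
    spectralNorm, minpoly.algEquiv_eq]

theorem norm_coeff_minpoly_le_one {x : Ω} (hx : ‖x‖ ≤ 1) (n : ℕ) :
    ‖(minpoly F x).coeff n‖ ≤ 1 := by
  rw [NormedAlgebra.norm_eq_spectralNorm F, spectralNorm] at hx
  exact (spectralValue_le_one_iff (minpoly.monic (Algebra.IsIntegral.isIntegral x))).1 hx n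

end NormClosure

section FrobeniusCongruence

variable {Ω : Type*} [NormedField Ω] [IsUltrametricDist Ω]

theorem norm_add_lt_one {x y : Ω} (hx : ‖x‖ < 1) (hy : ‖y‖ < 1) : ‖x + y‖ < 1 :=
  (IsUltrametricDist.norm_add_le_max _ _).trans_lt (max_lt hx hy)

theorem norm_sub_lt_one {x y : Ω} (hx : ‖x‖ < 1) (hy : ‖y‖ < 1) : ‖x - y‖ < 1 :=
  (norm_sub_le_max_norm _ _).trans_lt (max_lt hx hy)

theorem norm_sum_le_one {ι : Type*} (s : Finset ι) (f : ι → Ω) (hf : ∀ i ∈ s, ‖f i‖ ≤ 1) :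
    ‖∑ i ∈ s, f i‖ ≤ 1 :=
  IsUltrametricDist.norm_sum_le_of_forall_le_of_nonneg zero_le_one hf

theorem norm_sum_lt_one {ι : Type*} (s : Finset ι) (f : ι → Ω) (hf : ∀ i ∈ s, ‖f i‖ < 1) :
    ‖∑ i ∈ s, f i‖ < 1 := by
  classical
  induction s using Finset.induction_on with
  | empty => simp
  | insert a s ha ih =>
    rw [Finset.sum_insert ha]
    exact norm_add_lt_one (hf a (Finset.mem_insert_self a s))
      (ih fun i hi => hf i (Finset.mem_insert_of_mem hi))

theorem exists_norm_lt_one_of_prod {ι : Type*} (s : Finset ι) (f : ι → Ω)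
    (hf : ∀ i ∈ s, ‖f i‖ ≤ 1) (h : ‖∏ i ∈ s, f i‖ < 1) : ∃ i ∈ s, ‖f i‖ < 1 := by
  by_contra! hc
  rw [norm_prod, Finset.prod_congr rfl fun i hi => le_antisymm (hf i hi) (hc i hi)] at h
  simp at h

theorem norm_add_pow_sub_lt_one {p : ℕ} (hp : p.Prime) (hpn : ‖(p : Ω)‖ < 1) (s : ℕ) {x y : Ω}
    (hx : ‖x‖ ≤ 1) (hy : ‖y‖ ≤ 1) : ‖(x + y) ^ p ^ s - (x ^ p ^ s + y ^ p ^ s)‖ < 1 := by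
  rw [add_pow_prime_pow_eq hp, add_sub_cancel_left, norm_mul, norm_mul, norm_mul, mul_assoc, mul_assoc]
  refine mul_lt_one_of_nonneg_of_lt_one_left (norm_nonneg _) hpn (mul_le_one₀ hx (by positivity)
    (mul_le_one₀ hy (norm_nonneg _) (norm_sum_le_one _ _ ?_)))
  intro i _
  rw [norm_mul, norm_mul, norm_pow, norm_pow]
  exact mul_le_one₀ (mul_le_one₀ (pow_le_one₀ (norm_nonneg _) hx) (by positivity)
    (pow_le_one₀ (norm_nonneg _) hy)) (norm_nonneg _) (IsUltrametricDist.norm_natCast_le_one Ω _)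

theorem norm_sum_pow_sub_lt_one {p : ℕ} (hp : p.Prime) (hpn : ‖(p : Ω)‖ < 1) {q s : ℕ}
    (hq : q = p ^ s) {ι : Type*} (t : Finset ι) (f : ι → Ω) (hf : ∀ i ∈ t, ‖f i‖ ≤ 1) :
    ‖(∑ i ∈ t, f i) ^ q - ∑ i ∈ t, f i ^ q‖ < 1 := by
  classical
  subst hq
  induction t using Finset.induction_on with
  | empty => simp [hp.ne_zero]
  | insert a t ha ih =>
    have hf' : ∀ i ∈ t, ‖f i‖ ≤ 1 := fun i hi => hf i (Finset.mem_insert_of_mem hi)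
    rw [Finset.sum_insert ha, Finset.sum_insert ha]
    have h1 := norm_add_pow_sub_lt_one hp hpn s (hf a (Finset.mem_insert_self a t))
      (norm_sum_le_one t f hf')
    have h2 := norm_add_lt_one h1 (ih hf')
    convert h2 using 2
    ring

end FrobeniusCongruence

section FrobeniusElement

variable {F Ω : Type*} [NontriviallyNormedField F] [IsUltrametricDist F] [ProperSpace F]
  [NontriviallyNormedField Ω] [IsUltrametricDist Ω] [NormedAlgebra F Ω] [Algebra.IsAlgebraic F Ω]
  [IsAlgClosed Ω] [CharZero Ω] {p q : ℕ} {ϖ : F}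

open Polynomial in
theorem LocalParam.norm_aeval_pow_sub (h : LocalParam p F ϖ q) (P : Polynomial F)
    (hP : ∀ i, ‖P.coeff i‖ ≤ 1) {x : Ω} (hx : ‖x‖ ≤ 1) :
    ‖(aeval x P) ^ q - aeval (x ^ q) P‖ < 1 := by
  obtain ⟨s, -, hs⟩ := h.eq_pow
  have hpn : ‖(p : Ω)‖ < 1 := by
    rw [← map_natCast (algebraMap F Ω), norm_algebraMap']
    exact h.norm_p_lt_one
  rw [aeval_eq_sum_range, aeval_eq_sum_range]
  have h1 := norm_sum_pow_sub_lt_one h.prime hpn hs (Finset.range (P.natDegree + 1))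
    (fun i => P.coeff i • x ^ i) (fun i _ => by
      rw [norm_smul, norm_pow]
      exact mul_le_one₀ (hP i) (by positivity) (pow_le_one₀ (norm_nonneg _) hx))
  have h2 : ‖∑ i ∈ Finset.range (P.natDegree + 1), ((P.coeff i • x ^ i) ^ q -
      P.coeff i • (x ^ q) ^ i)‖ < 1 := by
    refine norm_sum_lt_one _ _ fun i _ => ?_
    rw [_root_.smul_pow, ← pow_mul, ← pow_mul, mul_comm q i, ← sub_smul, norm_smul, norm_pow]
    exact mul_lt_one_of_nonneg_of_lt_one_left (norm_nonneg _) (h.pow_residue _ (hP i))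
      (pow_le_one₀ (norm_nonneg _) hx)
  have h3 := norm_add_lt_one h1 h2
  rw [Finset.sum_sub_distrib] at h3
  convert h3 using 2
  ring

theorem LocalParam.norm_natCast_lt_one (h : LocalParam p F ϖ q) : ‖(p : Ω)‖ < 1 := by
  rw [← map_natCast (algebraMap F Ω), norm_algebraMap']
  exact h.norm_p_lt_one

open Polynomial in
theorem LocalParam.exists_apply_eq_pow (h : LocalParam p F ϖ q) {k : ℕ} (hk : ¬ p ∣ k) {ζ : Ω}
    (hζ : ζ ^ k = 1) : ∃ g : Ω ≃ₐ[F] Ω, g ζ = ζ ^ q := by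
  classical
  have hk0 : k ≠ 0 := by
    rintro rfl
    exact hk (dvd_zero p)
  have := normal_of_isAlgClosed F Ω
  have hpn : ‖(p : Ω)‖ < 1 := h.norm_natCast_lt_one
  have hintegral : IsIntegral F ζ := Algebra.IsIntegral.isIntegral ζ
  have hζ1 : ‖ζ‖ = 1 := norm_eq_one_of_pow_eq_one' hk0 hζ
  set f := minpoly F ζ
  have hf : f.Monic := minpoly.monic hintegral
  have hroots : ∀ y ∈ f.aroots Ω, ∃ g : Ω ≃ₐ[F] Ω, g ζ = y := fun y hy =>
    minpoly.exists_algEquiv_of_root' hintegral.isAlgebraic (mem_aroots'.1 hy).2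
  have h1 : ‖aeval (ζ ^ q) f‖ < 1 := by
    have h2 := h.norm_aeval_pow_sub f (norm_coeff_minpoly_le_one hζ1.le) hζ1.le
    obtain ⟨s, -, hs⟩ := h.eq_pow
    rw [minpoly.aeval, zero_pow (by rw [hs]; exact pow_ne_zero _ h.prime.ne_zero), zero_sub,
      norm_neg] at h2
    exact h2
  have h3 : aeval (ζ ^ q) f = ((f.aroots Ω).map fun y => ζ ^ q - y).prod := by
    have h4 := (IsAlgClosed.splits (f.map (algebraMap F Ω))).eq_prod_roots
    rw [(hf.map _).leadingCoeff, map_one, one_mul] at h4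
    rw [← eval_map_algebraMap]
    conv_lhs => rw [h4]
    rw [eval_multiset_prod, Multiset.map_map]
    simp [aroots]
  have h5 : ∃ y ∈ f.aroots Ω, ‖ζ ^ q - y‖ < 1 := by
    by_contra! hc
    rw [h3] at h1
    have h6 : ∀ m : Multiset Ω, (∀ y ∈ m, 1 ≤ ‖ζ ^ q - y‖) →
        1 ≤ ‖(m.map fun y => ζ ^ q - y).prod‖ := by
      intro m
      induction m using Multiset.induction_on with
      | empty => simp
      | cons a m ih =>
        intro hm
        rw [Multiset.map_cons, Multiset.prod_cons, norm_mul]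
        exact one_le_mul_of_one_le_of_one_le (hm a (Multiset.mem_cons_self a m))
          (ih fun y hy => hm y (Multiset.mem_cons_of_mem hy))
    exact absurd h1 (not_lt.2 (h6 _ hc))
  obtain ⟨y, hy, hlt⟩ := h5
  obtain ⟨g, rfl⟩ := hroots y hy
  refine ⟨g, (eq_of_norm_sub_lt_one h.prime hpn hk ?_ ?_ hlt).symm⟩
  · rw [← pow_mul, mul_comm, pow_mul, hζ, one_pow]
  · rw [← map_pow, hζ, map_one]

/-- There is a Frobenius element: an automorphism raising all roots of unity of order prime to
the residue characteristic to the power `q`. -/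
theorem LocalParam.exists_frobenius (h : LocalParam p F ϖ q) : ∃ φ : Ω ≃ₐ[F] Ω,
    ∀ (k : ℕ) (ζ : Ω), ¬ p ∣ k → ζ ^ k = 1 → φ ζ = ζ ^ q := by
  have hc0 : CharZero F := (algebraMap F Ω).charZero_iff (algebraMap F Ω).injective |>.2
    inferInstance
  have := normal_of_isAlgClosed F Ω
  have : IsGalois F Ω := ⟨⟩
  let t : {k : ℕ // ¬ p ∣ k} → Set (Ω ≃ₐ[F] Ω) := fun k => {g | ∀ ζ : Ω, ζ ^ k.1 = 1 → g ζ = ζ ^ q}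
  have : Nonempty {k : ℕ // ¬ p ∣ k} := ⟨⟨1, h.prime.one_lt.ne' ∘ Nat.dvd_one.1⟩⟩
  have hcl : ∀ k, IsClosed (t k) := by
    intro k
    have : t k = ⋂ (ζ : Ω) (_ : ζ ^ k.1 = 1), {g | g ζ = ζ ^ q} := by
      ext g
      simp [t]
    rw [this]
    exact isClosed_iInter fun ζ => isClosed_iInter fun _ => isClosed_setOf_apply_eq _ _
  have hdir : Directed (· ⊇ ·) t := by
    intro a b
    refine ⟨⟨a * b, fun hd => (h.prime.dvd_mul.1 hd).elim a.2 b.2⟩, fun g hg ζ hζ => hg ζ ?_,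
      fun g hg ζ hζ => hg ζ ?_⟩
    · change ζ ^ (a.1 * b.1) = 1
      rw [pow_mul, hζ, one_pow]
    · change ζ ^ (a.1 * b.1) = 1
      rw [mul_comm, pow_mul, hζ, one_pow]
  have hne : ∀ k, (t k).Nonempty := by
    rintro ⟨k, hk⟩
    have hk0 : k ≠ 0 := by
      rintro rfl
      exact hk (dvd_zero p)
    have : NeZero k := ⟨hk0⟩
    have : NeZero (k : Ω) := ⟨Nat.cast_ne_zero.2 hk0⟩
    obtain ⟨ζ, hζ⟩ := HasEnoughRootsOfUnity.exists_primitiveRoot Ω k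
    obtain ⟨g, hg⟩ := h.exists_apply_eq_pow hk hζ.pow_eq_one
    refine ⟨g, fun ξ hξ => ?_⟩
    obtain ⟨i, -, rfl⟩ := hζ.eq_pow_of_pow_eq_one hξ
    rw [map_pow, hg, ← pow_mul, ← pow_mul, mul_comm]
  obtain ⟨φ, hφ⟩ := IsCompact.nonempty_iInter_of_directed_nonempty_isCompact_isClosed t hdir hne
    (fun k => (hcl k).isCompact) hcl
  exact ⟨φ, fun k ζ hk hζ => Set.mem_iInter.1 hφ ⟨k, hk⟩ ζ hζ⟩

end FrobeniusElement

/-- The subextension generated by the roots of unity of order prime to `p`. -/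
def unramClosure (p : ℕ) (F Ω : Type*) [Field F] [Field Ω] [Algebra F Ω] : IntermediateField F Ω :=
  adjoin F {x : Ω | ∃ n : ℕ, 0 < n ∧ ¬ p ∣ n ∧ x ^ n = 1}

theorem isGalois_of_isAlgClosed (F Ω : Type*) [Field F] [Field Ω] [Algebra F Ω]
    [Algebra.IsAlgebraic F Ω] [IsAlgClosed Ω] [CharZero Ω] : IsGalois F Ω := by
  have hc0 : CharZero F := (algebraMap F Ω).charZero_iff (algebraMap F Ω).injective |>.2
    inferInstance
  have := normal_of_isAlgClosed F Ω
  exact ⟨⟩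

section

variable {F Ω : Type*} [Field F] [Field Ω] [Algebra F Ω]

theorem adjoin_rootOfUnity_le_unramClosure {p k : ℕ} (hk : ¬ p ∣ k) {ζ : Ω} (hζ : ζ ^ k = 1) :
    F⟮ζ⟯ ≤ unramClosure p F Ω := by
  refine adjoin.mono F _ _ ?_
  rw [Set.singleton_subset_iff]
  exact ⟨k, Nat.pos_of_ne_zero (by rintro rfl; exact hk (dvd_zero p)), hk, hζ⟩

theorem exists_rootOfUnity_of_mem_unramClosure [IsAlgClosed Ω] [CharZero Ω] {p : ℕ}
    (hp : p.Prime) {x : Ω} (hx : x ∈ unramClosure p F Ω) :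
    ∃ (k : ℕ) (ζ : Ω), ¬ p ∣ k ∧ IsPrimitiveRoot ζ k ∧ x ∈ F⟮ζ⟯ := by
  have prim : ∀ k : ℕ, ¬ p ∣ k → ∃ ζ : Ω, IsPrimitiveRoot ζ k := by
    intro k hk
    have hk0 : k ≠ 0 := by
      rintro rfl
      exact hk (dvd_zero p)
    have : NeZero k := ⟨hk0⟩
    have : NeZero (k : Ω) := ⟨Nat.cast_ne_zero.2 hk0⟩
    exact HasEnoughRootsOfUnity.exists_primitiveRoot Ω k
  have le : ∀ {k l : ℕ} {ζ η : Ω}, ¬ p ∣ k → ¬ p ∣ l → IsPrimitiveRoot ζ k →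
      IsPrimitiveRoot η (k * l) → F⟮ζ⟯ ≤ F⟮η⟯ := by
    intro k l ζ η hk hl hζ hη
    rw [adjoin_simple_le_iff]
    have : NeZero (k * l) := ⟨by
      intro h0
      exact (hp.dvd_mul.1 (h0 ▸ dvd_zero p)).elim hk hl⟩
    obtain ⟨i, -, rfl⟩ := hη.eq_pow_of_pow_eq_one (ξ := ζ) (by
      rw [pow_mul, hζ.pow_eq_one, one_pow])
    exact pow_mem (mem_adjoin_simple_self F η) i
  have key : ∀ {k l : ℕ} {ζ ξ a b : Ω}, ¬ p ∣ k → ¬ p ∣ l → IsPrimitiveRoot ζ k →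
      IsPrimitiveRoot ξ l → a ∈ F⟮ζ⟯ → b ∈ F⟮ξ⟯ →
      ∃ (m : ℕ) (η : Ω), ¬ p ∣ m ∧ IsPrimitiveRoot η m ∧ a ∈ F⟮η⟯ ∧ b ∈ F⟮η⟯ := by
    intro k l ζ ξ a b hk hl hζ hξ ha hb
    have hkl : ¬ p ∣ k * l := fun h => (hp.dvd_mul.1 h).elim hk hl
    obtain ⟨η, hη⟩ := prim (k * l) hkl
    exact ⟨_, η, hkl, hη, le hk hl hζ hη ha, le hl hk hξ (mul_comm k l ▸ hη) hb⟩
  have h1 : ¬ p ∣ 1 := hp.one_lt.ne' ∘ Nat.dvd_one.1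
  unfold unramClosure at hx
  induction hx using adjoin_induction with
  | mem x hx =>
    obtain ⟨n, hn, hpn, hxn⟩ := hx
    have : NeZero n := ⟨hn.ne'⟩
    obtain ⟨η, hη⟩ := prim n hpn
    obtain ⟨i, -, rfl⟩ := hη.eq_pow_of_pow_eq_one hxn
    exact ⟨n, η, hpn, hη, pow_mem (mem_adjoin_simple_self F η) i⟩
  | algebraMap x =>
    exact ⟨1, 1, h1, IsPrimitiveRoot.one, IntermediateField.algebraMap_mem _ x⟩
  | add x y _ _ hx hy =>
    obtain ⟨k, ζ, hk, hζ, hx⟩ := hx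
    obtain ⟨l, ξ, hl, hξ, hy⟩ := hy
    obtain ⟨m, η, hm, hη, ha, hb⟩ := key hk hl hζ hξ hx hy
    exact ⟨m, η, hm, hη, add_mem ha hb⟩
  | inv x _ hx =>
    obtain ⟨k, ζ, hk, hζ, hx⟩ := hx
    exact ⟨k, ζ, hk, hζ, inv_mem hx⟩
  | mul x y _ _ hx hy =>
    obtain ⟨k, ζ, hk, hζ, hx⟩ := hx
    obtain ⟨l, ξ, hl, hξ, hy⟩ := hy
    obtain ⟨m, η, hm, hη, ha, hb⟩ := key hk hl hζ hξ hx hy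
    exact ⟨m, η, hm, hη, mul_mem ha hb⟩

/-- Automorphisms agreeing on a generator agree on the simple extension. -/
theorem apply_eq_apply_of_mem_adjoin_simple {g g' : Ω ≃ₐ[F] Ω} {ζ x : Ω} (h : g ζ = g' ζ)
    (hx : x ∈ F⟮ζ⟯) : g x = g' x := by
  have : F⟮ζ⟯ ≤ (AlgHom.equalizer (g : Ω →ₐ[F] Ω) (g' : Ω →ₐ[F] Ω) |>.toIntermediateField
      fun y hy => by
        change g y⁻¹ = g' y⁻¹
        rw [map_inv₀, map_inv₀]
        exact congrArg _ hy) := by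
    rw [adjoin_simple_le_iff]
    exact h
  exact this hx

end

section

variable {F Ω : Type*} [NontriviallyNormedField F] [IsUltrametricDist F] [ProperSpace F]
  [NontriviallyNormedField Ω] [IsUltrametricDist Ω] [NormedAlgebra F Ω] [Algebra.IsAlgebraic F Ω]
  [IsAlgClosed Ω] [CharZero Ω] {p q : ℕ} {ϖ : F}

open scoped NormedField Valued in
/-- Elements of the residue field fixed by the `q`-power map come from the base field. -/
theorem LocalParam.exists_norm_sub_lt_one (h : LocalParam p F ϖ q) {c : Ω} (hc : ‖c‖ ≤ 1)
    (hcq : ‖c ^ q - c‖ < 1) : ∃ t : F, ‖t‖ ≤ 1 ∧ ‖algebraMap F Ω t - c‖ < 1 := by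
  classical
  have hres : ∀ x y : 𝒪[Ω], IsLocalRing.residue 𝒪[Ω] x = IsLocalRing.residue 𝒪[Ω] y ↔
      ‖(x : Ω) - y‖ < 1 := by
    intro x y
    rw [← sub_eq_zero, ← map_sub, IsLocalRing.residue_eq_zero_iff, IsLocalRing.mem_maximalIdeal,
      mem_nonunits_iff, Valued.integer.isUnit_iff_norm_eq_one]
    exact (lt_iff_le_and_ne.trans (and_iff_right (Valued.integer.norm_le_one (x - y)))).symm
  obtain ⟨T, hTc, hT1, -, hT2⟩ := h.residue
  obtain ⟨s, hs0, hs⟩ := h.eq_pow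
  have hq1 : 1 < q := hs ▸ Nat.one_lt_pow hs0 h.prime.one_lt
  have hmem : ∀ t : T, algebraMap F Ω t.1 ∈ 𝒪[Ω] := fun t =>
    Valued.integer.mem_iff.2 (by rw [norm_algebraMap']; exact hT1 t.1 t.2)
  let τ : T → 𝓀[Ω] := fun t => IsLocalRing.residue 𝒪[Ω] ⟨algebraMap F Ω t.1, hmem t⟩
  have hτ : Function.Injective τ := by
    intro a b hab
    by_contra hne
    have h1 := (hres _ _).1 hab
    rw [← map_sub, norm_algebraMap',
      hT2 a.1 a.2 b.1 b.2 fun h => hne (Subtype.ext h)] at h1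
    exact lt_irrefl _ h1
  let c' : 𝒪[Ω] := ⟨c, Valued.integer.mem_iff.2 hc⟩
  have hroots : ∀ t : T, τ t ^ q = τ t := fun t => by
    rw [← map_pow]
    refine (hres _ _).2 ?_
    change ‖algebraMap F Ω t.1 ^ q - algebraMap F Ω t.1‖ < 1
    rw [← map_pow, ← map_sub, norm_algebraMap']
    exact h.pow_residue _ (hT1 t.1 t.2)
  have hcroot : IsLocalRing.residue 𝒪[Ω] c' ^ q = IsLocalRing.residue 𝒪[Ω] c' := by
    rw [← map_pow]
    exact (hres _ _).2 hcq
  by_contra! hcon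
  have hnot : IsLocalRing.residue 𝒪[Ω] c' ∉ Finset.univ.image τ := by
    intro hmem'
    obtain ⟨t, -, ht⟩ := Finset.mem_image.1 hmem'
    exact absurd ((hres _ _).1 ht) (not_lt.2 (hcon t.1 (hT1 t.1 t.2)))
  have hdeg := FiniteField.X_pow_card_sub_X_natDegree_eq 𝓀[Ω] hq1
  have hne := FiniteField.X_pow_card_sub_X_ne_zero 𝓀[Ω] hq1
  have hle := Polynomial.card_le_degree_of_subset_roots
    (p := (Polynomial.X ^ q - Polynomial.X : Polynomial 𝓀[Ω]))
    (Z := insert (IsLocalRing.residue 𝒪[Ω] c') (Finset.univ.image τ)) (by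
      intro a ha
      rw [Polynomial.mem_roots hne]
      have : a ^ q = a := by
        have ha' : a ∈ insert (IsLocalRing.residue 𝒪[Ω] c') (Finset.univ.image τ) := ha
        rcases Finset.mem_insert.1 ha' with rfl | ha
        · exact hcroot
        · obtain ⟨t, -, rfl⟩ := Finset.mem_image.1 ha
          exact hroots t
      simp [this])
  rw [hdeg, Finset.card_insert_of_notMem hnot, Finset.card_image_of_injective _ hτ,
    Finset.card_univ, Fintype.card_coe, hTc] at hle
  omega

open scoped NormedField Valued in
theorem LocalParam.norm_coeff_prod_frobenius (h : LocalParam p F ϖ q) {ζ : Ω} (hζ : ‖ζ‖ ≤ 1)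
    {r : ℕ} (hr : ζ ^ q ^ r = ζ) (j : ℕ) :
    ‖(∏ i ∈ Finset.range r, (Polynomial.X - Polynomial.C (ζ ^ q ^ i))).coeff j‖ ≤ 1 ∧
    ‖(∏ i ∈ Finset.range r, (Polynomial.X - Polynomial.C (ζ ^ q ^ i))).coeff j ^ q -
      (∏ i ∈ Finset.range r, (Polynomial.X - Polynomial.C (ζ ^ q ^ i))).coeff j‖ < 1 := by
  have hres : ∀ x y : 𝒪[Ω], IsLocalRing.residue 𝒪[Ω] x = IsLocalRing.residue 𝒪[Ω] y ↔
      ‖(x : Ω) - y‖ < 1 := by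
    intro x y
    rw [← sub_eq_zero, ← map_sub, IsLocalRing.residue_eq_zero_iff, IsLocalRing.mem_maximalIdeal,
      mem_nonunits_iff, Valued.integer.isUnit_iff_norm_eq_one]
    exact (lt_iff_le_and_ne.trans (and_iff_right (Valued.integer.norm_le_one (x - y)))).symm
  obtain ⟨s, hs0, hs⟩ := h.eq_pow
  let z : 𝒪[Ω] := ⟨ζ, Valued.integer.mem_iff.2 hζ⟩
  have hz : z ^ q ^ r = z := Subtype.ext hr
  set H : Polynomial 𝒪[Ω] :=
    ∏ i ∈ Finset.range r, (Polynomial.X - Polynomial.C (z ^ q ^ i)) with hH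
  have hmap : ∏ i ∈ Finset.range r, (Polynomial.X - Polynomial.C (ζ ^ q ^ i)) =
      H.map (algebraMap 𝒪[Ω] Ω) := by
    simp [hH, Polynomial.map_prod]
    rfl
  have hcoeff : (∏ i ∈ Finset.range r, (Polynomial.X - Polynomial.C (ζ ^ q ^ i))).coeff j =
      ((H.coeff j : 𝒪[Ω]) : Ω) := by
    rw [hmap, Polynomial.coeff_map]
    rfl
  rw [hcoeff]
  refine ⟨Valued.integer.norm_le_one (H.coeff j), ?_⟩
  have : Fact p.Prime := ⟨h.prime⟩
  have hpk : ((p : ℕ) : 𝓀[Ω]) = 0 := by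
    have := (hres (p : 𝒪[Ω]) 0).2 (by simpa using h.norm_natCast_lt_one (Ω := Ω))
    simpa using this
  have : CharP 𝓀[Ω] p := ringChar.of_eq (CharP.ringChar_of_prime_eq_zero h.prime hpk)
  have hfrob : (H.map (IsLocalRing.residue 𝒪[Ω])).map (iterateFrobenius 𝓀[Ω] p s) =
      H.map (IsLocalRing.residue 𝒪[Ω]) := by
    have hzr : IsLocalRing.residue 𝒪[Ω] z ^ q ^ r = IsLocalRing.residue 𝒪[Ω] z := by
      rw [← map_pow, hz]
    simp only [hH, Polynomial.map_prod, Polynomial.map_sub, Polynomial.map_X, Polynomial.map_C,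
      Polynomial.map_pow, map_pow, iterateFrobenius_def, ← hs]
    have hsh := Finset.prod_range_succ (fun i => (Polynomial.X -
      Polynomial.C (IsLocalRing.residue 𝒪[Ω] z) ^ q ^ i : Polynomial 𝓀[Ω])) r
    have hsh' := Finset.prod_range_succ' (fun i => (Polynomial.X -
      Polynomial.C (IsLocalRing.residue 𝒪[Ω] z) ^ q ^ i : Polynomial 𝓀[Ω])) r
    rw [hsh'] at hsh
    have hne : (Polynomial.X - Polynomial.C (IsLocalRing.residue 𝒪[Ω] z) : Polynomial 𝓀[Ω]) ≠ 0 :=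
      Polynomial.X_sub_C_ne_zero _
    rw [pow_zero, pow_one, ← map_pow, hzr] at hsh
    have hfin := mul_right_cancel₀ hne hsh
    simpa only [map_pow, ← pow_mul, pow_succ, mul_comm] using hfin
  have hj := congrArg (fun P => Polynomial.coeff P j) hfrob
  simp only [Polynomial.coeff_map, iterateFrobenius_def, ← hs, ← map_pow] at hj
  exact (hres _ _).1 hj

/-- The conjugates of a root of unity of order prime to `p` are its `q`-power iterates. -/
theorem LocalParam.exists_apply_eq_pow_pow (h : LocalParam p F ϖ q) {k : ℕ} (hk : ¬ p ∣ k) {ζ : Ω}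
    (hζ : ζ ^ k = 1) (g : Ω ≃ₐ[F] Ω) : ∃ i : ℕ, g ζ = ζ ^ q ^ i := by
  obtain ⟨s, hs0, hs⟩ := h.eq_pow
  have hk0 : k ≠ 0 := by
    rintro rfl
    exact hk (dvd_zero p)
  have hζ1 : ‖ζ‖ = 1 := norm_eq_one_of_pow_eq_one' hk0 hζ
  have hcop : Nat.Coprime q k := by
    rw [hs]
    exact Nat.Coprime.pow_left s ((Nat.Prime.coprime_iff_not_dvd h.prime).2 hk)
  set r := k.totient
  have hr : ζ ^ q ^ r = ζ := by
    have h1 : q ^ r ≡ 1 [MOD k] := Nat.ModEq.pow_totient hcop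
    have h2 := pow_eq_pow_of_modEq h1 hζ
    rwa [pow_one] at h2
  set H : Polynomial Ω := ∏ i ∈ Finset.range r, (Polynomial.X - Polynomial.C (ζ ^ q ^ i)) with hH
  choose t ht1 ht using fun j => h.exists_norm_sub_lt_one
    (h.norm_coeff_prod_frobenius hζ1.le hr j).1 (h.norm_coeff_prod_frobenius hζ1.le hr j).2
  have hdeg : H.natDegree < r + 1 := by
    rw [hH, Polynomial.natDegree_prod_of_monic _ _ fun i _ => Polynomial.monic_X_sub_C _]
    simp only [Polynomial.natDegree_X_sub_C]
    simp
  let P : Polynomial F := ∑ j ∈ Finset.range (r + 1), Polynomial.monomial j (t j)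
  have hclose : ∀ x : Ω, ‖x‖ ≤ 1 → ‖Polynomial.aeval x P - H.eval x‖ < 1 := by
    intro x hx
    rw [Polynomial.eval_eq_sum_range' hdeg]
    simp only [P, map_sum, Polynomial.aeval_monomial]
    rw [← Finset.sum_sub_distrib]
    refine norm_sum_lt_one _ _ fun j _ => ?_
    rw [← sub_mul, norm_mul, norm_pow]
    exact mul_lt_one_of_nonneg_of_lt_one_left (norm_nonneg _) (ht j)
      (pow_le_one₀ (norm_nonneg _) hx)
  have hrpos : 0 < r := Nat.totient_pos.2 (Nat.pos_of_ne_zero hk0)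
  have hHζ : H.eval ζ = 0 := by
    rw [hH, Polynomial.eval_prod]
    exact Finset.prod_eq_zero (Finset.mem_range.2 hrpos) (by simp)
  have hPζ : ‖Polynomial.aeval (g ζ) P‖ < 1 := by
    have h1 : Polynomial.aeval (g ζ) P = g (Polynomial.aeval ζ P) :=
      Polynomial.aeval_algHom_apply (g : Ω →ₐ[F] Ω) ζ P
    rw [h1, norm_algEquiv_apply]
    simpa [hHζ] using hclose ζ hζ1.le
  have hgζ : ‖g ζ‖ ≤ 1 := by rw [norm_algEquiv_apply, hζ1]
  have hHg : ‖H.eval (g ζ)‖ < 1 := by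
    have := norm_sub_lt_one hPζ (hclose _ hgζ)
    simpa using this
  rw [hH, Polynomial.eval_prod] at hHg
  obtain ⟨i, -, hi⟩ := exists_norm_lt_one_of_prod _ _ (fun i _ => by
    simp only [Polynomial.eval_sub, Polynomial.eval_X, Polynomial.eval_C]
    refine (norm_sub_le_max_norm _ _).trans (max_le hgζ ?_)
    rw [norm_pow, hζ1, one_pow]) hHg
  refine ⟨i, eq_of_norm_sub_lt_one h.prime h.norm_natCast_lt_one hk ?_ ?_ (by simpa using hi)⟩
  · rw [← map_pow, hζ, map_one]
  · rw [← pow_mul, mul_comm, pow_mul, hζ, one_pow]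

end

/-- `φ` raises the roots of unity of order prime to `p` to the `q`-th power. -/
def IsFrobenius (p q : ℕ) {F Ω : Type*} [Field F] [Field Ω] [Algebra F Ω]
    (φ : Ω ≃ₐ[F] Ω) : Prop :=
  ∀ (k : ℕ) (ζ : Ω), ¬ p ∣ k → ζ ^ k = 1 → φ ζ = ζ ^ q

theorem IsFrobenius.pow_apply {p q : ℕ} {F Ω : Type*} [Field F] [Field Ω] [Algebra F Ω]
    {φ : Ω ≃ₐ[F] Ω} (hφ : IsFrobenius p q φ) {k : ℕ} {ζ : Ω} (hk : ¬ p ∣ k) (hζ : ζ ^ k = 1)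
    (i : ℕ) : (φ ^ i) ζ = ζ ^ q ^ i := by
  induction i with
  | zero => simp
  | succ i ih =>
    rw [pow_succ', AlgEquiv.mul_apply, ih, map_pow, hφ k ζ hk hζ, ← pow_mul, pow_succ, mul_comm]

section

variable {F Ω : Type*} [NontriviallyNormedField F] [IsUltrametricDist F] [ProperSpace F]
  [NontriviallyNormedField Ω] [IsUltrametricDist Ω] [NormedAlgebra F Ω] [Algebra.IsAlgebraic F Ω]
  [IsAlgClosed Ω] [CharZero Ω] {p q : ℕ} {ϖ : F}

theorem LocalParam.exists_apply_eq_frobenius_pow (h : LocalParam p F ϖ q) {φ : Ω ≃ₐ[F] Ω}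
    (hφ : IsFrobenius p q φ) (g : Ω ≃ₐ[F] Ω) {x : Ω} (hx : x ∈ unramClosure p F Ω) :
    ∃ i : ℕ, g x = (φ ^ i) x := by
  obtain ⟨k, ζ, hk, hζ, hxζ⟩ := exists_rootOfUnity_of_mem_unramClosure h.prime hx
  obtain ⟨i, hi⟩ := h.exists_apply_eq_pow_pow hk hζ.pow_eq_one g
  exact ⟨i, apply_eq_apply_of_mem_adjoin_simple
    (by rw [hi, hφ.pow_apply hk hζ.pow_eq_one]) hxζ⟩

theorem LocalParam.mem_bot_of_frobenius_apply_eq (h : LocalParam p F ϖ q) {φ : Ω ≃ₐ[F] Ω}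
    (hφ : IsFrobenius p q φ) {x : Ω} (hx : x ∈ unramClosure p F Ω) (hφx : φ x = x) :
    x ∈ (⊥ : IntermediateField F Ω) := by
  have := isGalois_of_isAlgClosed F Ω
  rw [InfiniteGalois.mem_bot_iff_fixed]
  intro g
  obtain ⟨i, hi⟩ := h.exists_apply_eq_frobenius_pow hφ g hx
  rw [hi]
  clear hi
  induction i with
  | zero => rfl
  | succ i ih => rw [pow_succ, AlgEquiv.mul_apply, hφx, ih]

theorem LocalParam.norm_le_of_norm_lt_one (h : LocalParam p F ϖ q) {x : F} (hx : ‖x‖ < 1) :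
    ‖x‖ ≤ ‖ϖ‖ := by
  by_cases hx0 : x = 0
  · simp [hx0]
  obtain ⟨k, hk⟩ := h.norm_eq_zpow x hx0
  have hpos : 0 < ‖ϖ‖ := norm_pos_iff.2 h.unif_ne_zero
  have hk1 : 1 ≤ k := by
    by_contra! hlt
    have : 1 ≤ ‖ϖ‖ ^ k := by
      obtain ⟨m, hm⟩ := Int.exists_eq_neg_ofNat (show k ≤ 0 by omega)
      rw [hm, zpow_neg, zpow_natCast]
      exact one_le_inv_iff₀.2 ⟨pow_pos hpos m, pow_le_one₀ hpos.le h.norm_unif_lt_one.le⟩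
    rw [hk] at hx
    exact absurd hx (not_lt.2 this)
  rw [hk]
  conv_rhs => rw [← zpow_one ‖ϖ‖]
  exact zpow_le_zpow_right_of_le_one₀ hpos h.norm_unif_lt_one.le hk1

/-- A unit of a finite extension is congruent to a root of unity of order prime to `p` in it. -/
theorem LocalParam.exists_rootOfUnity_norm_sub_lt_one (h : LocalParam p F ϖ q)
    (L : IntermediateField F Ω) [FiniteDimensional F L] {x : Ω} (hxL : x ∈ L) (hx : ‖x‖ = 1) :
    ∃ (k : ℕ) (ζ : Ω), ¬ p ∣ k ∧ ζ ^ k = 1 ∧ ζ ∈ L ∧ ‖x - ζ‖ < 1 := by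
  have hG := isGalois_of_isAlgClosed F Ω
  have hpn : ‖(p : Ω)‖ < 1 := h.norm_natCast_lt_one
  have hprop : ProperSpace L := FiniteDimensional.proper F L
  obtain ⟨k, hk0, hk⟩ : ∃ k : ℕ, 0 < k ∧ ‖x ^ k - 1‖ < 1 := by
    let u : ℕ → L := fun n => ⟨x, hxL⟩ ^ n
    have hu : ∀ n, u n ∈ Metric.closedBall (0 : L) 1 := by
      intro n
      rw [mem_closedBall_zero_iff]
      change ‖x ^ n‖ ≤ 1
      rw [norm_pow, hx, one_pow]
    obtain ⟨a, -, ψ, hψ, hlim⟩ := (isCompact_closedBall (0 : L) 1).tendsto_subseq hu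
    obtain ⟨N, hN⟩ := Metric.cauchySeq_iff.1 hlim.cauchySeq 1 one_pos
    have hlt : ψ N < ψ (N + 1) := hψ (Nat.lt_succ_self N)
    refine ⟨ψ (N + 1) - ψ N, Nat.sub_pos_of_lt hlt, ?_⟩
    have h1 := hN (N + 1) (Nat.le_succ N) N le_rfl
    rw [dist_eq_norm] at h1
    have h2 : ‖x ^ ψ (N + 1) - x ^ ψ N‖ < 1 := h1
    have h3 : x ^ ψ (N + 1) - x ^ ψ N = x ^ ψ N * (x ^ (ψ (N + 1) - ψ N) - 1) := by
      rw [mul_sub, ← pow_add, Nat.add_sub_cancel' hlt.le, mul_one]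
    rwa [h3, norm_mul, norm_pow, hx, one_pow, one_mul] at h2
  obtain ⟨a, m, hm, rfl⟩ := Nat.exists_eq_pow_mul_and_not_dvd hk0.ne' p h.prime.one_lt.ne'
  have hm0 : m ≠ 0 := by
    rintro rfl
    exact hm (dvd_zero p)
  have hxm : ‖x ^ m‖ = 1 := by rw [norm_pow, hx, one_pow]
  have hxm1 : ‖x ^ m - 1‖ < 1 := by
    have h1 := norm_add_pow_sub_lt_one h.prime hpn a (x := x ^ m - 1) (y := 1)
      ((norm_sub_le_max_norm _ _).trans (by rw [hxm, norm_one, max_self])) norm_one.le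
    rw [sub_add_cancel, one_pow, ← pow_mul, mul_comm m] at h1
    have h2 := norm_sub_lt_one hk h1
    rw [show x ^ (p ^ a * m) - 1 - (x ^ (p ^ a * m) - ((x ^ m - 1) ^ p ^ a + 1)) =
      (x ^ m - 1) ^ p ^ a by ring, norm_pow] at h2
    exact (pow_lt_one_iff_of_nonneg (norm_nonneg _) (pow_ne_zero _ h.prime.ne_zero)).1 h2
  have : NeZero m := ⟨hm0⟩
  have : NeZero (m : Ω) := ⟨Nat.cast_ne_zero.2 hm0⟩
  obtain ⟨ξ, hξ⟩ := HasEnoughRootsOfUnity.exists_primitiveRoot Ω m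
  have hprod : x ^ m - 1 = ∏ ζ ∈ Polynomial.nthRootsFinset m (1 : Ω), (x - ζ) := by
    simpa using hξ.pow_sub_pow_eq_prod_sub_mul x 1 (Nat.pos_of_ne_zero hm0)
  rw [hprod] at hxm1
  obtain ⟨ζ, hζ, hlt⟩ := exists_norm_lt_one_of_prod _ _ (fun ζ hζ => by
    have hζm : ζ ^ m = 1 := (Polynomial.mem_nthRootsFinset (Nat.pos_of_ne_zero hm0) 1).1 hζ
    refine (norm_sub_le_max_norm _ _).trans ?_
    rw [hx, norm_eq_one_of_pow_eq_one' hm0 hζm, max_self]) hxm1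
  have hζm : ζ ^ m = 1 := (Polynomial.mem_nthRootsFinset (Nat.pos_of_ne_zero hm0) 1).1 hζ
  refine ⟨m, ζ, hm, hζm, ?_, hlt⟩
  rw [← InfiniteGalois.fixedField_fixingSubgroup L, mem_fixedField_iff]
  intro g hg
  have hgx : g x = x := (mem_fixingSubgroup_iff L g).1 hg x hxL
  refine eq_of_norm_sub_lt_one h.prime hpn hm (by rw [← map_pow, hζm, map_one]) hζm ?_
  have h1 : ‖x - g ζ‖ < 1 := by
    have h2 : x - g ζ = g (x - ζ) := by rw [map_sub, hgx]
    rw [h2, norm_algEquiv_apply]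
    exact hlt
  have h2 := norm_sub_lt_one hlt h1
  rwa [sub_sub_sub_cancel_left] at h2

/-- A finite extension with the same value group as the base is unramified. -/
theorem LocalParam.le_unramClosure (h : LocalParam p F ϖ q) (L : IntermediateField F Ω)
    [FiniteDimensional F L] (hL : ∀ x ∈ L, ∃ y : F, ‖x‖ = ‖y‖) : L ≤ unramClosure p F Ω := by
  set M := L ⊓ unramClosure p F Ω with hM
  have hMfin : FiniteDimensional F M :=
    FiniteDimensional.of_injective (inclusion (inf_le_left : M ≤ L)).toLinearMap
      (inclusion (inf_le_left : M ≤ L)).injective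
  have hϖ : ‖algebraMap F Ω ϖ‖ = ‖ϖ‖ := norm_algebraMap' _ _
  have hϖ0 : algebraMap F Ω ϖ ≠ 0 := (map_ne_zero _).2 h.unif_ne_zero
  have step : ∀ x ∈ L, ‖x‖ ≤ 1 → ∃ m ∈ M, ‖x - m‖ ≤ ‖ϖ‖ := by
    intro x hx hx1
    have hlt : ∀ y ∈ L, ‖y‖ < 1 → ‖y‖ ≤ ‖ϖ‖ := by
      intro y hy hy1
      obtain ⟨z, hz⟩ := hL y hy
      rw [hz] at hy1 ⊢
      exact h.norm_le_of_norm_lt_one hy1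
    rcases hx1.lt_or_eq with hx1 | hx1
    · exact ⟨0, zero_mem M, by rw [sub_zero]; exact hlt x hx hx1⟩
    · obtain ⟨k, ζ, hk, hζ, hζL, hxζ⟩ := h.exists_rootOfUnity_norm_sub_lt_one L hx hx1
      refine ⟨ζ, ⟨hζL, adjoin_rootOfUnity_le_unramClosure hk hζ (mem_adjoin_simple_self F ζ)⟩, ?_⟩
      exact hlt _ (sub_mem hx hζL) hxζ
  have approx : ∀ x ∈ L, ‖x‖ ≤ 1 → ∀ n : ℕ, ∃ m ∈ M, ‖x - m‖ ≤ ‖ϖ‖ ^ n := by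
    intro x hx hx1 n
    induction n with
    | zero => exact ⟨0, zero_mem M, by simpa using hx1⟩
    | succ n ih =>
      obtain ⟨m, hm, hmn⟩ := ih
      obtain ⟨m', hm', hmn'⟩ := step ((x - m) / algebraMap F Ω ϖ ^ n)
        (div_mem (sub_mem hx hm.1) (pow_mem (L.algebraMap_mem ϖ) n)) (by
          rw [norm_div, norm_pow, hϖ]
          exact div_le_one_of_le₀ hmn (by positivity))
      refine ⟨m + algebraMap F Ω ϖ ^ n * m',
        add_mem hm (mul_mem (pow_mem (M.algebraMap_mem ϖ) n) hm'), ?_⟩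
      have h1 : x - (m + algebraMap F Ω ϖ ^ n * m') =
          algebraMap F Ω ϖ ^ n * ((x - m) / algebraMap F Ω ϖ ^ n - m') := by
        rw [mul_sub, mul_div_cancel₀ _ (pow_ne_zero _ hϖ0), sub_sub]
      rw [h1, norm_mul, norm_pow, hϖ, pow_succ]
      exact mul_le_mul_of_nonneg_left hmn' (by positivity)
  have hclosed : IsClosed (M : Set Ω) :=
    Submodule.closed_of_finiteDimensional (Subalgebra.toSubmodule M.toSubalgebra)
  have hintegral : ∀ x ∈ L, ‖x‖ ≤ 1 → x ∈ M := by
    intro x hx hx1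
    have : x ∈ closure (M : Set Ω) := by
      rw [Metric.mem_closure_iff]
      intro ε hε
      obtain ⟨n, hn⟩ := exists_pow_lt_of_lt_one hε h.norm_unif_lt_one
      obtain ⟨m, hm, hmn⟩ := approx x hx hx1 n
      exact ⟨m, hm, by rw [dist_eq_norm]; exact hmn.trans_lt hn⟩
    rwa [hclosed.closure_eq] at this
  intro x hx
  rcases le_total ‖x‖ 1 with hx1 | hx1
  · exact (hintegral x hx hx1).2
  · have h1 := (hintegral x⁻¹ (inv_mem hx) (by
      rw [norm_inv]
      exact inv_le_one_of_one_le₀ hx1)).2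
    simpa using inv_mem h1

end

/-- The Lubin–Tate polynomial `X ^ q + π X`. -/
def lubinTatePoly {R : Type*} [CommRing R] (π : R) (q : ℕ) : Polynomial R :=
  Polynomial.X ^ q + Polynomial.C π * Polynomial.X

/-- The defect of commutation of `P` with the Lubin–Tate polynomial. -/
def lubinTateDefect {R : Type*} [CommRing R] (π : R) (q : ℕ) (P : Polynomial R) : Polynomial R :=
  P.comp (lubinTatePoly π q) - (lubinTatePoly π q).comp P

/-- `P` is an approximation of order `k` to the Lubin–Tate endomorphism with derivative `a`. -/
structure IsLubinTateApprox {R : Type*} [CommRing R] (π : R) (q : ℕ) (a : R) (k : ℕ)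
    (P : Polynomial R) : Prop where
  coeff_zero : P.coeff 0 = 0
  coeff_one : P.coeff 1 = a
  dvd_defect : Polynomial.X ^ k ∣ lubinTateDefect π q P

section

theorem Polynomial.sub_dvd_comp_sub {R : Type*} [CommRing R] (A B P : Polynomial R) :
    A - B ∣ P.comp A - P.comp B := by
  have h := (P.map Polynomial.C).sub_dvd_eval_sub A B
  rwa [Polynomial.eval_map, Polynomial.eval_map] at h

open Polynomial in
theorem lubinTateDefect_eq {R : Type*} [CommRing R] (π : R) (q : ℕ) (P : Polynomial R) :
    lubinTateDefect π q P = P.comp (lubinTatePoly π q) - (P ^ q + C π * P) := by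
  simp [lubinTateDefect, lubinTatePoly]

open Polynomial in
theorem lubinTatePoly_pow {R : Type*} [CommRing R] (π : R) {q : ℕ} (hq : 2 ≤ q) (j : ℕ) :
    (X : Polynomial R) ^ (j + 1) ∣ lubinTatePoly π q ^ j - C (π ^ j) * X ^ j := by
  have h1 : lubinTatePoly π q ^ j - C (π ^ j) * X ^ j =
      X ^ j * ((X ^ (q - 1) + C π) ^ j - (C π) ^ j) := by
    have : lubinTatePoly π q = X * (X ^ (q - 1) + C π) := by
      rw [lubinTatePoly, mul_add, ← pow_succ', Nat.sub_add_cancel (by omega), mul_comm X (C π)]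
    rw [this, mul_pow, mul_sub, C_pow, mul_comm ((C π) ^ j)]
  rw [h1, pow_succ]
  refine mul_dvd_mul_left _ (dvd_trans ?_ (sub_dvd_pow_sub_pow _ _ j))
  rw [add_sub_cancel_right]
  exact dvd_pow_self _ (by omega)

open Polynomial in
theorem lubinTateDefect_add {R : Type*} [CommRing R] (π : R) {q : ℕ} (hq : 2 ≤ q)
    {P w : Polynomial R} {j : ℕ} (hj : 0 < j) (hP : P.coeff 0 = 0) :
    X ^ (j + 1) ∣ lubinTateDefect π q (P + X ^ j * w) - lubinTateDefect π q P -
      C ((π ^ j - π) * w.coeff 0) * X ^ j := by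
  obtain ⟨B, hB⟩ := X_dvd_iff.2 hP
  obtain ⟨u, hu⟩ : (X : Polynomial R) ∣ w - C (w.coeff 0) := X_dvd_iff.2 (by simp)
  have hw : w = C (w.coeff 0) + X * u := by rw [← hu]; ring
  set c := w.coeff 0
  obtain ⟨v, hv⟩ := lubinTatePoly_pow π hq j
  obtain ⟨s, hs⟩ : (X : Polynomial R) ∣ lubinTatePoly π q :=
    X_dvd_iff.2 (by simp [lubinTatePoly, show (0 : ℕ) ≠ q by omega])
  obtain ⟨m, rfl⟩ : ∃ m, j = m + 1 := ⟨j - 1, by omega⟩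
  have h1 : X ^ (m + 1 + 1) ∣ (P + X ^ (m + 1) * w) ^ q - P ^ q := by
    have : (P + X ^ (m + 1) * w) ^ q - P ^ q = X ^ q * ((B + X ^ m * w) ^ q - B ^ q) := by
      rw [hB, pow_succ', mul_assoc, ← mul_add, mul_pow, mul_pow, ← mul_sub]
    rw [this, show m + 1 + 1 = 2 + m by ring, pow_add]
    refine mul_dvd_mul (pow_dvd_pow _ hq) (dvd_trans ?_ (sub_dvd_pow_sub_pow _ _ q))
    rw [add_sub_cancel_left]
    exact dvd_mul_right _ _
  obtain ⟨z, hz⟩ := h1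
  have hwf : w.comp (lubinTatePoly π q) = C c + lubinTatePoly π q * u.comp (lubinTatePoly π q) := by
    conv_lhs => rw [hw]
    simp
  rw [lubinTateDefect_eq, lubinTateDefect_eq, add_comp, mul_comp, pow_comp, X_comp, hwf]
  have hv' : lubinTatePoly π q ^ (m + 1) = C (π ^ (m + 1)) * X ^ (m + 1) + X ^ (m + 1 + 1) * v := by
    rw [← hv]; ring
  have hz' : (P + X ^ (m + 1) * w) ^ q = P ^ q + X ^ (m + 1 + 1) * z := by rw [← hz]; ring
  rw [hz', hv']
  set U := u.comp (lubinTatePoly π q)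
  rw [hw, hs]
  refine ⟨C (π ^ (m + 1)) * (s * U) + v * (C c + X * s * U) - z - C π * u, ?_⟩
  rw [C_mul, C_sub]
  ring

open Polynomial in
theorem IsLubinTateApprox.mono {R : Type*} [CommRing R] {π : R} {q : ℕ} {a : R} {k m : ℕ}
    {P : Polynomial R} (h : IsLubinTateApprox π q a m P) (hkm : k ≤ m) :
    IsLubinTateApprox π q a k P :=
  ⟨h.1, h.2, (pow_dvd_pow _ hkm).trans h.3⟩

open Polynomial in
/-- Approximations to a Lubin–Tate endomorphism are unique. -/
theorem IsLubinTateApprox.dvd_sub {R : Type*} [CommRing R] [IsDomain R] {π : R} {q : ℕ}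
    (hq : 2 ≤ q) (hπ : π ≠ 0) (hunit : ∀ k : ℕ, 0 < k → IsUnit (1 - π ^ k)) {a : R} {k : ℕ}
    {P Q : Polynomial R} (hP : IsLubinTateApprox π q a k P) (hQ : IsLubinTateApprox π q a k Q) :
    X ^ k ∣ Q - P := by
  have h2 : X ^ 2 ∣ Q - P := by
    rw [X_pow_dvd_iff]
    intro d hd
    interval_cases d
    · simp [hP.1, hQ.1]
    · simp [hP.2, hQ.2]
  suffices ∀ j, j ≤ k → X ^ j ∣ Q - P from this k le_rfl
  intro j
  induction j with
  | zero => simp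
  | succ j ih =>
    intro hj
    rcases Nat.lt_or_ge j 2 with hj2 | hj2
    · exact (pow_dvd_pow _ (by omega)).trans h2
    obtain ⟨w, hw⟩ := ih (by omega)
    have hQP : Q = P + X ^ j * w := by rw [← hw]; ring
    have h3 := lubinTateDefect_add π hq (w := w) (by omega : 0 < j) hP.1
    rw [← hQP] at h3
    have h4 := _root_.dvd_sub (_root_.dvd_sub ((pow_dvd_pow _ hj).trans hQ.3) ((pow_dvd_pow _ hj).trans hP.3)) h3
    rw [sub_sub_cancel] at h4
    have h5 := X_pow_dvd_iff.1 h4 j (Nat.lt_succ_self j)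
    rw [coeff_C_mul, coeff_X_pow_self, mul_one] at h5
    have h6 : π ^ j - π ≠ 0 := by
      have := hunit (j - 1) (by omega)
      rw [show π ^ j - π = -(π * (1 - π ^ (j - 1))) by
        obtain ⟨i, rfl⟩ : ∃ i, j = i + 1 := ⟨j - 1, by omega⟩
        rw [Nat.add_sub_cancel]
        ring]
      exact neg_ne_zero.2 (mul_ne_zero hπ this.ne_zero)
    obtain ⟨u, hu⟩ := X_dvd_iff.2 ((mul_eq_zero.1 h5).resolve_left h6)
    rw [hw, hu, pow_succ]
    exact ⟨u, by ring⟩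

open Polynomial in
theorem dvd_lubinTateDefect {R : Type*} [CommRing R] {π : R} {q : ℕ}
    (hmod : ∀ g : Polynomial R, C π ∣ g ^ q - expand R q g) (P : Polynomial R) :
    C π ∣ lubinTateDefect π q P := by
  have h1 : C π ∣ P.comp (lubinTatePoly π q) - P.comp (X ^ q) := by
    refine dvd_trans ?_ (sub_dvd_comp_sub _ _ _)
    rw [lubinTatePoly, add_sub_cancel_left]
    exact dvd_mul_right _ _
  rw [← expand_eq_comp_X_pow] at h1
  have h2 := dvd_sub (dvd_sub h1 (hmod P)) (dvd_mul_right (C π) P)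
  rw [lubinTateDefect_eq]
  convert h2 using 1
  ring

open Polynomial in
theorem exists_isLubinTateApprox {R : Type*} [CommRing R] {π : R} {q : ℕ}
    (hq : 2 ≤ q) (hunit : ∀ k : ℕ, 0 < k → IsUnit (1 - π ^ k))
    (hmod : ∀ g : Polynomial R, C π ∣ g ^ q - expand R q g) (a : R) (k : ℕ) :
    ∃ P, IsLubinTateApprox π q a k P := by
  have base : IsLubinTateApprox π q a 2 (C a * X) := by
    refine ⟨by simp, by simp, ?_⟩
    have : lubinTateDefect π q (C a * X) = X ^ q * (C a - C a ^ q) := by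
      rw [lubinTateDefect_eq, mul_comp, C_comp, X_comp, lubinTatePoly]
      ring
    rw [this]
    exact (pow_dvd_pow _ hq).trans (dvd_mul_right _ _)
  suffices ∀ m, ∃ P, IsLubinTateApprox π q a (m + 2) P by
    obtain ⟨P, hP⟩ := this k
    exact ⟨P, hP.mono (by omega)⟩
  intro m
  induction m with
  | zero => exact ⟨_, base⟩
  | succ m ih =>
    obtain ⟨P, hP⟩ := ih
    obtain ⟨e, he⟩ := dvd_lubinTateDefect hmod P
    obtain ⟨E, hE⟩ := hP.3
    obtain ⟨t, ht⟩ := (hunit (m + 1) (by omega)).exists_right_inv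
    have hcoe : E.coeff 0 = π * e.coeff (m + 2) := by
      have h1 : (lubinTateDefect π q P).coeff (m + 2) = E.coeff 0 := by
        rw [hE, mul_comm]
        simpa using coeff_mul_X_pow E (m + 2) 0
      rw [← h1, he, coeff_C_mul]
    have h3 := lubinTateDefect_add π hq (w := C (e.coeff (m + 2) * t)) (by omega : 0 < m + 2) hP.1
    refine ⟨P + X ^ (m + 2) * C (e.coeff (m + 2) * t), by simp [hP.1, coeff_X_pow], ?_, ?_⟩
    · rw [coeff_add, hP.2, coeff_mul_C, coeff_X_pow]
      simp
    · obtain ⟨u, hu⟩ : (X : Polynomial R) ∣ E - C (E.coeff 0) := X_dvd_iff.2 (by simp)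
      have h4 : X ^ (m + 2 + 1) ∣ lubinTateDefect π q P - X ^ (m + 2) * C (E.coeff 0) := by
        rw [hE, ← mul_sub, hu, pow_succ]
        exact ⟨u, by ring⟩
      have h5 := dvd_add h3 h4
      rw [coeff_C_zero] at h5
      convert h5 using 1
      have h6 : (π ^ (m + 2) - π) * (e.coeff (m + 2) * t) = - E.coeff 0 := by
        rw [hcoe]
        linear_combination (-π * e.coeff (m + 2)) * ht
      rw [h6, C_neg]
      ring

open Polynomial in
theorem isLubinTateApprox_X {R : Type*} [CommRing R] (π : R) (q k : ℕ) :
    IsLubinTateApprox π q 1 k X :=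
  ⟨by simp, by simp, by simp [lubinTateDefect]⟩

open Polynomial in
theorem IsLubinTateApprox.comp {R : Type*} [CommRing R] {π : R} {q : ℕ} {a b : R} {k : ℕ}
    {P Q : Polynomial R} (hP : IsLubinTateApprox π q a k P) (hQ : IsLubinTateApprox π q b k Q) :
    IsLubinTateApprox π q (a * b) k (P.comp Q) := by
  obtain ⟨P', hP'⟩ := X_dvd_iff.2 hP.1
  obtain ⟨Q', hQ'⟩ := X_dvd_iff.2 hQ.1
  have hPQ : P.comp Q = X * (Q' * P'.comp Q) := by
    rw [← mul_assoc, ← hQ']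
    conv_lhs => rw [hP', mul_comp, X_comp]
  refine ⟨?_, ?_, ?_⟩
  · rw [← X_dvd_iff]
    exact ⟨_, hPQ⟩
  · have hQ0 : Q.eval 0 = 0 := by rw [← coeff_zero_eq_eval_zero, hQ.1]
    have h1 : P'.coeff 0 = a := by rw [← hP.2, hP', coeff_X_mul]
    have h2 : Q'.coeff 0 = b := by rw [← hQ.2, hQ', coeff_X_mul]
    rw [hPQ, coeff_X_mul, mul_coeff_zero, h2, coeff_zero_eq_eval_zero, eval_comp, hQ0,
      ← coeff_zero_eq_eval_zero, h1, mul_comm]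
  · have h1 : X ^ k ∣ P.comp (Q.comp (lubinTatePoly π q)) - P.comp ((lubinTatePoly π q).comp Q) :=
      hQ.3.trans (sub_dvd_comp_sub _ _ _)
    have h2 : X ^ k ∣ (lubinTateDefect π q P).comp Q := by
      obtain ⟨E, hE⟩ := hP.3
      rw [hE, mul_comp, pow_comp, X_comp, hQ', mul_pow, mul_assoc]
      exact dvd_mul_right _ _
    have h3 := dvd_add h1 h2
    convert h3 using 1
    simp only [lubinTateDefect, sub_comp, comp_assoc]
    ring

end

/-- The ring of integers of an ultrametric normed field. -/
def unitBall (F : Type*) [NormedField F] [IsUltrametricDist F] : Subring F where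
  carrier := {x | ‖x‖ ≤ 1}
  mul_mem' := by
    intro a b ha hb
    change ‖a * b‖ ≤ 1
    rw [norm_mul]
    exact mul_le_one₀ ha (norm_nonneg _) hb
  one_mem' := norm_one.le
  add_mem' := fun {a b} ha hb => (IsUltrametricDist.norm_add_le_max a b).trans (max_le ha hb)
  zero_mem' := by
    change ‖(0 : F)‖ ≤ 1
    rw [norm_zero]
    exact zero_le_one
  neg_mem' := by
    intro a ha
    change ‖-a‖ ≤ 1
    rwa [norm_neg]

theorem unitBall_dvd_iff {F : Type*} [NormedField F] [IsUltrametricDist F] {a b : unitBall F} :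
    a ∣ b ↔ ‖(b : F)‖ ≤ ‖(a : F)‖ := by
  constructor
  · rintro ⟨c, rfl⟩
    rw [Subring.coe_mul, norm_mul]
    exact mul_le_of_le_one_right (norm_nonneg _) c.2
  · intro h
    by_cases ha : (a : F) = 0
    · rw [ha, norm_zero] at h
      have hb : (b : F) = 0 := norm_le_zero_iff.1 h
      have : b = 0 := Subtype.ext hb
      rw [this]
      exact dvd_zero a
    · refine ⟨⟨(b : F) / a, ?_⟩, Subtype.ext ?_⟩
      · change ‖(b : F) / a‖ ≤ 1
        rw [norm_div]
        exact div_le_one_of_le₀ h (norm_nonneg _)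
      · change (b : F) = a * (b / a)
        rw [mul_div_cancel₀ _ ha]

/-- Evaluation of an integral polynomial. -/
def ballEval {F : Type*} (Ω : Type*) [NormedField F] [IsUltrametricDist F] [Field Ω] [Algebra F Ω]
    (x : Ω) : Polynomial (unitBall F) →+* Ω :=
  Polynomial.eval₂RingHom ((algebraMap F Ω).comp (unitBall F).subtype) x

section

variable {F Ω : Type*} [NormedField F] [IsUltrametricDist F]
  [NormedField Ω] [IsUltrametricDist Ω] [NormedAlgebra F Ω]

@[simp] theorem ballEval_X (x : Ω) : ballEval (F := F) Ω x Polynomial.X = x := by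
  simp [ballEval]

@[simp] theorem ballEval_C (x : Ω) (a : unitBall F) :
    ballEval Ω x (Polynomial.C a) = algebraMap F Ω a := by
  simp [ballEval]

theorem ballEval_comp (x : Ω) (P Q : Polynomial (unitBall F)) :
    ballEval Ω x (P.comp Q) = ballEval Ω (ballEval Ω x Q) P :=
  Polynomial.eval₂_comp _

theorem ballEval_map (g : Ω ≃ₐ[F] Ω) (x : Ω) (P : Polynomial (unitBall F)) :
    ballEval Ω (g x) P = g (ballEval Ω x P) := by
  have h : ballEval Ω (g x) = (g : Ω →+* Ω).comp (ballEval (F := F) Ω x) := by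
    apply Polynomial.ringHom_ext
    · intro a
      simp
    · simp
  rw [h]
  rfl

theorem norm_ballEval_le_one {x : Ω} (hx : ‖x‖ ≤ 1) (P : Polynomial (unitBall F)) :
    ‖ballEval Ω x P‖ ≤ 1 := by
  induction P using Polynomial.induction_on with
  | C a =>
    rw [ballEval_C, norm_algebraMap']
    exact a.2
  | add P Q hP hQ =>
    rw [map_add]
    exact (IsUltrametricDist.norm_add_le_max _ _).trans (max_le hP hQ)
  | monomial n a ih =>
    rw [map_mul, map_pow, ballEval_X, ballEval_C, norm_mul, norm_pow, norm_algebraMap']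
    exact mul_le_one₀ a.2 (by positivity) (pow_le_one₀ (norm_nonneg _) hx)

theorem norm_ballEval_le_of_dvd {x : Ω} (hx : ‖x‖ ≤ 1) {P : Polynomial (unitBall F)} {k : ℕ}
    (h : Polynomial.X ^ k ∣ P) : ‖ballEval Ω x P‖ ≤ ‖x‖ ^ k := by
  obtain ⟨Q, rfl⟩ := h
  rw [map_mul, map_pow, ballEval_X, norm_mul, norm_pow]
  exact mul_le_of_le_one_right (by positivity) (norm_ballEval_le_one hx Q)

theorem norm_ballEval_sub_le {x y : Ω} (hx : ‖x‖ ≤ 1) (hy : ‖y‖ ≤ 1)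
    (P : Polynomial (unitBall F)) : ‖ballEval Ω x P - ballEval Ω y P‖ ≤ ‖x - y‖ := by
  induction P using Polynomial.induction_on with
  | C a => simp
  | add P Q hP hQ =>
    rw [map_add, map_add, add_sub_add_comm]
    exact (IsUltrametricDist.norm_add_le_max _ _).trans (max_le hP hQ)
  | monomial n a ih =>
    rw [map_mul, map_mul, ballEval_C, ballEval_C, map_pow, map_pow, ballEval_X, ballEval_X] at ih ⊢
    have h1 : algebraMap F Ω a * x ^ (n + 1) - algebraMap F Ω a * y ^ (n + 1) =
        (algebraMap F Ω a * x ^ n - algebraMap F Ω a * y ^ n) * x +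
          algebraMap F Ω a * y ^ n * (x - y) := by ring
    rw [h1]
    refine (IsUltrametricDist.norm_add_le_max _ _).trans (max_le ?_ ?_)
    · rw [norm_mul]
      exact (mul_le_of_le_one_right (norm_nonneg _) hx).trans ih
    · rw [norm_mul, norm_mul, norm_pow, norm_algebraMap']
      exact mul_le_of_le_one_left (norm_nonneg _)
        (mul_le_one₀ a.2 (by positivity) (pow_le_one₀ (norm_nonneg _) hy))

end

section

variable {F : Type*} [NormedField F] [IsUltrametricDist F] {p q : ℕ} {ϖ : F}

/-- The uniformizer as an element of the ring of integers. -/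
def LocalParam.unif (h : LocalParam p F ϖ q) : unitBall F := ⟨ϖ, h.norm_unif_lt_one.le⟩

theorem LocalParam.unif_ne_zero' (h : LocalParam p F ϖ q) : h.unif ≠ 0 :=
  fun h0 => h.unif_ne_zero (congrArg Subtype.val h0)

theorem LocalParam.two_le (h : LocalParam p F ϖ q) : 2 ≤ q := by
  obtain ⟨s, hs, rfl⟩ := h.eq_pow
  exact h.prime.two_le.trans (Nat.le_self_pow hs p)

theorem LocalParam.isUnit_one_sub (h : LocalParam p F ϖ q) (k : ℕ) (hk : 0 < k) :
    IsUnit (1 - h.unif ^ k) := by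
  have h1 : ‖ϖ ^ k‖ < 1 := by
    rw [norm_pow]
    exact pow_lt_one₀ (norm_nonneg _) h.norm_unif_lt_one hk.ne'
  have h2 : ‖1 - ϖ ^ k‖ = 1 := by
    have := IsUltrametricDist.norm_add_eq_max_of_norm_ne_norm (x := (1 : F)) (y := -ϖ ^ k)
      (by rw [norm_one, norm_neg]; exact h1.ne')
    rw [sub_eq_add_neg, this, norm_one, norm_neg, max_eq_left h1.le]
  rw [isUnit_iff_dvd_one, unitBall_dvd_iff]
  change ‖(1 : F)‖ ≤ ‖1 - ϖ ^ k‖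
  rw [h2, norm_one]

end

section

variable {F : Type*} [NontriviallyNormedField F] [IsUltrametricDist F] [ProperSpace F]
  {p q : ℕ} {ϖ : F}

theorem LocalParam.norm_natCast_card_le (h : LocalParam p F ϖ q) : ‖(q : F)‖ ≤ ‖ϖ‖ := by
  obtain ⟨s, hs, rfl⟩ := h.eq_pow
  have hp : ‖(p : F)‖ < 1 := h.norm_p_lt_one
  refine h.norm_le_of_norm_lt_one ?_
  rw [Nat.cast_pow, norm_pow]
  exact pow_lt_one₀ (norm_nonneg _) hp hs

open Polynomial in
theorem LocalParam.dvd_pow_sub_expand (h : LocalParam p F ϖ q) (g : Polynomial (unitBall F)) :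
    C h.unif ∣ g ^ q - expand _ q g := by
  obtain ⟨s, hs, hqs⟩ := h.eq_pow
  have hp : h.unif ∣ (p : unitBall F) := by
    rw [unitBall_dvd_iff]
    exact h.norm_le_of_norm_lt_one h.norm_p_lt_one
  induction g using Polynomial.induction_on' with
  | add P Q hP hQ =>
    obtain ⟨r, hr⟩ := exists_add_pow_prime_pow_eq h.prime P Q s
    have h1 : (P + Q) ^ q - expand _ q (P + Q) =
        (P ^ q - expand _ q P) + (Q ^ q - expand _ q Q) + (p : Polynomial (unitBall F)) *
          (P * Q * r) := by
      rw [map_add, hqs, hr]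
      ring
    have h2 : C h.unif ∣ (p : Polynomial (unitBall F)) := by
      rw [← C_eq_natCast]
      exact _root_.map_dvd C hp
    rw [h1]
    exact dvd_add (dvd_add hP hQ) (h2.mul_right _)
  | monomial n a =>
    rw [expand_monomial, monomial_pow, mul_comm n q, mul_comm q n, ← map_sub,
      ← C_mul_X_pow_eq_monomial]
    refine Dvd.dvd.mul_right (_root_.map_dvd C ?_) _
    rw [unitBall_dvd_iff]
    exact h.norm_le_of_norm_lt_one (h.pow_residue a a.2)

end

section

variable {F Ω : Type*} [NontriviallyNormedField F] [IsUltrametricDist F] [ProperSpace F]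
  [NontriviallyNormedField Ω] [IsUltrametricDist Ω] [NormedAlgebra F Ω] [Algebra.IsAlgebraic F Ω]
  {p q : ℕ} {ϖ : F}

/-- `y` is the value at `x` of the Lubin–Tate endomorphism with derivative `a`. -/
def LocalParam.Acts (h : LocalParam p F ϖ q) (a : unitBall F) (x y : Ω) : Prop :=
  ∀ (k : ℕ) (P : Polynomial (unitBall F)), IsLubinTateApprox h.unif q a k P →
    ‖y - ballEval Ω x P‖ ≤ ‖x‖ ^ k

theorem LocalParam.exists_approx (h : LocalParam p F ϖ q) (a : unitBall F) (k : ℕ) :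
    ∃ P, IsLubinTateApprox h.unif q a k P :=
  exists_isLubinTateApprox h.two_le h.isUnit_one_sub h.dvd_pow_sub_expand a k

theorem LocalParam.norm_approx_sub_le (h : LocalParam p F ϖ q) {a : unitBall F} {k : ℕ}
    {P Q : Polynomial (unitBall F)} (hP : IsLubinTateApprox h.unif q a k P)
    (hQ : IsLubinTateApprox h.unif q a k Q) {x : Ω} (hx : ‖x‖ < 1) :
    ‖ballEval Ω x Q - ballEval Ω x P‖ ≤ ‖x‖ ^ k := by
  rw [← map_sub]
  exact norm_ballEval_le_of_dvd hx.le
    (IsLubinTateApprox.dvd_sub h.two_le h.unif_ne_zero' h.isUnit_one_sub hP hQ)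

/-- It suffices to check the defining condition on one approximation of each order. -/
theorem LocalParam.acts_of_exists (h : LocalParam p F ϖ q) {a : unitBall F} {x y : Ω}
    (hx : ‖x‖ < 1)
    (hy : ∀ k, ∃ P, IsLubinTateApprox h.unif q a k P ∧ ‖y - ballEval Ω x P‖ ≤ ‖x‖ ^ k) :
    h.Acts a x y := by
  intro k P hP
  obtain ⟨Q, hQ, hyQ⟩ := hy k
  rw [← sub_add_sub_cancel y (ballEval Ω x Q)]
  exact (IsUltrametricDist.norm_add_le_max _ _).trans
    (max_le hyQ (h.norm_approx_sub_le hP hQ hx))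

theorem LocalParam.Acts.unique {h : LocalParam p F ϖ q} {a : unitBall F} {x y z : Ω}
    (hx : ‖x‖ < 1) (hy : h.Acts a x y) (hz : h.Acts a x z) : y = z := by
  have h1 : ∀ k : ℕ, ‖y - z‖ ≤ ‖x‖ ^ k := by
    intro k
    obtain ⟨P, hP⟩ := h.exists_approx a k
    rw [← sub_sub_sub_cancel_right y z (ballEval Ω x P)]
    exact (norm_sub_le_max_norm _ _).trans (max_le (hy k P hP) (hz k P hP))
  have h2 : ‖y - z‖ ≤ 0 :=
    ge_of_tendsto' (tendsto_pow_atTop_nhds_zero_of_lt_one (norm_nonneg _) hx) h1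
  exact sub_eq_zero.1 (norm_le_zero_iff.1 h2)

theorem LocalParam.exists_acts (h : LocalParam p F ϖ q) (a : unitBall F) {x : Ω} (hx : ‖x‖ < 1) :
    ∃ y, h.Acts a x y := by
  choose P hP using h.exists_approx a
  have hfd : FiniteDimensional F F⟮x⟯ :=
    adjoin.finiteDimensional (Algebra.IsAlgebraic.isAlgebraic x).isIntegral
  have hprop : ProperSpace F⟮x⟯ := FiniteDimensional.proper F F⟮x⟯
  have hmem : ∀ Q : Polynomial (unitBall F), ballEval Ω x Q ∈ F⟮x⟯ := by
    intro Q
    induction Q using Polynomial.induction_on' with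
    | add Q R hQ hR =>
      rw [map_add]
      exact add_mem hQ hR
    | monomial n b =>
      rw [← Polynomial.C_mul_X_pow_eq_monomial, map_mul, map_pow, ballEval_X, ballEval_C]
      exact mul_mem (IntermediateField.algebraMap_mem _ _) (pow_mem (mem_adjoin_simple_self F x) n)
  let u : ℕ → F⟮x⟯ := fun k => ⟨ballEval Ω x (P k), hmem _⟩
  have hu : ∀ k j, k ≤ j → ‖(u j : Ω) - u k‖ ≤ ‖x‖ ^ k := fun k j hkj =>
    h.norm_approx_sub_le (hP k) ((hP j).mono hkj) hx
  have hpow := tendsto_pow_atTop_nhds_zero_of_lt_one (norm_nonneg x) hx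
  have hcau : CauchySeq u := by
    refine cauchySeq_of_le_tendsto_0' (fun k => ‖x‖ ^ k) (fun k j hkj => ?_) hpow
    rw [dist_comm, dist_eq_norm]
    exact hu k j hkj
  obtain ⟨y, hy⟩ := cauchySeq_tendsto_of_complete hcau
  have hy' : Filter.Tendsto (fun j => (u j : Ω)) Filter.atTop (nhds (y : Ω)) :=
    (continuous_subtype_val.tendsto y).comp hy
  refine ⟨y, h.acts_of_exists hx fun k => ⟨P k, hP k, ?_⟩⟩
  refine le_of_tendsto ((hy'.sub_const _).norm) ?_
  filter_upwards [Filter.eventually_ge_atTop k] with j hj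
  exact hu k j hj

theorem LocalParam.Acts.norm_le {h : LocalParam p F ϖ q} {a : unitBall F} {x y : Ω}
    (hx : ‖x‖ < 1) (hy : h.Acts a x y) : ‖y‖ ≤ ‖x‖ := by
  obtain ⟨P, hP⟩ := h.exists_approx a 1
  have h1 := hy 1 P hP
  rw [pow_one] at h1
  rw [← sub_add_cancel y (ballEval Ω x P)]
  refine (IsUltrametricDist.norm_add_le_max _ _).trans (max_le h1 ?_)
  have := norm_ballEval_le_of_dvd hx.le (k := 1) (P := P)
    (by rw [pow_one]; exact Polynomial.X_dvd_iff.2 hP.1)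
  rwa [pow_one] at this

theorem LocalParam.acts_one (h : LocalParam p F ϖ q) {x : Ω} (hx : ‖x‖ < 1) : h.Acts 1 x x :=
  h.acts_of_exists hx fun k => ⟨Polynomial.X, isLubinTateApprox_X _ _ _, by simp⟩

theorem LocalParam.acts_zero (h : LocalParam p F ϖ q) (a : unitBall F) : h.Acts a (0 : Ω) 0 := by
  obtain ⟨y, hy⟩ := h.exists_acts a (x := (0 : Ω)) (by simp)
  have := hy.norm_le (by simp)
  rw [norm_zero] at this
  rwa [norm_le_zero_iff.1 this] at hy

theorem LocalParam.Acts.trans {h : LocalParam p F ϖ q} {a b : unitBall F} {x y z : Ω}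
    (hx : ‖x‖ < 1) (hy : h.Acts b x y) (hz : h.Acts a y z) : h.Acts (a * b) x z := by
  have hyx := hy.norm_le hx
  refine h.acts_of_exists hx fun k => ?_
  obtain ⟨P, hP⟩ := h.exists_approx a k
  obtain ⟨Q, hQ⟩ := h.exists_approx b k
  refine ⟨_, hP.comp hQ, ?_⟩
  rw [ballEval_comp, ← sub_add_sub_cancel z (ballEval Ω y P)]
  refine (IsUltrametricDist.norm_add_le_max _ _).trans (max_le ?_ ?_)
  · exact (hz k P hP).trans (pow_le_pow_left₀ (norm_nonneg _) hyx k)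
  · exact (norm_ballEval_sub_le (hyx.trans hx.le) (norm_ballEval_le_one hx.le _) P).trans (hy k Q hQ)

theorem LocalParam.Acts.map {h : LocalParam p F ϖ q} {a : unitBall F} {x y : Ω}
    (g : Ω ≃ₐ[F] Ω) (hg : ∀ x, ‖g x‖ = ‖x‖) (hy : h.Acts a x y) : h.Acts a (g x) (g y) := by
  intro k P hP
  rw [ballEval_map, ← map_sub, hg, hg]
  exact hy k P hP

theorem LocalParam.ballEval_lubinTatePoly (h : LocalParam p F ϖ q) (x : Ω) :
    ballEval Ω x (lubinTatePoly h.unif q) = x ^ q + algebraMap F Ω ϖ * x := by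
  simp [lubinTatePoly, LocalParam.unif]

theorem LocalParam.Acts.frob {h : LocalParam p F ϖ q} {a : unitBall F} {x y : Ω}
    (hx : ‖x‖ < 1) (hy : h.Acts a x y) :
    h.Acts a (x ^ q + algebraMap F Ω ϖ * x) (y ^ q + algebraMap F Ω ϖ * y) := by
  have hyx := hy.norm_le hx
  have hfx : ‖x ^ q + algebraMap F Ω ϖ * x‖ ≤ ‖x‖ := by
    refine (IsUltrametricDist.norm_add_le_max _ _).trans (max_le ?_ ?_)
    · rw [norm_pow]
      exact pow_le_of_le_one (norm_nonneg _) hx.le (by have := h.two_le; omega)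
    · rw [norm_mul, norm_algebraMap']
      exact mul_le_of_le_one_left (norm_nonneg _) h.norm_unif_lt_one.le
  have hfx1 := hfx.trans_lt hx
  obtain ⟨z, hz⟩ := h.exists_acts a hfx1
  suffices y ^ q + algebraMap F Ω ϖ * y = z by rwa [this]
  have h1 : ∀ k : ℕ, ‖y ^ q + algebraMap F Ω ϖ * y - z‖ ≤ ‖x‖ ^ k := by
    intro k
    obtain ⟨P, hP⟩ := h.exists_approx a k
    have e1 := hz k P hP
    have e2 := norm_ballEval_le_of_dvd hx.le hP.3
    rw [lubinTateDefect, map_sub, ballEval_comp, ballEval_comp, h.ballEval_lubinTatePoly] at e2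
    have e3 := norm_ballEval_sub_le (hyx.trans hx.le) (norm_ballEval_le_one hx.le P)
      (lubinTatePoly h.unif q)
    rw [h.ballEval_lubinTatePoly] at e3
    have e4 := e3.trans (hy k P hP)
    have e5 := e1.trans (pow_le_pow_left₀ (norm_nonneg _) hfx k)
    rw [← norm_neg, neg_sub] at e2 
    rw [← norm_neg, neg_sub] at e5
    have e6 := (IsUltrametricDist.norm_add_le_max _ _).trans (max_le e4 e2)
    have e7 := (IsUltrametricDist.norm_add_le_max _ _).trans (max_le e6 e5)
    rwa [sub_add_sub_cancel, sub_add_sub_cancel] at e7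
  have h2 : ‖y ^ q + algebraMap F Ω ϖ * y - z‖ ≤ 0 :=
    ge_of_tendsto' (tendsto_pow_atTop_nhds_zero_of_lt_one (norm_nonneg _) hx) h1
  exact sub_eq_zero.1 (norm_le_zero_iff.1 h2)

end

/-- The iterates of the Lubin–Tate polynomial. -/
def lubinTateIter {R : Type*} [CommRing R] (π : R) (q : ℕ) : ℕ → Polynomial R
  | 0 => Polynomial.X
  | n + 1 => (lubinTatePoly π q).comp (lubinTateIter π q n)

/-- The map given by the Lubin–Tate polynomial. -/
def lubinTateMap {F Ω : Type*} [Field F] [Field Ω] [Algebra F Ω] (ϖ : F) (q : ℕ) (x : Ω) : Ω :=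
  x ^ q + algebraMap F Ω ϖ * x

section

theorem natDegree_lubinTatePoly_le {R : Type*} [CommRing R] [Nontrivial R] (π : R) {q : ℕ}
    (hq : 2 ≤ q) :
    (lubinTatePoly π q).Monic ∧ (lubinTatePoly π q).natDegree = q := by
  have h1 : (Polynomial.C π * Polynomial.X).degree < (q : WithBot ℕ) :=
    (Polynomial.degree_C_mul_X_le π).trans_lt (by exact_mod_cast hq)
  refine ⟨Polynomial.monic_X_pow_add h1, ?_⟩
  rw [← Polynomial.degree_X_pow (R := R) q] at h1
  rw [lubinTatePoly, Polynomial.natDegree_add_eq_left_of_degree_lt h1, Polynomial.natDegree_X_pow]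

theorem monic_natDegree_lubinTateIter {R : Type*} [CommRing R] [IsDomain R] (π : R) {q : ℕ}
    (hq : 2 ≤ q) (n : ℕ) :
    (lubinTateIter π q n).Monic ∧ (lubinTateIter π q n).natDegree = q ^ n := by
  induction n with
  | zero => exact ⟨Polynomial.monic_X, by simp [lubinTateIter]⟩
  | succ n ih =>
    have h := natDegree_lubinTatePoly_le π hq
    refine ⟨h.1.comp ih.1 (by rw [ih.2]; positivity), ?_⟩
    rw [lubinTateIter, Polynomial.natDegree_comp, h.2, ih.2, pow_succ']

open Polynomial in
theorem X_dvd_lubinTateIter {R : Type*} [CommRing R] (π : R) {q : ℕ} (hq : 2 ≤ q) (n : ℕ) :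
    (lubinTateIter π q n).coeff 0 = 0 ∧ (lubinTateIter π q n).coeff 1 = π ^ n := by
  induction n with
  | zero => simp [lubinTateIter]
  | succ n ih =>
    obtain ⟨B, hB⟩ := X_dvd_iff.2 ih.1
    have h1 : B.coeff 0 = π ^ n := by rw [← ih.2, hB, coeff_X_mul]
    have h2 : lubinTateIter π q (n + 1) = X * (X ^ (q - 1) * B ^ q + C π * B) := by
      rw [lubinTateIter, lubinTatePoly, add_comp, pow_comp, X_comp, mul_comp, C_comp, X_comp, hB,
        mul_pow]
      conv_lhs => rw [← Nat.sub_add_cancel (show 1 ≤ q by omega)]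
      rw [pow_succ X (q - 1), Nat.sub_add_cancel (show 1 ≤ q by omega)]
      ring
    refine ⟨by rw [h2]; simp, ?_⟩
    rw [h2, coeff_X_mul, coeff_add, coeff_C_mul, h1, mul_comm (X ^ (q - 1)),
      mul_coeff_zero, coeff_X_pow, if_neg (by omega), mul_zero, zero_add, pow_succ']

end

section

variable {F Ω : Type*} [NontriviallyNormedField F] [IsUltrametricDist F] [ProperSpace F]
  [NontriviallyNormedField Ω] [IsUltrametricDist Ω] [NormedAlgebra F Ω] [Algebra.IsAlgebraic F Ω]
  {p q : ℕ} {ϖ : F}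

theorem aeval_lubinTateIter (ϖ : F) (q n : ℕ) (x : Ω) :
    Polynomial.aeval x (lubinTateIter ϖ q n) = (lubinTateMap ϖ q)^[n] x := by
  induction n with
  | zero => simp [lubinTateIter]
  | succ n ih =>
    rw [lubinTateIter, Polynomial.aeval_comp, ih, Function.iterate_succ_apply']
    simp [lubinTatePoly, lubinTateMap]

theorem LocalParam.ballEval_lubinTateIter (h : LocalParam p F ϖ q) (n : ℕ) (x : Ω) :
    ballEval Ω x (lubinTateIter h.unif q n) = (lubinTateMap ϖ q)^[n] x := by
  induction n with
  | zero => simp [lubinTateIter]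
  | succ n ih =>
    rw [lubinTateIter, ballEval_comp, ih, Function.iterate_succ_apply', h.ballEval_lubinTatePoly]
    rfl

theorem LocalParam.Acts.lubinTateMap {h : LocalParam p F ϖ q} {a : unitBall F} {x y : Ω}
    (hx : ‖x‖ < 1) (hy : h.Acts a x y) : h.Acts a (lubinTateMap ϖ q x) (lubinTateMap ϖ q y) :=
  hy.frob hx

theorem LocalParam.norm_lubinTateMap_lt_one (h : LocalParam p F ϖ q) {x : Ω} (hx : ‖x‖ < 1) :
    ‖lubinTateMap ϖ q x‖ < 1 := by
  refine norm_add_lt_one ?_ ?_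
  · rw [norm_pow]
    exact pow_lt_one₀ (norm_nonneg _) hx (by have := h.two_le; omega)
  · rw [norm_mul, norm_algebraMap']
    exact mul_lt_one_of_nonneg_of_lt_one_left (norm_nonneg _) h.norm_unif_lt_one hx.le

theorem LocalParam.norm_iterate_lubinTateMap_lt_one (h : LocalParam p F ϖ q) {x : Ω}
    (hx : ‖x‖ < 1) (n : ℕ) : ‖(lubinTateMap ϖ q)^[n] x‖ < 1 := by
  induction n with
  | zero => exact hx
  | succ n ih =>
    rw [Function.iterate_succ_apply']
    exact h.norm_lubinTateMap_lt_one ih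

theorem LocalParam.Acts.iterate {h : LocalParam p F ϖ q} {a : unitBall F} {x y : Ω}
    (hx : ‖x‖ < 1) (hy : h.Acts a x y) (n : ℕ) :
    h.Acts a ((_root_.lubinTateMap ϖ q)^[n] x) ((_root_.lubinTateMap ϖ q)^[n] y) := by
  induction n with
  | zero => exact hy
  | succ n ih =>
    rw [Function.iterate_succ_apply', Function.iterate_succ_apply']
    exact ih.lubinTateMap (h.norm_iterate_lubinTateMap_lt_one hx n)

theorem lubinTateMap_algEquiv (g : Ω ≃ₐ[F] Ω) (x : Ω) :
    lubinTateMap ϖ q (g x) = g (lubinTateMap ϖ q x) := by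
  simp [lubinTateMap]

theorem iterate_lubinTateMap_algEquiv (g : Ω ≃ₐ[F] Ω) (n : ℕ) (x : Ω) :
    (lubinTateMap ϖ q)^[n] (g x) = g ((lubinTateMap ϖ q)^[n] x) := by
  induction n with
  | zero => rfl
  | succ n ih => rw [Function.iterate_succ_apply', ih, lubinTateMap_algEquiv,
      ← Function.iterate_succ_apply' (lubinTateMap ϖ q)]

theorem LocalParam.one_le_norm_lubinTateMap (h : LocalParam p F ϖ q) {x : Ω} (hx : 1 ≤ ‖x‖) :
    1 ≤ ‖lubinTateMap ϖ q x‖ := by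
  have h1 : ‖algebraMap F Ω ϖ * x‖ < ‖x ^ q‖ := by
    rw [norm_mul, norm_algebraMap', norm_pow]
    refine (mul_lt_of_lt_one_left (by linarith) h.norm_unif_lt_one).trans_le ?_
    exact le_self_pow₀ hx (by have := h.two_le; omega)
  have h2 := IsUltrametricDist.norm_add_eq_max_of_norm_ne_norm h1.ne'
  rw [lubinTateMap, h2, max_eq_left h1.le, norm_pow]
  exact one_le_pow₀ hx

theorem LocalParam.norm_lt_one_of_iterate_eq_zero (h : LocalParam p F ϖ q) {x : Ω} {n : ℕ}
    (hx : (lubinTateMap ϖ q)^[n] x = 0) : ‖x‖ < 1 := by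
  by_contra! hc
  have : ∀ n, 1 ≤ ‖(lubinTateMap ϖ q)^[n] x‖ := by
    intro n
    induction n with
    | zero => exact hc
    | succ n ih =>
      rw [Function.iterate_succ_apply']
      exact h.one_le_norm_lubinTateMap ih
  have h1 := this n
  rw [hx, norm_zero] at h1
  linarith

theorem LocalParam.iterate_zero (h : LocalParam p F ϖ q) (n : ℕ) :
    (lubinTateMap ϖ q)^[n] (0 : Ω) = 0 := by
  have hq := h.two_le
  induction n with
  | zero => rfl
  | succ n ih =>
    rw [Function.iterate_succ_apply', ih, lubinTateMap, zero_pow (by omega), mul_zero, add_zero]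

theorem LocalParam.lubinTateMap_eq_zero_iff (h : LocalParam p F ϖ q) {x : Ω} (hx : x ≠ 0) :
    lubinTateMap ϖ q x = 0 ↔ x ^ (q - 1) = -algebraMap F Ω ϖ := by
  have hq := h.two_le
  have h1 : lubinTateMap ϖ q x = x * (x ^ (q - 1) + algebraMap F Ω ϖ) := by
    rw [lubinTateMap, mul_add, ← pow_succ', Nat.sub_add_cancel (by omega), mul_comm x (algebraMap F Ω ϖ)]
  rw [h1, mul_eq_zero, or_iff_right hx, eq_neg_iff_add_eq_zero]

/-- The iterates of the Lubin–Tate polynomial are separable. -/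
theorem LocalParam.eval_derivative_ne_zero (h : LocalParam p F ϖ q) (n : ℕ) {x : Ω}
    (hx : ‖x‖ < 1) :
    Polynomial.aeval x (Polynomial.derivative (lubinTateIter ϖ q n)) ≠ 0 := by
  induction n with
  | zero => simp [lubinTateIter]
  | succ n ih =>
    rw [lubinTateIter, Polynomial.derivative_comp, map_mul, Polynomial.aeval_comp,
      aeval_lubinTateIter]
    refine mul_ne_zero ih ?_
    have hy := h.norm_iterate_lubinTateMap_lt_one hx n
    set y := (lubinTateMap ϖ q)^[n] x
    have h1 : Polynomial.aeval y (Polynomial.derivative (lubinTatePoly ϖ q)) =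
        (algebraMap F Ω q) * y ^ (q - 1) + algebraMap F Ω ϖ := by
      rw [lubinTatePoly, Polynomial.derivative_add, Polynomial.derivative_X_pow]
      simp
    have h2 : ‖algebraMap F Ω q * y ^ (q - 1)‖ < ‖algebraMap F Ω ϖ‖ := by
      rw [norm_mul, norm_algebraMap', norm_algebraMap', norm_pow]
      refine (mul_le_mul_of_nonneg_right h.norm_natCast_card_le (by positivity)).trans_lt ?_
      refine mul_lt_of_lt_one_right (norm_pos_iff.2 h.unif_ne_zero) ?_
      exact pow_lt_one₀ (norm_nonneg _) hy (by have := h.two_le; omega)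
    rw [h1]
    intro h0
    rw [eq_neg_of_add_eq_zero_left h0, norm_neg] at h2
    exact lt_irrefl _ h2

theorem LocalParam.exists_finset_roots [IsAlgClosed Ω] (h : LocalParam p F ϖ q) (n : ℕ) :
    ∃ S : Finset Ω, S.card = q ^ n ∧ ∀ x, x ∈ S ↔ (lubinTateMap ϖ q)^[n] x = 0 := by
  classical
  have hm := monic_natDegree_lubinTateIter ϖ h.two_le n
  set f := (lubinTateIter ϖ q n).map (algebraMap F Ω) with hf
  have hf0 : f ≠ 0 := (hm.1.map _).ne_zero
  have hroot : ∀ x, x ∈ f.roots ↔ (lubinTateMap ϖ q)^[n] x = 0 := by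
    intro x
    rw [Polynomial.mem_roots hf0, Polynomial.IsRoot.def, hf, Polynomial.eval_map_algebraMap,
      aeval_lubinTateIter]
  have hnd : f.roots.Nodup := by
    rw [Multiset.nodup_iff_count_le_one]
    intro x
    by_contra! hc
    rw [Polynomial.count_roots, Polynomial.one_lt_rootMultiplicity_iff_isRoot hf0] at hc
    have hx := h.norm_lt_one_of_iterate_eq_zero ((hroot x).1 ((Polynomial.mem_roots hf0).2 hc.1))
    have h1 := hc.2
    rw [hf, Polynomial.derivative_map, Polynomial.IsRoot.def, Polynomial.eval_map_algebraMap] at h1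
    exact h.eval_derivative_ne_zero n hx h1
  refine ⟨⟨f.roots, hnd⟩, ?_, hroot⟩
  change f.roots.card = _
  rw [Polynomial.splits_iff_card_roots.1 (IsAlgClosed.splits f), hf, hm.1.natDegree_map, hm.2]

/-- An endomorphism fixing all the torsion of level `n` is congruent to `1`. -/
theorem LocalParam.norm_sub_one_le [IsAlgClosed Ω] (h : LocalParam p F ϖ q) {n : ℕ}
    {a : unitBall F} (ha : ∀ x : Ω, (_root_.lubinTateMap ϖ q)^[n] x = 0 → h.Acts a x x) :
    ‖(a : F) - 1‖ ≤ ‖ϖ‖ ^ n := by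
  classical
  obtain ⟨S, hcard, hS⟩ := h.exists_finset_roots (Ω := Ω) n
  have hm := monic_natDegree_lubinTateIter h.unif h.two_le n
  have hc := X_dvd_lubinTateIter h.unif h.two_le n
  set G := lubinTateIter h.unif q n with hG
  let ε : ℕ → ℝ := fun k => ∑ x ∈ S, ‖x‖ ^ k * ‖(Lagrange.basis S id x).coeff 1‖
  have hε : Filter.Tendsto ε Filter.atTop (nhds 0) := by
    rw [show (0 : ℝ) = ∑ x ∈ S, 0 * ‖(Lagrange.basis S id x).coeff 1‖ by simp]
    refine tendsto_finsetSum _ fun x hx => ?_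
    refine (tendsto_pow_atTop_nhds_zero_of_lt_one (norm_nonneg _) ?_).mul_const _
    exact h.norm_lt_one_of_iterate_eq_zero ((hS x).1 hx)
  have key : ∀ k, ‖(a : F) - 1‖ ≤ max (‖ϖ‖ ^ n) (ε k) := by
    intro k
    obtain ⟨P, hP⟩ := h.exists_approx a k
    set R := P - Polynomial.X with hR
    have hdiv := Polynomial.modByMonic_add_div R G
    set r := R %ₘ G
    set s := R /ₘ G
    have h1 : (a : F) - 1 = (r.coeff 1 : F) + ϖ ^ n * (s.coeff 0 : F) := by
      have e := congrArg (fun T => Polynomial.coeff T 1) hdiv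
      simp only [Polynomial.coeff_add, Polynomial.mul_coeff_one, hc.1, hc.2, zero_mul, zero_add,
        hR, Polynomial.coeff_sub, hP.2, Polynomial.coeff_X_one] at e
      have e' := congrArg (Subtype.val) e
      exact e'.symm
    have h2 : ‖(r.coeff 1 : F)‖ ≤ ε k := by
      set ι := (algebraMap F Ω).comp (unitBall F).subtype with hι
      have hdeg : (r.map ι).degree < S.card := by
        refine (Polynomial.degree_map_le).trans_lt ?_
        have := Polynomial.degree_modByMonic_lt R hm.1
        rwa [Polynomial.degree_eq_natDegree hm.1.ne_zero, hm.2, ← hcard] at this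
      have h3 := Lagrange.eq_interpolate (s := S) (v := id) (Set.injOn_id _) hdeg
      rw [Lagrange.interpolate_apply] at h3
      have h4 := congrArg (fun T => Polynomial.coeff T 1) h3
      simp only [Polynomial.coeff_map, Polynomial.finsetSum_coeff, Polynomial.coeff_C_mul] at h4
      have h5 : ‖(r.coeff 1 : F)‖ = ‖ι (r.coeff 1)‖ := (norm_algebraMap' Ω _).symm
      rw [h5, h4]
      refine (norm_sum_le _ _).trans (Finset.sum_le_sum fun x hx => ?_)
      rw [norm_mul]
      refine mul_le_mul_of_nonneg_right ?_ (norm_nonneg _)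
      have hx0 := (hS x).1 hx
      have h6 : Polynomial.eval (id x) (r.map ι) = ballEval Ω x R := by
        rw [← hdiv, map_add, map_mul, hG, h.ballEval_lubinTateIter, hx0, zero_mul, add_zero,
          Polynomial.eval_map]
        rfl
      rw [h6, hR, map_sub, ballEval_X, norm_sub_rev]
      exact ha x hx0 k P hP
    rw [h1]
    refine (IsUltrametricDist.norm_add_le_max _ _).trans ?_
    rw [max_comm]
    refine max_le_max ?_ h2
    rw [norm_mul, norm_pow]
    exact mul_le_of_le_one_right (by positivity) (s.coeff 0).2
  by_contra! hlt
  have h1 : ∀ k, ‖(a : F) - 1‖ ≤ ε k := fun k => (le_max_iff.1 (key k)).resolve_left (not_le.2 hlt)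
  have h2 := ge_of_tendsto' hε h1
  exact absurd (hlt.trans_le h2) (not_lt.2 (by positivity))

end

/-- `x` is a Lubin–Tate torsion point of exact level `n + 1`. -/
def IsPrimitiveTorsion {F Ω : Type*} [Field F] [Field Ω] [Algebra F Ω] (ϖ : F) (q n : ℕ)
    (x : Ω) : Prop :=
  ((lubinTateMap ϖ q)^[n] x) ^ (q - 1) = -algebraMap F Ω ϖ

section

variable {F Ω : Type*} [NontriviallyNormedField F] [IsUltrametricDist F] [ProperSpace F]
  [NontriviallyNormedField Ω] [IsUltrametricDist Ω] [NormedAlgebra F Ω] [Algebra.IsAlgebraic F Ω]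
  {p q : ℕ} {ϖ : F}

theorem LocalParam.isPrimitiveTorsion_iff (h : LocalParam p F ϖ q) {n : ℕ} {x : Ω} :
    IsPrimitiveTorsion ϖ q n x ↔
      (lubinTateMap ϖ q)^[n + 1] x = 0 ∧ (lubinTateMap ϖ q)^[n] x ≠ 0 := by
  rw [Function.iterate_succ_apply', IsPrimitiveTorsion]
  constructor
  · intro hx
    have hne : (lubinTateMap ϖ q)^[n] x ≠ 0 := by
      intro h0
      rw [h0, zero_pow (by have := h.two_le; omega), eq_comm, neg_eq_zero, map_eq_zero] at hx
      exact h.unif_ne_zero hx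
    exact ⟨(h.lubinTateMap_eq_zero_iff hne).2 hx, hne⟩
  · rintro ⟨h1, h2⟩
    exact (h.lubinTateMap_eq_zero_iff h2).1 h1

theorem LocalParam.norm_lt_one_of_isPrimitiveTorsion (h : LocalParam p F ϖ q) {n : ℕ} {x : Ω}
    (hx : IsPrimitiveTorsion ϖ q n x) : ‖x‖ < 1 :=
  h.norm_lt_one_of_iterate_eq_zero (h.isPrimitiveTorsion_iff.1 hx).1

theorem LocalParam.norm_pow_isPrimitiveTorsion (h : LocalParam p F ϖ q) {n : ℕ} {x : Ω}
    (hx : IsPrimitiveTorsion ϖ q n x) : ‖x‖ ^ (q ^ n * (q - 1)) = ‖ϖ‖ := by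
  have hq := h.two_le
  induction n generalizing x with
  | zero =>
    have h1 := congrArg norm hx
    rw [Function.iterate_zero_apply, norm_pow, norm_neg, norm_algebraMap'] at h1
    rw [pow_zero, one_mul, h1]
  | succ n ih =>
    have hx1 := h.norm_lt_one_of_isPrimitiveTorsion hx
    have hy : IsPrimitiveTorsion ϖ q n (lubinTateMap ϖ q x) := by
      rw [IsPrimitiveTorsion, Function.iterate_succ_apply] at hx
      exact hx
    have h1 := ih hy
    have hy1 := h.norm_lt_one_of_isPrimitiveTorsion hy
    set y := lubinTateMap ϖ q x with hyx
    have h2 : ‖ϖ‖ ≤ ‖y‖ := by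
      rw [← h1]
      exact pow_le_of_le_one (norm_nonneg _) hy1.le
        (Nat.mul_ne_zero (pow_ne_zero _ (by omega)) (by omega))
    have h3 : ‖algebraMap F Ω ϖ * x‖ < ‖y‖ := by
      rw [norm_mul, norm_algebraMap']
      exact (mul_lt_of_lt_one_right (norm_pos_iff.2 h.unif_ne_zero) hx1).trans_le h2
    have h4 : x ^ q = y + -(algebraMap F Ω ϖ * x) := by
      rw [hyx, lubinTateMap]
      ring
    have h5 : ‖x‖ ^ q = ‖y‖ := by
      rw [← norm_pow, h4, IsUltrametricDist.norm_add_eq_max_of_norm_ne_norm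
        (by rw [norm_neg]; exact h3.ne'), norm_neg, max_eq_left h3.le]
    rw [pow_succ', mul_assoc, pow_mul, h5, h1]

/-- The minimal polynomial over `F` of the torsion points of exact level `n + 1`. -/
def primitiveTorsionPoly {F : Type*} [Field F] (ϖ : F) (q n : ℕ) : Polynomial F :=
  lubinTateIter ϖ q n ^ (q - 1) + Polynomial.C ϖ

theorem aeval_primitiveTorsionPoly {n : ℕ} {x : Ω} :
    Polynomial.aeval x (primitiveTorsionPoly ϖ q n) = 0 ↔ IsPrimitiveTorsion ϖ q n x := by
  rw [primitiveTorsionPoly, map_add, map_pow, Polynomial.aeval_C, aeval_lubinTateIter,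
    IsPrimitiveTorsion, eq_neg_iff_add_eq_zero]

theorem monic_natDegree_primitiveTorsionPoly {F : Type*} [Field F] (ϖ : F) {q : ℕ} (hq : 2 ≤ q)
    (n : ℕ) : (primitiveTorsionPoly ϖ q n).Monic ∧
      (primitiveTorsionPoly ϖ q n).natDegree = q ^ n * (q - 1) := by
  have h := monic_natDegree_lubinTateIter ϖ hq n
  have hd : (lubinTateIter ϖ q n ^ (q - 1)).natDegree = q ^ n * (q - 1) := by
    rw [Polynomial.natDegree_pow, h.2, mul_comm]
  have hlt : (Polynomial.C ϖ).degree < (lubinTateIter ϖ q n ^ (q - 1)).degree := by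
    refine Polynomial.degree_C_le.trans_lt ?_
    rw [Polynomial.degree_eq_natDegree (h.1.pow _).ne_zero, hd]
    have : 0 < q ^ n * (q - 1) := Nat.mul_pos (by positivity) (by omega)
    exact_mod_cast this
  exact ⟨(h.1.pow _).add_of_left hlt,
    (Polynomial.natDegree_add_eq_left_of_degree_lt hlt).trans hd⟩

theorem LocalParam.dvd_natDegree_minpoly [IsAlgClosed Ω] (h : LocalParam p F ϖ q)
    (M : IntermediateField F Ω) (hM : ∀ x ∈ M, x ≠ 0 → ∃ k : ℤ, ‖x‖ = ‖ϖ‖ ^ k) {n : ℕ} {x : Ω}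
    (hx : IsPrimitiveTorsion ϖ q n x) : q ^ n * (q - 1) ≤ (minpoly M x).natDegree := by
  have hn : Normal F Ω := normal_of_isAlgClosed F Ω
  have hnM : Normal M Ω := Normal.tower_top_of_normal F M Ω
  have hx0 : x ≠ 0 := by
    rintro rfl
    exact (h.isPrimitiveTorsion_iff.1 hx).2 (h.iterate_zero n)
  have hpos : 0 < ‖x‖ := norm_pos_iff.2 hx0
  have hintegral : IsIntegral M x := Algebra.IsIntegral.isIntegral x
  set f := (minpoly M x).map (algebraMap M Ω) with hf
  have hmon : f.Monic := (minpoly.monic hintegral).map _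
  have hnorm : ∀ y ∈ f.roots, ‖y‖ = ‖x‖ := by
    intro y hy
    rw [Polynomial.mem_roots hmon.ne_zero, Polynomial.IsRoot.def, hf,
      Polynomial.eval_map_algebraMap] at hy
    have h1 : minpoly M x = minpoly M y :=
      minpoly.eq_of_irreducible_of_monic (minpoly.irreducible hintegral) hy (minpoly.monic hintegral)
    obtain ⟨g, hg⟩ := (Normal.minpoly_eq_iff_mem_orbit Ω).1 h1
    have h2 : (g.restrictScalars F) y = x := hg
    rw [← h2, norm_algEquiv_apply]
  have hsp : f.Splits := IsAlgClosed.splits f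
  have h3 := hsp.coeff_zero_eq_prod_roots_of_monic hmon
  have h4 : ‖f.coeff 0‖ = ‖x‖ ^ (minpoly M x).natDegree := by
    rw [h3, norm_mul, norm_pow, norm_neg, norm_one, one_pow, one_mul]
    have h5 : ∀ m : Multiset Ω, (∀ y ∈ m, ‖y‖ = ‖x‖) → ‖m.prod‖ = ‖x‖ ^ m.card := by
      intro m
      induction m using Multiset.induction_on with
      | empty => simp
      | cons a m ih =>
        intro hm
        rw [Multiset.prod_cons, norm_mul, Multiset.card_cons, pow_succ',
          hm a (Multiset.mem_cons_self a m), ih fun y hy => hm y (Multiset.mem_cons_of_mem hy)]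
    rw [h5 _ hnorm, Polynomial.splits_iff_card_roots.1 hsp, hf, (minpoly.monic hintegral).natDegree_map]
  have h6 : f.coeff 0 = ((minpoly M x).coeff 0 : Ω) := by
    rw [hf, Polynomial.coeff_map]
    rfl
  have h7 : ((minpoly M x).coeff 0 : Ω) ≠ 0 := by
    rw [← h6, ← norm_pos_iff, h4]
    positivity
  obtain ⟨k, hk⟩ := hM _ ((minpoly M x).coeff 0).2 h7
  rw [← h6, h4, ← h.norm_pow_isPrimitiveTorsion hx, ← zpow_natCast, ← zpow_natCast,
    ← zpow_mul] at hk
  have hx1 := h.norm_lt_one_of_isPrimitiveTorsion hx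
  have h8 := zpow_right_injective₀ hpos hx1.ne hk
  have h9 : 0 < (minpoly M x).natDegree := minpoly.natDegree_pos hintegral
  exact Nat.le_of_dvd h9 (Int.natCast_dvd_natCast.1 ⟨k, h8⟩)

/-- The torsion points of a given exact level are conjugate over any extension with the same
value group. -/
theorem LocalParam.exists_apply_eq_of_isPrimitiveTorsion [IsAlgClosed Ω] (h : LocalParam p F ϖ q)
    (M : IntermediateField F Ω) (hM : ∀ x ∈ M, x ≠ 0 → ∃ k : ℤ, ‖x‖ = ‖ϖ‖ ^ k) {n : ℕ} {x y : Ω}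
    (hx : IsPrimitiveTorsion ϖ q n x) (hy : IsPrimitiveTorsion ϖ q n y) :
    ∃ g ∈ M.fixingSubgroup, g x = y := by
  have hn : Normal F Ω := normal_of_isAlgClosed F Ω
  have hnM : Normal M Ω := Normal.tower_top_of_normal F M Ω
  have key : ∀ z : Ω, IsPrimitiveTorsion ϖ q n z →
      minpoly M z = (primitiveTorsionPoly ϖ q n).map (algebraMap F M) := by
    intro z hz
    have hintegral : IsIntegral M z := Algebra.IsIntegral.isIntegral z
    have hm := monic_natDegree_primitiveTorsionPoly ϖ h.two_le n
    refine (Polynomial.eq_of_monic_of_dvd_of_natDegree_le (minpoly.monic hintegral) (hm.1.map _)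
      (minpoly.dvd M z ?_) ?_).symm
    · rw [Polynomial.aeval_map_algebraMap]
      exact aeval_primitiveTorsionPoly.2 hz
    · rw [hm.1.natDegree_map, hm.2]
      exact h.dvd_natDegree_minpoly M hM hz
  obtain ⟨g, hg⟩ := (Normal.minpoly_eq_iff_mem_orbit (F := M) Ω).1 ((key y hy).trans (key x hx).symm)
  exact ⟨g.restrictScalars F,
    (IntermediateField.mem_fixingSubgroup_iff M _).2 fun z hz => g.commutes ⟨z, hz⟩, hg⟩

theorem LocalParam.exists_zpow_of_mem_unramClosure [IsAlgClosed Ω] [CharZero Ω]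
    (h : LocalParam p F ϖ q) {x : Ω} (hx : x ∈ unramClosure p F Ω) (hx0 : x ≠ 0) :
    ∃ k : ℤ, ‖x‖ = ‖ϖ‖ ^ k := by
  obtain ⟨k, ζ, hk, hζ, hxζ⟩ := exists_rootOfUnity_of_mem_unramClosure h.prime hx
  obtain ⟨y, hy⟩ := exists_norm_eq_of_mem_adjoin_rootOfUnity h.prime h.norm_natCast_lt_one
    norm_algEquiv_apply hk hζ.pow_eq_one hxζ
  rw [norm_algebraMap'] at hy
  rw [hy]
  refine h.norm_eq_zpow y ?_
  rintro rfl
  rw [norm_zero, norm_eq_zero] at hy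
  exact hx0 hy

/-- A compatible system of Lubin–Tate torsion points. -/
structure IsTorsionTower (ϖ : F) (q : ℕ) (l : ℕ → Ω) : Prop where
  zero : l 0 ^ (q - 1) = -algebraMap F Ω ϖ
  succ : ∀ n, lubinTateMap ϖ q (l (n + 1)) = l n

theorem LocalParam.exists_isTorsionTower [IsAlgClosed Ω] (h : LocalParam p F ϖ q) :
    ∃ l : ℕ → Ω, IsTorsionTower ϖ q l := by
  have hq := h.two_le
  obtain ⟨x, hx⟩ := IsAlgClosed.exists_pow_nat_eq (-algebraMap F Ω ϖ) (show 0 < q - 1 by omega)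
  have hsurj : ∀ y : Ω, ∃ z, lubinTateMap ϖ q z = y := by
    intro y
    have hm := natDegree_lubinTatePoly_le (algebraMap F Ω ϖ) hq
    have hdeg : (lubinTatePoly (algebraMap F Ω ϖ) q - Polynomial.C y).degree ≠ 0 := by
      have h1 : (lubinTatePoly (algebraMap F Ω ϖ) q - Polynomial.C y).natDegree = q := by
        rw [Polynomial.natDegree_sub_C, hm.2]
      intro h0
      rw [Polynomial.natDegree_eq_of_degree_eq_some (n := 0) (by simpa using h0)] at h1
      omega
    obtain ⟨z, hz⟩ := IsAlgClosed.exists_root _ hdeg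
    refine ⟨z, ?_⟩
    rw [Polynomial.IsRoot.def, Polynomial.eval_sub, Polynomial.eval_C, sub_eq_zero] at hz
    rw [← hz]
    simp [lubinTateMap, lubinTatePoly]
  choose s hs using hsurj
  exact ⟨fun n => s^[n] x, hx, fun n => by rw [Function.iterate_succ_apply', hs]⟩

theorem IsTorsionTower.iterate {l : ℕ → Ω} (hl : IsTorsionTower ϖ q l) (n m : ℕ) :
    (lubinTateMap ϖ q)^[n] (l (m + n)) = l m := by
  induction n with
  | zero => rfl
  | succ n ih => rw [Function.iterate_succ_apply, ← add_assoc, hl.succ, ih]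

theorem IsTorsionTower.isPrimitiveTorsion {l : ℕ → Ω} (hl : IsTorsionTower ϖ q l) (n : ℕ) :
    IsPrimitiveTorsion ϖ q n (l n) := by
  have h1 := hl.iterate n 0
  rw [zero_add] at h1
  rw [IsPrimitiveTorsion, h1, hl.zero]

/-- The stabilizer of a torsion point of exact level `n + 1` consists of elements congruent
to `1`. -/
theorem LocalParam.norm_sub_one_le_of_acts [IsAlgClosed Ω] (h : LocalParam p F ϖ q) {l : ℕ → Ω}
    (hl : IsTorsionTower ϖ q l) {n : ℕ} {a : unitBall F} (ha : h.Acts a (l n) (l n)) :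
    ‖(a : F) - 1‖ ≤ ‖ϖ‖ ^ (n + 1) := by
  refine h.norm_sub_one_le (Ω := Ω) fun x hx => ?_
  classical
  have hex : ∃ m, (lubinTateMap ϖ q)^[m] x = 0 := ⟨_, hx⟩
  have hle : Nat.find hex ≤ n + 1 := Nat.find_min' hex hx
  rcases hm : Nat.find hex with _ | j
  · have h0 := Nat.find_spec hex
    rw [hm] at h0
    have : x = 0 := h0
    rw [this]
    exact h.acts_zero a
  · have h0 := Nat.find_spec hex
    rw [hm] at h0 hle
    have hne : (lubinTateMap ϖ q)^[j] x ≠ 0 := Nat.find_min hex (by omega)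
    have hprim : IsPrimitiveTorsion ϖ q j x := h.isPrimitiveTorsion_iff.2 ⟨h0, hne⟩
    have hbot : ∀ x ∈ (⊥ : IntermediateField F Ω), x ≠ 0 → ∃ k : ℤ, ‖x‖ = ‖ϖ‖ ^ k := by
      intro x hx hx0
      obtain ⟨y, rfl⟩ := mem_bot.1 hx
      rw [norm_algebraMap']
      exact h.norm_eq_zpow y fun h0 => hx0 (by rw [h0, map_zero])
    obtain ⟨g, -, rfl⟩ :=
      h.exists_apply_eq_of_isPrimitiveTorsion ⊥ hbot (hl.isPrimitiveTorsion j) hprim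
    refine LocalParam.Acts.map g (norm_algEquiv_apply g) ?_
    have h1 := ha.iterate (h.norm_lt_one_of_isPrimitiveTorsion (hl.isPrimitiveTorsion n)) (n - j)
    have h2 := hl.iterate (n - j) j
    rw [show j + (n - j) = n by omega] at h2
    rwa [h2] at h1

end

/-- The units of norm one. -/
def normOneUnits (F : Type*) [NormedField F] : Subgroup Fˣ where
  carrier := {u | ‖(u : F)‖ = 1}
  one_mem' := by simp
  mul_mem' := by
    intro a b ha hb
    change ‖(a : F) * b‖ = 1
    rw [norm_mul, show ‖(a : F)‖ = 1 from ha, show ‖(b : F)‖ = 1 from hb, one_mul]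
  inv_mem' := by
    intro a ha
    change ‖((a⁻¹ : Fˣ) : F)‖ = 1
    rw [Units.val_inv_eq_inv_val, norm_inv, show ‖(a : F)‖ = 1 from ha, inv_one]

/-- The inclusion of the units of norm one in the ring of integers. -/
def normOneUnits.toBall {F : Type*} [NormedField F] [IsUltrametricDist F] :
    normOneUnits F →* unitBall F where
  toFun u := ⟨((u : Fˣ) : F), show ‖((u : Fˣ) : F)‖ ≤ 1 from le_of_eq u.2⟩
  map_one' := rfl
  map_mul' _ _ := rfl

section

variable {F Ω : Type*} [NontriviallyNormedField F] [IsUltrametricDist F] [ProperSpace F]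
  [NontriviallyNormedField Ω] [IsUltrametricDist Ω] [NormedAlgebra F Ω] [Algebra.IsAlgebraic F Ω]
  {p q : ℕ} {ϖ : F}

/-- Representatives of the units modulo a power of the uniformizer. -/
theorem LocalParam.exists_finset_units (h : LocalParam p F ϖ q) (n : ℕ) :
    ∃ T : Finset F, T.card = q ^ n * (q - 1) ∧ (∀ t ∈ T, ‖t‖ = 1) ∧
      ∀ s ∈ T, ∀ t ∈ T, s ≠ t → ‖ϖ‖ ^ (n + 1) < ‖s - t‖ := by
  classical
  obtain ⟨R, hcard, hR1, hRdense, hRsep⟩ := h.residue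
  have hpos : 0 < ‖ϖ‖ := norm_pos_iff.2 h.unif_ne_zero
  have hlt := h.norm_unif_lt_one
  induction n with
  | zero =>
    obtain ⟨t0, ht0, ht0'⟩ := hRdense 0 (by simp)
    rw [zero_sub, norm_neg] at ht0'
    refine ⟨R.erase t0, ?_, ?_, ?_⟩
    · rw [Finset.card_erase_of_mem ht0, hcard, pow_zero, one_mul]
    · intro t ht
      have hne := Finset.ne_of_mem_erase ht
      have h1 := hRsep t (Finset.mem_of_mem_erase ht) t0 ht0 hne
      have h2 := IsUltrametricDist.norm_add_le_max (t - t0) t0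
      rw [sub_add_cancel, h1, max_eq_left ht0'.le] at h2
      refine le_antisymm h2 ?_
      by_contra! h3
      have h4 := norm_sub_lt_one h3 ht0'
      rw [h1] at h4
      exact lt_irrefl _ h4
    · intro s hs t ht hst
      rw [zero_add, pow_one, hRsep s (Finset.mem_of_mem_erase hs) t (Finset.mem_of_mem_erase ht) hst]
      exact hlt
  | succ n ih =>
    obtain ⟨T, hT, hT1, hTsep⟩ := ih
    have hsmall : ‖ϖ‖ ^ (n + 1) < 1 := pow_lt_one₀ (norm_nonneg _) hlt (by omega)
    have hpow : 0 < ‖ϖ‖ ^ (n + 1) := by positivity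
    have hstep : ‖ϖ‖ ^ (n + 1 + 1) < ‖ϖ‖ ^ (n + 1) := by
      rw [pow_succ _ (n + 1)]
      exact mul_lt_of_lt_one_right hpow hlt
    let f : F × F → F := fun z => z.1 + ϖ ^ (n + 1) * z.2
    have hsep : ∀ z ∈ T ×ˢ R, ∀ w ∈ T ×ˢ R, z ≠ w → ‖ϖ‖ ^ (n + 1 + 1) < ‖f z - f w‖ := by
      intro z hz w hw hzw
      rw [Finset.mem_product] at hz hw
      have h1 : f z - f w = (z.1 - w.1) + ϖ ^ (n + 1) * (z.2 - w.2) := by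
        simp only [f]
        ring
      by_cases h2 : z.1 = w.1
      · have h3 : z.2 ≠ w.2 := fun h3 => hzw (Prod.ext h2 h3)
        rw [h1, h2, sub_self, zero_add, norm_mul, norm_pow, hRsep _ hz.2 _ hw.2 h3, mul_one]
        exact hstep
      · have h3 := hTsep _ hz.1 _ hw.1 h2
        have h4 : ‖ϖ ^ (n + 1) * (z.2 - w.2)‖ ≤ ‖ϖ‖ ^ (n + 1) := by
          rw [norm_mul, norm_pow]
          refine mul_le_of_le_one_right hpow.le ?_
          exact (norm_sub_le_max_norm _ _).trans (max_le (hR1 _ hz.2) (hR1 _ hw.2))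
        rw [h1, IsUltrametricDist.norm_add_eq_max_of_norm_ne_norm (h4.trans_lt h3).ne',
          max_eq_left (h4.trans h3.le)]
        exact hstep.trans h3
    have hinj : Set.InjOn f (T ×ˢ R : Finset (F × F)) := by
      intro z hz w hw hzw
      by_contra hne
      have h1 := hsep z hz w hw hne
      rw [hzw, sub_self, norm_zero] at h1
      exact absurd h1 (not_lt.2 (by positivity))
    refine ⟨(T ×ˢ R).image f, ?_, ?_, ?_⟩
    · rw [Finset.card_image_of_injOn hinj, Finset.card_product, hT, hcard]
      ring
    · intro t ht
      obtain ⟨z, hz, rfl⟩ := Finset.mem_image.1 ht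
      rw [Finset.mem_product] at hz
      have h4 : ‖ϖ ^ (n + 1) * z.2‖ < 1 := by
        rw [norm_mul, norm_pow]
        exact (mul_le_of_le_one_right hpow.le (hR1 _ hz.2)).trans_lt hsmall
      have h5 := hT1 _ hz.1
      change ‖z.1 + ϖ ^ (n + 1) * z.2‖ = 1
      rw [IsUltrametricDist.norm_add_eq_max_of_norm_ne_norm (by rw [h5]; exact h4.ne'), h5,
        max_eq_left h4.le]
    · intro s hs t ht hst
      obtain ⟨z, hz, rfl⟩ := Finset.mem_image.1 hs
      obtain ⟨w, hw, rfl⟩ := Finset.mem_image.1 ht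
      exact hsep z hz w hw fun h0 => hst (by rw [h0])

/-- The action of the units of norm one on the torsion points. -/
def LocalParam.UnitActs (h : LocalParam p F ϖ q) (u : normOneUnits F) (x y : Ω) : Prop :=
  h.Acts (normOneUnits.toBall u) x y

theorem LocalParam.UnitActs.inv {h : LocalParam p F ϖ q} {u : normOneUnits F} {x y : Ω}
    (hx : ‖x‖ < 1) (hy : h.UnitActs u x y) : h.UnitActs u⁻¹ y x := by
  obtain ⟨z, hz⟩ := h.exists_acts (normOneUnits.toBall u⁻¹) ((hy.norm_le hx).trans_lt hx)
  have h1 := LocalParam.Acts.trans hx hy hz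
  rw [← map_mul, inv_mul_cancel, map_one] at h1
  rwa [← h1.unique hx (h.acts_one hx)]

theorem LocalParam.UnitActs.isPrimitiveTorsion {h : LocalParam p F ϖ q} {u : normOneUnits F}
    {n : ℕ} {x y : Ω} (hx : IsPrimitiveTorsion ϖ q n x) (hy : h.UnitActs u x y) :
    IsPrimitiveTorsion ϖ q n y := by
  have hx1 := h.norm_lt_one_of_isPrimitiveTorsion hx
  have hx' := h.isPrimitiveTorsion_iff.1 hx
  have hz : ∀ {z : Ω} {v : normOneUnits F}, h.Acts (normOneUnits.toBall v) 0 z → z = 0 :=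
    fun hz => hz.unique (by simp) (h.acts_zero _)
  refine h.isPrimitiveTorsion_iff.2 ⟨?_, fun h0 => hx'.2 ?_⟩
  · have := hy.iterate hx1 (n + 1)
    rw [hx'.1] at this
    exact hz this
  · have h1 : h.UnitActs u _ _ := hy.iterate hx1 n
    rw [h0] at h1
    exact hz (h1.inv (h.norm_iterate_lubinTateMap_lt_one hx1 n))

theorem LocalParam.UnitActs.norm_sub_le [IsAlgClosed Ω] {h : LocalParam p F ϖ q} {l : ℕ → Ω}
    (hl : IsTorsionTower ϖ q l) {n : ℕ} {u v : normOneUnits F} {y : Ω}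
    (hu : h.UnitActs u (l n) y) (hv : h.UnitActs v (l n) y) :
    ‖((u : Fˣ) : F) - ((v : Fˣ) : F)‖ ≤ ‖ϖ‖ ^ (n + 1) := by
  have hx1 := h.norm_lt_one_of_isPrimitiveTorsion (hl.isPrimitiveTorsion n)
  have h1 := LocalParam.Acts.trans hx1 hu (hv.inv hx1)
  rw [← map_mul] at h1
  have h2 := h.norm_sub_one_le_of_acts hl h1
  have h3 : ((u : Fˣ) : F) - ((v : Fˣ) : F) =
      ((v : Fˣ) : F) * (((normOneUnits.toBall (v⁻¹ * u) : unitBall F) : F) - 1) := by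
    have : ((normOneUnits.toBall (v⁻¹ * u) : unitBall F) : F) =
      (((v : Fˣ)⁻¹ : Fˣ) : F) * ((u : Fˣ) : F) := rfl
    rw [this, mul_sub, ← mul_assoc, Units.mul_inv, one_mul, mul_one]
  rw [h3, norm_mul, show ‖((v : Fˣ) : F)‖ = 1 from v.2, one_mul]
  exact h2

theorem LocalParam.exists_unitActs_finset [IsAlgClosed Ω] (h : LocalParam p F ϖ q) {l : ℕ → Ω}
    (hl : IsTorsionTower ϖ q l) (n : ℕ) :
    ∃ T : Set (normOneUnits F),
      (∀ s ∈ T, ∀ t ∈ T, ‖((s : Fˣ) : F) - ((t : Fˣ) : F)‖ ≤ ‖ϖ‖ ^ (n + 1) → s = t) ∧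
      ∀ y, IsPrimitiveTorsion ϖ q n y → ∃ t ∈ T, h.UnitActs t (l n) y := by
  classical
  obtain ⟨T, hcard, hT1, hsep⟩ := h.exists_finset_units n
  have hprim := hl.isPrimitiveTorsion n
  have hx1 := h.norm_lt_one_of_isPrimitiveTorsion hprim
  let u : T → normOneUnits F := fun t =>
    ⟨Units.mk0 t.1 (norm_ne_zero_iff.1 (by rw [hT1 t.1 t.2]; exact one_ne_zero)), hT1 t.1 t.2⟩
  have hact : ∀ t, ∃ y, h.UnitActs (u t) (l n) y := fun t => h.exists_acts _ hx1
  choose f hf using hact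
  have hsep' : ∀ s t : T, ‖(s : F) - t‖ ≤ ‖ϖ‖ ^ (n + 1) → s = t := by
    intro s t hst
    by_contra hne
    exact absurd (hsep s s.2 t t.2 fun h0 => hne (Subtype.ext h0)) (not_lt.2 hst)
  have hinj : Function.Injective f := by
    intro s t hst
    refine hsep' s t ?_
    have h1 := hf t
    rw [← hst] at h1
    exact (hf s).norm_sub_le hl h1
  set P := (primitiveTorsionPoly ϖ q n).map (algebraMap F Ω) with hP
  have hm := monic_natDegree_primitiveTorsionPoly ϖ h.two_le n
  have hP0 : P ≠ 0 := (hm.1.map _).ne_zero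
  have hroots : ∀ y, y ∈ P.roots.toFinset ↔ IsPrimitiveTorsion ϖ q n y := by
    intro y
    rw [Multiset.mem_toFinset, Polynomial.mem_roots hP0, Polynomial.IsRoot.def, hP,
      Polynomial.eval_map_algebraMap, aeval_primitiveTorsionPoly]
  have hle : P.roots.toFinset.card ≤ (Finset.univ.image f).card := by
    rw [Finset.card_image_of_injective _ hinj, Finset.card_univ, Fintype.card_coe, hcard, ← hm.2,
      ← hm.1.natDegree_map (algebraMap F Ω)]
    exact (Multiset.toFinset_card_le _).trans (Polynomial.card_roots' P)
  have hsub : Finset.univ.image f ⊆ P.roots.toFinset := by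
    intro y hy
    obtain ⟨t, -, rfl⟩ := Finset.mem_image.1 hy
    exact (hroots _).2 ((hf t).isPrimitiveTorsion hprim)
  have heq := Finset.eq_of_subset_of_card_le hsub hle
  refine ⟨Set.range u, ?_, ?_⟩
  · rintro _ ⟨s, rfl⟩ _ ⟨t, rfl⟩ hst
    rw [hsep' s t hst]
  · intro y hy
    rw [← hroots, ← heq] at hy
    obtain ⟨t, -, rfl⟩ := Finset.mem_image.1 hy
    exact ⟨u t, ⟨t, rfl⟩, hf t⟩

theorem LocalParam.unitActs_of_norm_sub_le [IsAlgClosed Ω] (h : LocalParam p F ϖ q) {l : ℕ → Ω}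
    (hl : IsTorsionTower ϖ q l) {n : ℕ} {u v : normOneUnits F} {y : Ω}
    (hu : h.UnitActs u (l n) y)
    (huv : ‖((u : Fˣ) : F) - ((v : Fˣ) : F)‖ ≤ ‖ϖ‖ ^ (n + 1)) : h.UnitActs v (l n) y := by
  obtain ⟨T, hT, hTy⟩ := h.exists_unitActs_finset hl n
  have hprim := hl.isPrimitiveTorsion n
  have hx1 := h.norm_lt_one_of_isPrimitiveTorsion hprim
  obtain ⟨z, hz⟩ := h.exists_acts (normOneUnits.toBall v) hx1
  have hz' : h.UnitActs v (l n) z := hz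
  obtain ⟨s, hs, hsy⟩ := hTy y (hu.isPrimitiveTorsion hprim)
  obtain ⟨t, ht, htz⟩ := hTy z (hz'.isPrimitiveTorsion hprim)
  have h1 := hsy.norm_sub_le hl hu
  have h2 := hz'.norm_sub_le hl htz
  have h3 := (IsUltrametricDist.norm_add_le_max _ _).trans (max_le h1 huv)
  have h4 := (IsUltrametricDist.norm_add_le_max _ _).trans (max_le h3 h2)
  rw [sub_add_sub_cancel, sub_add_sub_cancel] at h4
  have hst := hT s hs t ht h4
  rw [hst] at hsy
  rwa [LocalParam.Acts.unique hx1 hsy htz]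

theorem LocalParam.exists_unitActs_tower [IsAlgClosed Ω] (h : LocalParam p F ϖ q) {l : ℕ → Ω}
    (hl : IsTorsionTower ϖ q l) (g : Ω ≃ₐ[F] Ω) :
    ∃ u : normOneUnits F, ∀ n, h.UnitActs u (l n) (g (l n)) := by
  have hconj : ∀ n, IsPrimitiveTorsion ϖ q n (g (l n)) := by
    intro n
    rw [IsPrimitiveTorsion, iterate_lubinTateMap_algEquiv, ← map_pow, hl.isPrimitiveTorsion n,
      map_neg, g.commutes]
  have hex : ∀ n, ∃ u : normOneUnits F, h.UnitActs u (l n) (g (l n)) := by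
    intro n
    obtain ⟨T, -, hT⟩ := h.exists_unitActs_finset hl n
    obtain ⟨t, -, ht⟩ := hT _ (hconj n)
    exact ⟨t, ht⟩
  choose u hu using hex
  have hdown : ∀ n m, h.UnitActs (u (n + m)) (l n) (g (l n)) := by
    intro n m
    have h1 := (hu (n + m)).iterate
      (h.norm_lt_one_of_isPrimitiveTorsion (hl.isPrimitiveTorsion (n + m))) m
    rwa [iterate_lubinTateMap_algEquiv, hl.iterate] at h1
  let a : ℕ → F := fun n => ((u n : Fˣ) : F)
  have ha1 : ∀ n, ‖a n‖ = 1 := fun n => (u n).2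
  have hcl : ∀ n m, n ≤ m → ‖a m - a n‖ ≤ ‖ϖ‖ ^ (n + 1) := by
    intro n m hnm
    obtain ⟨k, rfl⟩ := Nat.exists_eq_add_of_le hnm
    exact (hdown n k).norm_sub_le hl (hu n)
  have hpow : Filter.Tendsto (fun n => ‖ϖ‖ ^ (n + 1)) Filter.atTop (nhds 0) :=
    (tendsto_pow_atTop_nhds_zero_of_lt_one (norm_nonneg _) h.norm_unif_lt_one).comp
      (Filter.tendsto_add_atTop_nat 1)
  have hcau : CauchySeq a := by
    refine cauchySeq_of_le_tendsto_0' (fun k => ‖ϖ‖ ^ (k + 1)) (fun n m hnm => ?_) hpow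
    rw [dist_comm, dist_eq_norm]
    exact hcl n m hnm
  obtain ⟨b, hb⟩ := cauchySeq_tendsto_of_complete hcau
  have hb1 : ‖b‖ = 1 := by
    refine tendsto_nhds_unique hb.norm ?_
    simp [ha1]
  let v : normOneUnits F :=
    ⟨Units.mk0 b (norm_ne_zero_iff.1 (by rw [hb1]; exact one_ne_zero)), hb1⟩
  refine ⟨v, fun n => h.unitActs_of_norm_sub_le hl (hu n) ?_⟩
  have h1 : ‖b - a n‖ ≤ ‖ϖ‖ ^ (n + 1) := by
    refine le_of_tendsto ((hb.sub_const _).norm) ?_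
    filter_upwards [Filter.eventually_ge_atTop n] with m hm
    exact hcl n m hm
  rw [norm_sub_rev] at h1
  exact h1

theorem LocalParam.UnitActs.eq_of_forall [IsAlgClosed Ω] {h : LocalParam p F ϖ q} {l : ℕ → Ω}
    (hl : IsTorsionTower ϖ q l) {u v : normOneUnits F} {y : ℕ → Ω}
    (hu : ∀ n, h.UnitActs u (l n) (y n)) (hv : ∀ n, h.UnitActs v (l n) (y n)) : u = v := by
  have hpow : Filter.Tendsto (fun n => ‖ϖ‖ ^ (n + 1)) Filter.atTop (nhds 0) :=
    (tendsto_pow_atTop_nhds_zero_of_lt_one (norm_nonneg _) h.norm_unif_lt_one).comp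
      (Filter.tendsto_add_atTop_nat 1)
  have h1 := ge_of_tendsto' hpow fun n => (hu n).norm_sub_le hl (hv n)
  exact Subtype.ext (Units.ext (sub_eq_zero.1 (norm_le_zero_iff.1 h1)))

/-- The Lubin–Tate character of the Galois group. -/
theorem LocalParam.exists_character [IsAlgClosed Ω] (h : LocalParam p F ϖ q) {l : ℕ → Ω}
    (hl : IsTorsionTower ϖ q l) :
    ∃ ρ : (Ω ≃ₐ[F] Ω) →* normOneUnits F, ∀ g n, h.UnitActs (ρ g) (l n) (g (l n)) := by
  choose f hf using h.exists_unitActs_tower hl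
  have hx1 : ∀ n, ‖l n‖ < 1 := fun n =>
    h.norm_lt_one_of_isPrimitiveTorsion (hl.isPrimitiveTorsion n)
  refine ⟨⟨⟨f, ?_⟩, ?_⟩, hf⟩
  · refine LocalParam.UnitActs.eq_of_forall hl (hf 1) fun n => ?_
    have h1 := h.acts_one (hx1 n)
    rwa [← map_one normOneUnits.toBall] at h1
  · intro g g'
    refine LocalParam.UnitActs.eq_of_forall hl (hf (g * g')) fun n => ?_
    have h1 : h.Acts (normOneUnits.toBall (f g')) (g (l n)) (g (g' (l n))) :=
      LocalParam.Acts.map g (norm_algEquiv_apply g) (hf g' n)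
    have h2 := LocalParam.Acts.trans (hx1 n) (hf g n) h1
    rw [← map_mul, mul_comm] at h2
    exact h2

end

section

variable {F Ω : Type*} [NontriviallyNormedField F] [IsUltrametricDist F] [ProperSpace F]
  [NontriviallyNormedField Ω] [IsUltrametricDist Ω] [NormedAlgebra F Ω] [Algebra.IsAlgebraic F Ω]
  [IsAlgClosed Ω] [CharZero Ω] {p q : ℕ} {ϖ : F}

/-- The Lubin–Tate character is continuous, and surjective on the inertia subgroup. -/
theorem LocalParam.exists_inertia_character (h : LocalParam p F ϖ q) :
    ∃ ρ : (Ω ≃ₐ[F] Ω) →* normOneUnits F,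
      (∀ n : ℕ, ∃ x : Ω, ∀ g, g x = x → ‖((ρ g : Fˣ) : F) - 1‖ ≤ ‖ϖ‖ ^ (n + 1)) ∧
      ∀ u, ∃ g ∈ (unramClosure p F Ω).fixingSubgroup, ρ g = u := by
  have := isGalois_of_isAlgClosed F Ω
  obtain ⟨l, hl⟩ := h.exists_isTorsionTower (Ω := Ω)
  obtain ⟨ρ, hρ⟩ := h.exists_character hl
  have hx1 : ∀ n, ‖l n‖ < 1 := fun n =>
    h.norm_lt_one_of_isPrimitiveTorsion (hl.isPrimitiveTorsion n)
  refine ⟨ρ, fun n => ⟨l n, fun g hg => ?_⟩, fun u => ?_⟩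
  · have h1 := hρ g n
    rw [hg] at h1
    have h2 : h.UnitActs 1 (l n) (l n) := by
      have h3 := h.acts_one (hx1 n)
      rwa [← map_one normOneUnits.toBall] at h3
    exact h1.norm_sub_le hl h2
  · choose y hy using fun n => h.exists_acts (normOneUnits.toBall u) (hx1 n)
    set I := (unramClosure p F Ω).fixingSubgroup
    let S : ℕ → Set (Ω ≃ₐ[F] Ω) := fun n => (I : Set _) ∩ {g | g (l n) = y n}
    have hIcl : IsClosed (I : Set (Ω ≃ₐ[F] Ω)) := by
      have : (I : Set (Ω ≃ₐ[F] Ω)) = ⋂ x ∈ unramClosure p F Ω, {g | g x = x} := by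
        ext g
        simp only [I, SetLike.mem_coe, IntermediateField.mem_fixingSubgroup_iff, Set.mem_iInter,
          Set.mem_ofPred_eq]
      rw [this]
      exact isClosed_biInter fun x _ => isClosed_setOf_apply_eq x x
    have hcl : ∀ n, IsClosed (S n) := fun n => hIcl.inter (isClosed_setOf_apply_eq _ _)
    have hmap : ∀ (g : Ω ≃ₐ[F] Ω) x, g (lubinTateMap ϖ q x) = lubinTateMap ϖ q (g x) := by
      intro g x
      simp [lubinTateMap]
    have hyl : ∀ n, lubinTateMap ϖ q (y (n + 1)) = y n := by
      intro n
      have h1 : h.Acts (normOneUnits.toBall u) (lubinTateMap ϖ q (l (n + 1)))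
        (lubinTateMap ϖ q (y (n + 1))) := (hy (n + 1)).frob (hx1 _)
      rw [hl.succ] at h1
      exact h1.unique (hx1 n) (hy n)
    obtain ⟨g, hg⟩ := IsCompact.nonempty_iInter_of_sequence_nonempty_isCompact_isClosed S
      (by
        rintro n g ⟨hgI, hg⟩
        refine ⟨hgI, ?_⟩
        have hg' : g (l (n + 1)) = y (n + 1) := hg
        change g (l n) = y n
        rw [← hl.succ, hmap, hg', hyl])
      (by
        intro n
        have h1 : IsPrimitiveTorsion ϖ q n (y n) :=
          LocalParam.UnitActs.isPrimitiveTorsion (hl.isPrimitiveTorsion n) (hy n)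
        obtain ⟨g, hg, hgy⟩ := h.exists_apply_eq_of_isPrimitiveTorsion (unramClosure p F Ω)
          (fun x hx hx0 => h.exists_zpow_of_mem_unramClosure hx hx0) (hl.isPrimitiveTorsion n) h1
        exact ⟨g, hg, hgy⟩)
      (hcl 0).isCompact hcl
    rw [Set.mem_iInter] at hg
    refine ⟨g, (hg 0).1, LocalParam.UnitActs.eq_of_forall hl (hρ g) fun n => ?_⟩
    rw [show g (l n) = y n from (hg n).2]
    exact hy n

end

section

variable {F Ω : Type*} [Field F] [Field Ω] [Algebra F Ω] [IsGalois F Ω]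
  (Q : IntermediateField F Ω) [FiniteDimensional F Q] [Normal F Q]

theorem coe_restrictNormalHom_apply (g : Ω ≃ₐ[F] Ω) (x : Q) :
    ((AlgEquiv.restrictNormalHom Q g x : Q) : Ω) = g x :=
  AlgEquiv.restrictNormal_commutes g Q x

theorem fixingSubgroup_fixedField_comap (H : Subgroup (Q ≃ₐ[F] Q)) :
    (fixedField (H.comap (AlgEquiv.restrictNormalHom Q))).fixingSubgroup =
      H.comap (AlgEquiv.restrictNormalHom (K₁ := Ω) Q) := by
  have hle : Q.fixingSubgroup ≤ H.comap (AlgEquiv.restrictNormalHom (K₁ := Ω) Q) := by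
    rw [← IntermediateField.restrictNormalHom_ker]
    exact Subgroup.ker_le_comap _ _
  have hopen := Subgroup.isOpen_mono hle (IntermediateField.fixingSubgroup_isOpen Q)
  exact InfiniteGalois.fixingSubgroup_fixedField
    ⟨H.comap (AlgEquiv.restrictNormalHom (K₁ := Ω) Q), Subgroup.isClosed_of_isOpen _ hopen⟩

theorem mem_fixedField_comap_iff {H : Subgroup (Q ≃ₐ[F] Q)} {x : Q} :
    (x : Ω) ∈ fixedField (H.comap (AlgEquiv.restrictNormalHom (K₁ := Ω) Q)) ↔
      ∀ g ∈ H, g x = x := by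
  rw [IntermediateField.mem_fixedField_iff]
  constructor
  · intro hx g hg
    obtain ⟨a, rfl⟩ := AlgEquiv.restrictNormalHom_surjective (F := F) (E := Ω) (K₁ := Q) g
    apply Subtype.ext
    rw [coe_restrictNormalHom_apply]
    exact hx a hg
  · intro hx a ha
    rw [← coe_restrictNormalHom_apply, hx _ ha]

theorem fixedField_comap_le (H : Subgroup (Q ≃ₐ[F] Q)) :
    fixedField (H.comap (AlgEquiv.restrictNormalHom (K₁ := Ω) Q)) ≤ Q := by
  intro x hx
  rw [← InfiniteGalois.fixedField_fixingSubgroup Q, IntermediateField.mem_fixedField_iff]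
  intro a ha
  rw [IntermediateField.mem_fixedField_iff] at hx
  apply hx
  rw [← IntermediateField.restrictNormalHom_ker] at ha
  exact Subgroup.ker_le_comap _ _ ha

end

section

variable {F Ω : Type*} [NontriviallyNormedField F] [IsUltrametricDist F] [ProperSpace F]
  [NontriviallyNormedField Ω] [IsUltrametricDist Ω] [NormedAlgebra F Ω] [Algebra.IsAlgebraic F Ω]
  [IsAlgClosed Ω] [CharZero Ω] {p q : ℕ} {ϖ : F}

theorem LocalParam.exists_norm_eq_of_unramified (h : LocalParam p F ϖ q)
    (Q : IntermediateField F Ω) [FiniteDimensional F Q] [Normal F Q] {k : ℕ} (hk : ¬ p ∣ k) {ζ : Ω}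
    (hζ : ζ ^ k = 1) {H S : Subgroup (Q ≃ₐ[F] Q)}
    (hHS : S.comap (AlgEquiv.restrictNormalHom (K₁ := Ω) Q) ⊓ F⟮ζ⟯.fixingSubgroup ≤
      H.comap (AlgEquiv.restrictNormalHom Q)) {x : Q} (hx : ∀ g ∈ H, g x = x) :
    ∃ y : Q, (∀ g ∈ S, g y = y) ∧ ‖x‖ = ‖y‖ := by
  have := isGalois_of_isAlgClosed F Ω
  set L := fixedField (S.comap (AlgEquiv.restrictNormalHom (K₁ := Ω) Q)) with hL
  have h1 : (x : Ω) ∈ L ⊔ F⟮ζ⟯ := by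
    rw [← InfiniteGalois.fixedField_fixingSubgroup (L ⊔ F⟮ζ⟯),
      IntermediateField.fixingSubgroup_sup, hL, fixingSubgroup_fixedField_comap,
      IntermediateField.mem_fixedField_iff]
    intro a ha
    exact (IntermediateField.mem_fixedField_iff _ _).1 ((mem_fixedField_comap_iff Q).2 hx) a
      (hHS ha)
  have h2 : L ⊔ F⟮ζ⟯ ≤ (L⟮ζ⟯).restrictScalars F := by
    refine sup_le (fun y hy => ?_) ?_
    · exact IntermediateField.algebraMap_mem L⟮ζ⟯ (⟨y, hy⟩ : L)
    · rw [IntermediateField.adjoin_simple_le_iff]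
      exact IntermediateField.mem_adjoin_simple_self L ζ
  have h3 : (x : Ω) ∈ L⟮ζ⟯ := h2 h1
  obtain ⟨y, hy⟩ := exists_norm_eq_of_mem_adjoin_rootOfUnity (M := L) h.prime
    (h.norm_natCast_lt_one (Ω := Ω))
    (fun g x => norm_algEquiv_apply (AlgEquiv.restrictScalars F g) x) hk hζ h3
  exact ⟨⟨y, fixedField_comap_le Q S y.2⟩, (mem_fixedField_comap_iff Q).1 y.2, hy⟩

theorem LocalParam.eq_top_of_frobenius_mem (h : LocalParam p F ϖ q) {φ : Ω ≃ₐ[F] Ω}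
    (hφ : IsFrobenius p q φ) (Q : IntermediateField F Ω) [FiniteDimensional F Q] [Normal F Q]
    {H : Subgroup (Q ≃ₐ[F] Q)} (hφH : AlgEquiv.restrictNormalHom Q φ ∈ H)
    (hH : ∀ x : Q, (∀ g ∈ H, g x = x) → ∃ y : F, ‖x‖ = ‖y‖) : H = ⊤ := by
  have := isGalois_of_isAlgClosed F Ω
  set L := fixedField (H.comap (AlgEquiv.restrictNormalHom (K₁ := Ω) Q)) with hL
  have hLQ : L ≤ Q := fixedField_comap_le Q H
  have hfin : FiniteDimensional F L :=
    FiniteDimensional.of_injective (IntermediateField.inclusion hLQ).toLinearMap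
      (IntermediateField.inclusion hLQ).injective
  have h1 : L ≤ unramClosure p F Ω := h.le_unramClosure L fun x hx =>
    hH ⟨x, hLQ hx⟩ ((mem_fixedField_comap_iff Q (x := ⟨x, hLQ hx⟩)).1 hx)
  have h2 : L = ⊥ := by
    rw [eq_bot_iff]
    intro x hx
    exact h.mem_bot_of_frobenius_apply_eq hφ (h1 hx)
      ((IntermediateField.mem_fixedField_iff _ _).1 hx φ hφH)
  have h3 : H.comap (AlgEquiv.restrictNormalHom (K₁ := Ω) Q) = ⊤ := by
    rw [← fixingSubgroup_fixedField_comap Q H, ← hL, h2, IntermediateField.fixingSubgroup_bot]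
  rw [eq_top_iff]
  intro g _
  obtain ⟨a, rfl⟩ := AlgEquiv.restrictNormalHom_surjective (F := F) (E := Ω) (K₁ := Q) g
  have : a ∈ H.comap (AlgEquiv.restrictNormalHom (K₁ := Ω) Q) := h3 ▸ Subgroup.mem_top a
  exact this

end

/-- The projection onto the first factor of an internal direct product with a cyclic group. -/
theorem exists_projection_of_cyclic_complement {G : Type*} [CommGroup G] {N : Subgroup G} {φ : G}
    (hdisj : ∀ i : ℕ, φ ^ i ∈ N → φ ^ i = 1) (hex : ∀ g, ∃ i : ℕ, g * (φ ^ i)⁻¹ ∈ N) :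
    ∃ pr : G →* G, (∀ g, pr g ∈ N) ∧ (∀ g ∈ N, pr g = g) ∧ pr φ = 1 ∧
      ∀ g, ∃ i : ℕ, g = pr g * φ ^ i := by
  have huniq' : ∀ {a b : G} {i j : ℕ}, i ≤ j → a ∈ N → b ∈ N → a * φ ^ i = b * φ ^ j → a = b := by
    intro a b i j hij ha hb hab
    have h1 : b⁻¹ * a = φ ^ (j - i) := by
      obtain ⟨c, rfl⟩ := Nat.exists_eq_add_of_le hij
      rw [pow_add, mul_left_comm, mul_comm] at hab
      rw [Nat.add_sub_cancel_left, inv_mul_eq_iff_eq_mul]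
      exact mul_left_cancel hab
    have h2 := hdisj (j - i) (h1 ▸ mul_mem (inv_mem hb) ha)
    rw [h2, inv_mul_eq_one] at h1
    exact h1.symm
  have huniq : ∀ {a b : G} {i j : ℕ}, a ∈ N → b ∈ N → a * φ ^ i = b * φ ^ j → a = b := by
    intro a b i j ha hb hab
    rcases le_total i j with hij | hij
    · exact huniq' hij ha hb hab
    · exact (huniq' hij hb ha hab.symm).symm
  choose e he using hex
  have hdec : ∀ g, g = (g * (φ ^ e g)⁻¹) * φ ^ e g := fun g => (inv_mul_cancel_right _ _).symm
  refine ⟨⟨⟨fun g => g * (φ ^ e g)⁻¹, ?_⟩, ?_⟩, he, fun g hg => ?_, ?_, fun g => ⟨e g, hdec g⟩⟩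
  · refine huniq (i := e 1) (j := 0) (he 1) (one_mem N) ?_
    rw [← hdec, pow_zero, one_mul]
  · intro a b
    refine huniq (i := e (a * b)) (j := e a + e b) (he _) (mul_mem (he a) (he b)) ?_
    rw [← hdec, pow_add, mul_mul_mul_comm]
    exact congrArg₂ _ (hdec a) (hdec b)
  · refine huniq (i := e g) (j := 0) (he g) hg ?_
    exact (hdec g).symm.trans (by rw [pow_zero, mul_one])
  · refine huniq (i := e φ) (j := 1) (he φ) (one_mem N) ?_
    exact (hdec φ).symm.trans (by rw [pow_one, one_mul])

theorem index_range_powMonoidHom_congr {A B : Type*} [CommGroup A] [CommGroup B] (e : A ≃* B)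
    (n : ℕ) :
    (powMonoidHom n : A →* A).range.index = (powMonoidHom n : B →* B).range.index := by
  rw [← Subgroup.index_map_equiv _ e]
  congr 1
  ext b
  simp only [Subgroup.mem_map, MonoidHom.mem_range, powMonoidHom_apply]
  constructor
  · rintro ⟨_, ⟨a, rfl⟩, rfl⟩
    exact ⟨e a, (map_pow e a n).symm⟩
  · rintro ⟨b, rfl⟩
    refine ⟨_, ⟨e.symm b, rfl⟩, ?_⟩
    change e (e.symm b ^ n) = _
    rw [map_pow, e.apply_symm_apply]

theorem dvd_of_pow_sub_one_dvd_pow_sub_one {q r i : ℕ} (hq : 2 ≤ q)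
    (h : q ^ r - 1 ∣ q ^ i - 1) : r ∣ i := by
  have h1 := Nat.pow_sub_one_gcd_pow_sub_one q r i
  rw [Nat.gcd_eq_left h] at h1
  have h2 : q ^ r = q ^ r.gcd i := by
    have := Nat.pow_pos (n := r) (show 0 < q by lia)
    have := Nat.pow_pos (n := r.gcd i) (show 0 < q by lia)
    lia
  have h3 := Nat.pow_right_injective hq h2
  rw [h3]
  exact Nat.gcd_dvd_right r i

section

variable {F Ω : Type*} [NontriviallyNormedField F] [IsUltrametricDist F] [ProperSpace F]
  [NontriviallyNormedField Ω] [IsUltrametricDist Ω] [NormedAlgebra F Ω] [Algebra.IsAlgebraic F Ω]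
  [IsAlgClosed Ω] [CharZero Ω] {p q : ℕ} {ϖ : F}

theorem LocalParam.not_dvd_pow_sub_one (h : LocalParam p F ϖ q) {r : ℕ} (hr : 0 < r) :
    ¬ p ∣ q ^ r - 1 := by
  intro hd
  obtain ⟨s, hs, rfl⟩ := h.eq_pow
  have h1 : p ∣ (p ^ s) ^ r := dvd_pow (dvd_pow_self p hs) hr.ne'
  have h2 : 0 < (p ^ s) ^ r := Nat.pow_pos (Nat.pow_pos h.prime.pos)
  have h3 := (Nat.dvd_sub_iff_right h2 h1).1 hd
  exact h.prime.one_lt.ne' (Nat.dvd_one.1 h3)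

/-- The first inequality: the inertia group of an abelian extension containing enough roots of
unity is at most as large as the group of units modulo powers. -/
theorem LocalParam.relIndex_le_index (h : LocalParam p F ϖ q) {φ : Ω ≃ₐ[F] Ω}
    (hφ : IsFrobenius p q φ) (Q : IntermediateField F Ω) [FiniteDimensional F Q] [Normal F Q]
    {r n : ℕ} (hr : 0 < r) (hn : 0 < n) {ζ : Ω} (hζ : IsPrimitiveRoot ζ (q ^ r - 1))
    (hζQ : ζ ∈ Q) (hcomm : ∀ a b : Q ≃ₐ[F] Q, a * b = b * a) (hφr : φ ^ r ∈ Q.fixingSubgroup)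
    (hN : ∀ a ∈ F⟮ζ⟯.fixingSubgroup, a ^ n ∈ Q.fixingSubgroup)
    (hcard : Q.fixingSubgroup.relIndex F⟮ζ⟯.fixingSubgroup ∣ r)
    (hfin : (powMonoidHom n : normOneUnits F →* _).range.FiniteIndex) :
    Q.fixingSubgroup.relIndex F⟮ζ⟯.fixingSubgroup ≤
      (powMonoidHom n : normOneUnits F →* _).range.index := by
  have hgal := isGalois_of_isAlgClosed F Ω
  have hgalQ : IsGalois F Q := ⟨⟩
  let _ : CommGroup (Q ≃ₐ[F] Q) := { AlgEquiv.aut with mul_comm := hcomm }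
  have hproper : ProperSpace Q := FiniteDimensional.proper F Q
  have hq2 : 2 ≤ q := h.two_le
  have hnd := h.not_dvd_pow_sub_one hr
  have hk0 : q ^ r - 1 ≠ 0 := fun h0 => hnd (h0 ▸ dvd_zero p)
  let res : (Ω ≃ₐ[F] Ω) →* (Q ≃ₐ[F] Q) := AlgEquiv.restrictNormalHom Q
  have hres_surj : Function.Surjective res := AlgEquiv.restrictNormalHom_surjective _
  have hres : ∀ a (x : Q), ((res a x : Q) : Ω) = a x := coe_restrictNormalHom_apply Q
  have hker : res.ker = Q.fixingSubgroup := IntermediateField.restrictNormalHom_ker Q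
  have hfix : ∀ a : Ω ≃ₐ[F] Ω, a ∈ F⟮ζ⟯.fixingSubgroup ↔ a ζ = ζ := by
    intro a
    rw [IntermediateField.mem_fixingSubgroup_iff]
    refine ⟨fun ha => ha ζ (IntermediateField.mem_adjoin_simple_self F ζ), fun ha x hx => ?_⟩
    exact apply_eq_apply_of_mem_adjoin_simple (g := a) (g' := 1) ha hx
  set N : Subgroup (Q ≃ₐ[F] Q) := F⟮ζ⟯.fixingSubgroup.map res with hNdef
  have hQle : Q.fixingSubgroup ≤ F⟮ζ⟯.fixingSubgroup :=
    IntermediateField.fixingSubgroup_le (IntermediateField.adjoin_simple_le_iff.2 hζQ)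
  have hmemN : ∀ a, res a ∈ N ↔ a ζ = ζ := by
    intro a
    rw [← hfix]
    refine ⟨?_, fun ha => Subgroup.mem_map_of_mem _ ha⟩
    rintro ⟨b, hb, hab⟩
    have : a⁻¹ * b ∈ F⟮ζ⟯.fixingSubgroup := hQle (hker ▸ (by
      rw [MonoidHom.mem_ker, map_mul, map_inv, hab, inv_mul_cancel]))
    have h2 := mul_mem hb (inv_mem this)
    rwa [mul_inv_rev, inv_inv, mul_inv_cancel_left] at h2
  have hcardN : Nat.card N = Q.fixingSubgroup.relIndex F⟮ζ⟯.fixingSubgroup := by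
    rw [← hker, Subgroup.relIndex_ker]
  rw [← hcardN] at hcard ⊢
  have hpow : ∀ i : ℕ, (φ ^ i) ζ = ζ ^ q ^ i := hφ.pow_apply hnd hζ.pow_eq_one
  have hdvd : ∀ i : ℕ, (φ ^ i) ζ = ζ → r ∣ i := by
    intro i hi
    rw [hpow] at hi
    have hqi : 0 < q ^ i := Nat.pow_pos (by lia)
    refine dvd_of_pow_sub_one_dvd_pow_sub_one hq2 ((hζ.pow_eq_one_iff_dvd _).1 ?_)
    have h0 : ζ ≠ 0 := hζ.ne_zero hk0
    apply mul_right_cancel₀ h0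
    rw [one_mul, ← pow_succ, Nat.sub_add_cancel hqi, hi]
  have hφr1 : res φ ^ r = 1 := by
    rw [← map_pow, ← MonoidHom.mem_ker, hker]
    exact hφr
  have hone : ∀ i : ℕ, r ∣ i → res φ ^ i = 1 := by
    rintro _ ⟨j, rfl⟩
    rw [pow_mul, hφr1, one_pow]
  obtain ⟨pr, hpr_mem, hpr_of, hpr_frob, hpr_ex⟩ :=
    exists_projection_of_cyclic_complement (N := N) (φ := res φ)
      (fun i hi => by
        rw [← map_pow, hmemN] at hi
        exact hone i (hdvd i hi))
      (fun g => by
        obtain ⟨a, rfl⟩ := hres_surj g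
        obtain ⟨i, hi⟩ := h.exists_apply_eq_pow_pow hnd hζ.pow_eq_one a
        refine ⟨i, ?_⟩
        rw [mul_comm, ← map_pow, ← map_inv, ← map_mul, hmemN, AlgEquiv.mul_apply, hi, ← hpow,
          ← AlgEquiv.mul_apply, inv_mul_cancel, AlgEquiv.one_apply])
  have hfixall : ∀ x : Q, (∀ g : Q ≃ₐ[F] Q, g x = x) → ∃ y : F, algebraMap F Q y = x := fun x hx =>
    (InfiniteGalois.mem_range_algebraMap_iff_fixed x).2 hx
  have key : UnramifiedSplitting N (res φ) pr r n (algebraMap F Q ϖ) := by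
    refine ⟨?_, ?_, ?_, ?_, hpr_mem, hpr_of, hpr_frob, hpr_ex, ?_, hr, hcard, hn, ?_, ?_, ?_⟩
    · intro g x
      obtain ⟨a, rfl⟩ := hres_surj g
      change ‖((res a x : Q) : Ω)‖ = ‖(x : Ω)‖
      rw [hres, norm_algEquiv_apply]
    · intro g
      exact g.commutes ϖ
    · simpa using h.unif_ne_zero
    · rw [norm_algebraMap']
      exact h.norm_unif_lt_one
    · intro i
      refine ⟨fun hi => hdvd i ?_, hone i⟩
      rw [← hmemN, map_pow, hi]
      exact one_mem N
    · rintro g ⟨a, ha, rfl⟩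
      rw [← map_pow, ← MonoidHom.mem_ker, hker]
      exact hN a ha
    · rintro H hH _ ⟨u, hu, rfl⟩
      obtain ⟨y, hy, hxy⟩ := h.exists_norm_eq_of_unramified Q hnd hζ.pow_eq_one (H := H)
        (S := H ⊔ Subgroup.zpowers (res φ)) (by
          rintro a ⟨ha, haζ⟩
          have h1 : H ⊔ Subgroup.zpowers (res φ) ≤ H.comap pr := by
            refine sup_le (fun t ht => ?_) ?_
            · rw [Subgroup.mem_comap, hpr_of t (hH ht)]
              exact ht
            · rw [Subgroup.zpowers_le, Subgroup.mem_comap, hpr_frob]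
              exact one_mem _
          have h2 : pr (res a) ∈ H := h1 ha
          rw [hpr_of _ ((hmemN a).2 ((hfix a).1 haζ))] at h2
          exact h2) (x := (u : Q)) hu
      have hy0 : y ≠ 0 := by
        rw [← norm_ne_zero_iff, ← hxy, norm_ne_zero_iff]
        exact u.ne_zero
      refine ⟨Units.mk0 y hy0, hy, ?_⟩
      apply Units.ext
      rw [coe_unitsNorm, coe_unitsNorm, Units.val_mk0, hxy]
    · intro H hφH hH
      refine h.eq_top_of_frobenius_mem hφ Q hφH fun x hx => ?_
      by_cases hx0 : x = 0
      · exact ⟨0, by rw [hx0, norm_zero, norm_zero]⟩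
      obtain ⟨v, hv, hvx⟩ := hH ⟨Units.mk0 x hx0, hx, rfl⟩
      obtain ⟨y, hy⟩ := hfixall (v : Q) (fun g => hv g (Subgroup.mem_top g))
      refine ⟨y, ?_⟩
      have h1 := congrArg Units.val hvx
      rw [coe_unitsNorm, coe_unitsNorm, Units.val_mk0, ← hy, norm_algebraMap'] at h1
      exact h1.symm
  have e : normOneUnits F ≃* unitSphere Q (⊤ : Subgroup (Q ≃ₐ[F] Q)) := by
    refine MulEquiv.ofBijective (((Units.map (algebraMap F Q : F →* Q)).comp
      (normOneUnits F).subtype).codRestrict _ fun u => ?_) ⟨?_, ?_⟩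
    · rw [mem_unitSphere]
      refine ⟨fun g _ => g.commutes _, ?_⟩
      change ‖algebraMap F Q _‖ = 1
      rw [norm_algebraMap']
      exact u.2
    · intro u v huv
      apply Subtype.ext
      apply Units.ext
      have h1 := congrArg (fun z : unitSphere Q (⊤ : Subgroup (Q ≃ₐ[F] Q)) => ((z : Qˣ) : Q)) huv
      exact (algebraMap F Q).injective h1
    · rintro ⟨v, hv⟩
      rw [mem_unitSphere] at hv
      obtain ⟨y, hy⟩ := hfixall (v : Q) (fun g => hv.1 g (Subgroup.mem_top g))
      have hy1 : ‖y‖ = 1 := by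
        rw [← hv.2, ← hy, norm_algebraMap']
      have hy0 : y ≠ 0 := by
        rw [← norm_ne_zero_iff, hy1]
        exact one_ne_zero
      refine ⟨⟨Units.mk0 y hy0, hy1⟩, ?_⟩
      apply Subtype.ext
      apply Units.ext
      exact hy
  rw [index_range_powMonoidHom_congr e n]
  refine key.card_le_index ?_ ?_
  · intro x hx
    obtain ⟨y, hy⟩ := hfixall (x : Q) (fun g => hx g (Subgroup.mem_top g))
    have hy0 : y ≠ 0 := by
      rintro rfl
      rw [map_zero] at hy
      exact x.ne_zero hy.symm
    obtain ⟨k, hk⟩ := h.norm_eq_zpow y hy0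
    refine ⟨k, ?_⟩
    rw [← hy, norm_algebraMap', norm_algebraMap', hk]
  · refine ⟨?_⟩
    rw [← index_range_powMonoidHom_congr e n]
    exact hfin.index_ne_zero

end

section

variable {F : Type*} [NontriviallyNormedField F] [IsUltrametricDist F] [ProperSpace F] [CharZero F]

/-- The `n`-th powers form an open subgroup of the units. -/
theorem exists_mem_range_powMonoidHom_of_norm_sub_lt {n : ℕ} (hn : n ≠ 0) :
    ∃ ε > 0, ∀ u : normOneUnits F, ‖((u : Fˣ) : F) - 1‖ < ε →
      u ∈ (powMonoidHom n : normOneUnits F →* _).range := by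
  have h1 : HasStrictDerivAt (fun x : F => x ^ n) ((n : F) * 1 ^ (n - 1)) 1 :=
    hasStrictDerivAt_pow n 1
  have h2 := h1.map_nhds_eq (by simpa using hn)
  rw [one_pow] at h2
  have h3 : (fun x : F => x ^ n) '' Set.univ ∈ nhds (1 : F) := by
    rw [← h2]
    exact Filter.image_mem_map Filter.univ_mem
  obtain ⟨ε, hε, hball⟩ := Metric.mem_nhds_iff.1 h3
  refine ⟨ε, hε, fun u hu => ?_⟩
  obtain ⟨x, -, hx⟩ := hball (by rwa [Metric.mem_ball, dist_eq_norm])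
  have hx' : x ^ n = ((u : Fˣ) : F) := hx
  have hx1 : ‖x‖ = 1 := by
    rw [← pow_eq_one_iff_of_nonneg (norm_nonneg x) hn, ← norm_pow, hx']
    exact u.2
  have hx0 : x ≠ 0 := by
    rw [← norm_ne_zero_iff, hx1]
    exact one_ne_zero
  refine ⟨⟨Units.mk0 x hx0, hx1⟩, ?_⟩
  apply Subtype.ext
  apply Units.ext
  exact hx'

theorem finiteIndex_range_powMonoidHom {n : ℕ} (hn : n ≠ 0) :
    (powMonoidHom n : normOneUnits F →* _).range.FiniteIndex := by
  obtain ⟨ε, hε, hU⟩ := exists_mem_range_powMonoidHom_of_norm_sub_lt (F := F) hn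
  obtain ⟨t, ht, hcov⟩ := Metric.totallyBounded_iff.1
    (isCompact_closedBall (0 : F) 1).totallyBounded ε hε
  have h1 : ∀ u : normOneUnits F, ∃ y : t, ‖((u : Fˣ) : F) - y‖ < ε := by
    intro u
    have h2 : ((u : Fˣ) : F) ∈ Metric.closedBall (0 : F) 1 := by
      rw [mem_closedBall_zero_iff]
      exact le_of_eq u.2
    obtain ⟨y, hy, hyu⟩ := Set.mem_iUnion₂.1 (hcov h2)
    exact ⟨⟨y, hy⟩, by rwa [Metric.mem_ball, dist_eq_norm] at hyu⟩
  choose c hc using h1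
  have : Finite t := ht
  have : Finite (normOneUnits F ⧸ (powMonoidHom n : normOneUnits F →* _).range) := by
    refine Finite.of_injective (fun x => c (Quotient.out x)) fun x y hxy => ?_
    rw [← Quotient.out_eq x, ← Quotient.out_eq y]
    refine QuotientGroup.eq.2 (hU _ ?_)
    generalize hu : Quotient.out x = u at *
    generalize hv : Quotient.out y = v at *
    have hxy' : c u = c v := by simpa [hu, hv] using hxy
    have h3 : ((u⁻¹ * v : normOneUnits F) : Fˣ) = (u : Fˣ)⁻¹ * (v : Fˣ) := rfl
    have h4 : (((u⁻¹ * v : normOneUnits F) : Fˣ) : F) - 1 =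
        (((u : Fˣ)⁻¹ : Fˣ) : F) * (((v : Fˣ) : F) - ((u : Fˣ) : F)) := by
      rw [h3, mul_sub, Units.val_mul, Units.inv_mul]
    have h5 : ‖(((u : Fˣ)⁻¹ : Fˣ) : F)‖ = 1 := (u⁻¹).2
    rw [h4, norm_mul, h5, one_mul, ← sub_sub_sub_cancel_right _ _ ((c u : t) : F)]
    refine (norm_sub_le_max_norm _ _).trans_lt (max_lt ?_ (hc u))
    rw [hxy']
    exact hc v
  exact Subgroup.finiteIndex_of_finite_quotient

end

theorem normal_of_commutator_mem {G : Type*} [Group G] {H : Subgroup G}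
    (hH : ∀ a b : G, a * b * a⁻¹ * b⁻¹ ∈ H) : H.Normal := by
  refine ⟨fun n hn g => ?_⟩
  have h1 := mul_mem (hH g n) hn
  rwa [inv_mul_cancel_right] at h1

section

variable {F Ω : Type*} [NontriviallyNormedField F] [IsUltrametricDist F] [ProperSpace F]
  [NontriviallyNormedField Ω] [IsUltrametricDist Ω] [NormedAlgebra F Ω] [Algebra.IsAlgebraic F Ω]
  [IsAlgClosed Ω] [CharZero Ω] {p q : ℕ} {ϖ : F}

/-- An element of the inertia group in the kernel of the Lubin–Tate character acts trivially on
every finite abelian extension. -/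
theorem LocalParam.mem_of_character_eq_one (h : LocalParam p F ϖ q)
    {ρ : (Ω ≃ₐ[F] Ω) →* normOneUnits F}
    (hcont : ∀ n : ℕ, ∃ x : Ω, ∀ g, g x = x → ‖((ρ g : Fˣ) : F) - 1‖ ≤ ‖ϖ‖ ^ (n + 1))
    (hsurj : ∀ u, ∃ g ∈ (unramClosure p F Ω).fixingSubgroup, ρ g = u)
    {V₀ : Subgroup (Ω ≃ₐ[F] Ω)} (hopen : IsOpen (V₀ : Set (Ω ≃ₐ[F] Ω)))
    (hcomm : ∀ a b, a * b * a⁻¹ * b⁻¹ ∈ V₀) {g : Ω ≃ₐ[F] Ω}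
    (hg : g ∈ (unramClosure p F Ω).fixingSubgroup) (hρg : ρ g = 1) : g ∈ V₀ := by
  have hgal := isGalois_of_isAlgClosed F Ω
  have hchar : CharZero F := (algebraMap F Ω).charZero_iff (algebraMap F Ω).injective |>.2
    inferInstance
  have hindex : ∀ {V : Subgroup (Ω ≃ₐ[F] Ω)}, IsOpen (V : Set (Ω ≃ₐ[F] Ω)) → 0 < V.index := by
    intro V hV
    have := V.quotient_finite_of_isOpen hV
    exact Nat.pos_of_ne_zero Subgroup.index_ne_zero_of_finite
  have hpowmem : ∀ {V : Subgroup (Ω ≃ₐ[F] Ω)}, (∀ a b, a * b * a⁻¹ * b⁻¹ ∈ V) →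
      ∀ a, a ^ V.index ∈ V := by
    intro V hV a
    have := normal_of_commutator_mem hV
    exact Subgroup.pow_index_mem V a
  set n := V₀.index with hn
  have hn0 : 0 < n := hindex hopen
  set R := (powMonoidHom n : normOneUnits F →* _).range with hR
  have hRfin : R.FiniteIndex := finiteIndex_range_powMonoidHom hn0.ne'
  set W : Subgroup (Ω ≃ₐ[F] Ω) := R.comap ρ with hW
  have hWcomm : ∀ a b, a * b * a⁻¹ * b⁻¹ ∈ W := by
    intro a b
    rw [hW, Subgroup.mem_comap, map_mul, map_mul, map_mul, map_inv, map_inv,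
      mul_inv_cancel_comm, mul_inv_cancel]
    exact one_mem R
  have hWopen : IsOpen (W : Set (Ω ≃ₐ[F] Ω)) := by
    obtain ⟨ε, hε, hU⟩ := exists_mem_range_powMonoidHom_of_norm_sub_lt (F := F) hn0.ne'
    obtain ⟨m, hm⟩ := exists_pow_lt_of_lt_one hε h.norm_unif_lt_one
    obtain ⟨x, hx⟩ := hcont m
    have hfd : FiniteDimensional F F⟮x⟯ :=
      IntermediateField.adjoin.finiteDimensional (Algebra.IsIntegral.isIntegral x)
    refine Subgroup.isOpen_mono (fun a ha => ?_) (IntermediateField.fixingSubgroup_isOpen F⟮x⟯)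
    refine hU _ ((hx a ?_).trans_lt (lt_of_le_of_lt ?_ hm))
    · exact (IntermediateField.mem_fixingSubgroup_iff _ _).1 ha x
        (IntermediateField.mem_adjoin_simple_self F x)
    · exact pow_le_pow_of_le_one (norm_nonneg _) h.norm_unif_lt_one.le (Nat.le_succ m)
  set V := V₀ ⊓ W with hV
  have hVopen : IsOpen (V : Set (Ω ≃ₐ[F] Ω)) := hopen.inter hWopen
  have hVcomm : ∀ a b, a * b * a⁻¹ * b⁻¹ ∈ V := fun a b => ⟨hcomm a b, hWcomm a b⟩
  have hVn : ∀ a, a ^ n ∈ V := fun a => ⟨hpowmem hcomm a, by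
    change ρ (a ^ n) ∈ R
    rw [map_pow]
    exact ⟨ρ a, rfl⟩⟩
  set r := V.index with hr
  have hr0 : 0 < r := hindex hVopen
  have hnd := h.not_dvd_pow_sub_one hr0
  have hk0 : q ^ r - 1 ≠ 0 := fun h0 => hnd (h0 ▸ dvd_zero p)
  obtain ⟨ζ, hζ⟩ : ∃ ζ : Ω, IsPrimitiveRoot ζ (q ^ r - 1) := by
    have : NeZero (q ^ r - 1) := ⟨hk0⟩
    exact HasEnoughRootsOfUnity.exists_primitiveRoot Ω _
  obtain ⟨φ, hφ⟩ := h.exists_frobenius (Ω := Ω)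
  have hφ : IsFrobenius p q φ := hφ
  set N := F⟮ζ⟯.fixingSubgroup with hN
  have hfix : ∀ a : Ω ≃ₐ[F] Ω, a ∈ N ↔ a ζ = ζ := by
    intro a
    rw [hN, IntermediateField.mem_fixingSubgroup_iff]
    refine ⟨fun ha => ha ζ (IntermediateField.mem_adjoin_simple_self F ζ), fun ha x hx => ?_⟩
    exact apply_eq_apply_of_mem_adjoin_simple (g := a) (g' := 1) ha hx
  have hNcomm : ∀ a b, a * b * a⁻¹ * b⁻¹ ∈ N := by
    intro a b
    have hab : ∀ a b : Ω ≃ₐ[F] Ω, (a * b) ζ = (b * a) ζ := by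
      intro a b
      obtain ⟨i, hi⟩ := h.exists_apply_eq_pow_pow hnd hζ.pow_eq_one a
      obtain ⟨j, hj⟩ := h.exists_apply_eq_pow_pow hnd hζ.pow_eq_one b
      rw [AlgEquiv.mul_apply, AlgEquiv.mul_apply, hi, hj, map_pow, map_pow, hi, hj, ← pow_mul,
        ← pow_mul, mul_comm]
    have h1 : a * b * a⁻¹ * b⁻¹ = (b⁻¹ * a⁻¹)⁻¹ * (a⁻¹ * b⁻¹) := by group
    rw [hfix, h1, AlgEquiv.mul_apply, hab, ← AlgEquiv.mul_apply, inv_mul_cancel,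
      AlgEquiv.one_apply]
  have hNopen : IsOpen (N : Set (Ω ≃ₐ[F] Ω)) := by
    have hfd : FiniteDimensional F F⟮ζ⟯ :=
      IntermediateField.adjoin.finiteDimensional (Algebra.IsIntegral.isIntegral ζ)
    exact IntermediateField.fixingSubgroup_isOpen F⟮ζ⟯
  set V' := V ⊓ N with hV'
  have hV'comm : ∀ a b, a * b * a⁻¹ * b⁻¹ ∈ V' := fun a b => ⟨hVcomm a b, hNcomm a b⟩
  have hV'open : IsOpen (V' : Set (Ω ≃ₐ[F] Ω)) := hVopen.inter hNopen
  have hV'normal : V'.Normal := normal_of_commutator_mem hV'comm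
  obtain ⟨Q, hQ⟩ : ∃ Q : IntermediateField F Ω, Q.fixingSubgroup = V' :=
    ⟨_, InfiniteGalois.fixingSubgroup_fixedField ⟨V', Subgroup.isClosed_of_isOpen _ hV'open⟩⟩
  have hQfin : FiniteDimensional F Q := by
    rw [← InfiniteGalois.isOpen_iff_finite, hQ]
    exact hV'open
  have hQgal : IsGalois F Q := by
    rw [← InfiniteGalois.normal_iff_isGalois, hQ]
    exact hV'normal
  have hζQ : ζ ∈ Q := by
    rw [← InfiniteGalois.fixedField_fixingSubgroup Q, hQ, IntermediateField.mem_fixedField_iff]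
    exact fun a ha => (hfix a).1 ha.2
  have hVnormal : V.Normal := normal_of_commutator_mem hVcomm
  have hle : V'.relIndex N ≤ R.index := by
    rw [← hQ]
    refine h.relIndex_le_index hφ Q hr0 hn0 hζ hζQ (fun a b => ?_) ?_ (fun a ha => ?_) ?_ hRfin
    · obtain ⟨a, rfl⟩ := AlgEquiv.restrictNormalHom_surjective (F := F) (E := Ω) (K₁ := Q) a
      obtain ⟨b, rfl⟩ := AlgEquiv.restrictNormalHom_surjective (F := F) (E := Ω) (K₁ := Q) b
      have h1 := hV'comm a b
      rw [← hQ, ← IntermediateField.restrictNormalHom_ker, MonoidHom.mem_ker, map_mul, map_mul,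
        map_mul, map_inv, map_inv, mul_inv_eq_one, mul_inv_eq_iff_eq_mul] at h1
      exact h1
    · rw [hQ]
      refine ⟨hpowmem hVcomm φ, ?_⟩
      change _ ∈ N
      have hqr : 0 < q ^ r := Nat.pow_pos (lt_of_lt_of_le two_pos h.two_le)
      have hζr : ζ ^ (q ^ r - 1 + 1) = ζ := by rw [pow_succ, hζ.pow_eq_one, one_mul]
      rw [hfix, hφ.pow_apply hnd hζ.pow_eq_one, ← Nat.sub_add_cancel hqr]
      exact hζr
    · rw [hQ]
      exact ⟨hVn a, pow_mem ha n⟩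
    · rw [hQ, hV', Subgroup.inf_relIndex_right]
      exact Subgroup.relIndex_dvd_index_of_normal V N
  have hIN : (unramClosure p F Ω).fixingSubgroup ≤ N :=
    IntermediateField.fixingSubgroup_le (adjoin_rootOfUnity_le_unramClosure hnd hζ.pow_eq_one)
  have hWN : (W ⊓ N).relIndex N = R.index := by
    have h1 : ((QuotientGroup.mk' R).comp ρ).ker = W := by
      rw [← MonoidHom.comap_ker, QuotientGroup.ker_mk']
    have h2 : N.map ((QuotientGroup.mk' R).comp ρ) = ⊤ := by
      rw [eq_top_iff]
      rintro x -
      obtain ⟨u, rfl⟩ := QuotientGroup.mk'_surjective R x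
      obtain ⟨a, ha, rfl⟩ := hsurj u
      exact ⟨a, hIN ha, rfl⟩
    rw [Subgroup.inf_relIndex_right, ← h1, Subgroup.relIndex_ker, h2, Subgroup.card_top]
    rfl
  have hV'W : V' ≤ W ⊓ N := inf_le_inf_right N inf_le_right
  have hmul := Subgroup.relIndex_mul_relIndex V' (W ⊓ N) N hV'W inf_le_right
  rw [hWN] at hmul
  have hR0 : 0 < R.index := Nat.pos_of_ne_zero hRfin.index_ne_zero
  have hfin : V'.relIndex (W ⊓ N) ≠ 0 := by
    intro h0
    have h1 := Subgroup.relIndex_dvd_index_of_normal V' (W ⊓ N)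
    rw [h0, zero_dvd_iff] at h1
    exact (hindex hV'open).ne' h1
  have hone : V'.relIndex (W ⊓ N) = 1 := by
    rw [← hmul] at hle
    have := Nat.le_of_mul_le_mul_right (hle.trans_eq (one_mul _).symm) hR0
    lia
  have hgW : g ∈ W ⊓ N := by
    refine ⟨?_, hIN hg⟩
    change ρ g ∈ R
    rw [hρg]
    exact one_mem R
  exact (Subgroup.relIndex_eq_one.1 hone hgW).1.1

end

/-- An element of a profinite group lying in every open subgroup with abelian quotient lies in the
closure of the commutator subgroup. -/
theorem mem_topologicalClosure_commutator {G : Type*} [Group G] [TopologicalSpace G]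
    [IsTopologicalGroup G] [CompactSpace G] [TotallyDisconnectedSpace G] {g : G}
    (hg : ∀ V : Subgroup G, IsOpen (V : Set G) → (∀ a b, a * b * a⁻¹ * b⁻¹ ∈ V) → g ∈ V) :
    g ∈ (commutator G).topologicalClosure := by
  by_contra hgC
  have hcl : IsClosed ((commutator G).topologicalClosure : Set G) :=
    Subgroup.isClosed_topologicalClosure _
  have hU : IsOpen ((fun x => g * x) ⁻¹' ((commutator G).topologicalClosure : Set G)ᶜ) :=
    hcl.isOpen_compl.preimage (continuous_const_mul g)
  obtain ⟨H, hH⟩ := ProfiniteGrp.exist_openNormalSubgroup_sub_open_nhds_of_one hU (by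
    change g * 1 ∉ (commutator G).topologicalClosure
    rwa [mul_one])
  have hnormal : H.toSubgroup.Normal := H.isNormal'
  have h1 : g ∈ commutator G ⊔ H.toSubgroup := by
    refine hg _ (Subgroup.isOpen_mono le_sup_right H.isOpen') fun a b => ?_
    exact Subgroup.mem_sup_left (Subgroup.commutator_mem_commutator (Subgroup.mem_top a)
      (Subgroup.mem_top b))
  obtain ⟨c, hc, w, hw, hcw⟩ := Subgroup.mem_sup_of_normal_right.1 h1
  have h2 : g * w⁻¹ ∉ (commutator G).topologicalClosure := hH (inv_mem hw)
  rw [← hcw, mul_inv_cancel_right] at h2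
  exact h2 (Subgroup.le_topologicalClosure _ hc)

section

variable {F Ω : Type*} [NontriviallyNormedField F] [IsUltrametricDist F] [ProperSpace F]
  [NontriviallyNormedField Ω] [IsUltrametricDist Ω] [NormedAlgebra F Ω] [Algebra.IsAlgebraic F Ω]
  [IsAlgClosed Ω] [CharZero Ω] {p q : ℕ} {ϖ : F}

/-- The Lubin–Tate character identifies the inertia subgroup of the abelianized Galois group with
the group of units. -/
theorem LocalParam.exists_abelianized_character (h : LocalParam p F ϖ q) :
    ∃ ρ : (Ω ≃ₐ[F] Ω) →* normOneUnits F,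
      (∀ g ∈ (commutator (Ω ≃ₐ[F] Ω)).topologicalClosure, ρ g = 1) ∧
      (∀ g ∈ (unramClosure p F Ω).fixingSubgroup, ρ g = 1 →
        g ∈ (commutator (Ω ≃ₐ[F] Ω)).topologicalClosure) ∧
      ∀ u, ∃ g ∈ (unramClosure p F Ω).fixingSubgroup, ρ g = u := by
  have hgal := isGalois_of_isAlgClosed F Ω
  obtain ⟨ρ, hcont, hsurj⟩ := h.exists_inertia_character (Ω := Ω)
  refine ⟨ρ, fun g hg => ?_, fun g hg hρ => mem_topologicalClosure_commutator fun V hV hcomm =>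
    h.mem_of_character_eq_one hcont hsurj hV hcomm hg hρ, hsurj⟩
  have h1 : ∀ n : ℕ, ‖((ρ g : Fˣ) : F) - 1‖ ≤ ‖ϖ‖ ^ (n + 1) := by
    intro n
    obtain ⟨x, hx⟩ := hcont n
    obtain ⟨c, hcx, hc⟩ := mem_closure_iff.1 hg _ (isOpen_setOf_apply_eq x (g x)) rfl
    have hcx' : c x = g x := hcx
    have hρc : ρ c = 1 := Abelianization.commutator_subset_ker ρ hc
    have h2 := hx (c⁻¹ * g) (by
      rw [AlgEquiv.mul_apply, ← hcx', ← AlgEquiv.mul_apply, inv_mul_cancel, AlgEquiv.one_apply])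
    rwa [map_mul, map_inv, hρc, inv_one, one_mul] at h2
  have h2 : Filter.Tendsto (fun n : ℕ => ‖ϖ‖ ^ (n + 1)) Filter.atTop (nhds 0) :=
    (tendsto_pow_atTop_nhds_zero_of_lt_one (norm_nonneg ϖ) h.norm_unif_lt_one).comp
      (Filter.tendsto_add_atTop_nat 1)
  have h3 : ‖((ρ g : Fˣ) : F) - 1‖ ≤ 0 := ge_of_tendsto' h2 h1
  exact Subtype.ext (Units.ext (sub_eq_zero.1 (norm_le_zero_iff.1 h3)))

end

/-- The fibre product of an extension of `G ⧸ J` with `ℤ`, when `J` is the group of units. -/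
theorem exists_mulEquiv_fibreProduct {F : Type*} [NormedField F] {ϖ : F} (h0 : ϖ ≠ 0)
    (h1 : ‖ϖ‖ < 1) (hz : ∀ x : F, x ≠ 0 → ∃ k : ℤ, ‖x‖ = ‖ϖ‖ ^ k) {G : Type*} [CommGroup G]
    {J : Subgroup G} (ρ : G →* normOneUnits F) (hinj : ∀ g ∈ J, ρ g = 1 → g = 1)
    (hsurj : ∀ u, ∃ g ∈ J, ρ g = u) (φ : G ⧸ J) (S : Subgroup (G × Multiplicative ℤ))
    (hS : ∀ x, x ∈ S ↔ (QuotientGroup.mk x.1 : G ⧸ J) = φ ^ (Multiplicative.toAdd x.2)) :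
    Nonempty (Fˣ ≃* S) := by
  obtain ⟨σ, rfl⟩ := QuotientGroup.mk_surjective φ
  let f : G × Multiplicative ℤ →* Fˣ :=
    { toFun := fun x => (ρ (x.1 * (σ ^ (Multiplicative.toAdd x.2))⁻¹) : Fˣ) *
        Units.mk0 ϖ h0 ^ (Multiplicative.toAdd x.2)
      map_one' := by simp
      map_mul' := fun x y => by
        have h2 : (x * y).1 * (σ ^ (Multiplicative.toAdd (x * y).2))⁻¹ =
            (x.1 * (σ ^ (Multiplicative.toAdd x.2))⁻¹) *
              (y.1 * (σ ^ (Multiplicative.toAdd y.2))⁻¹) := by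
          rw [Prod.fst_mul, Prod.snd_mul, toAdd_mul, zpow_add, mul_inv, mul_mul_mul_comm]
        rw [h2, map_mul, Subgroup.coe_mul, Prod.snd_mul, toAdd_mul, zpow_add, mul_mul_mul_comm] }
  have hf : ∀ x, f x = (ρ (x.1 * (σ ^ (Multiplicative.toAdd x.2))⁻¹) : Fˣ) *
        Units.mk0 ϖ h0 ^ (Multiplicative.toAdd x.2) := fun x => rfl
  have hmem : ∀ x, x ∈ S ↔ x.1 * (σ ^ (Multiplicative.toAdd x.2))⁻¹ ∈ J := by
    intro x
    rw [hS, ← QuotientGroup.mk_zpow, eq_comm, QuotientGroup.eq, mul_comm]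
  refine ⟨(MulEquiv.ofBijective (f.comp S.subtype) ⟨?_, ?_⟩).symm⟩
  · rw [injective_iff_map_eq_one]
    rintro ⟨⟨a, k⟩, hx⟩ hx1
    have hx2 : (ρ (a * (σ ^ (Multiplicative.toAdd k))⁻¹) : Fˣ) *
        Units.mk0 ϖ h0 ^ (Multiplicative.toAdd k) = 1 := hx1
    have hk : Multiplicative.toAdd k = 0 := by
      have h2 := congrArg (fun u : Fˣ => ‖(u : F)‖) hx2
      simp only [Units.val_mul, Units.val_zpow_eq_zpow_val, Units.val_mk0, norm_mul, norm_zpow,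
        Units.val_one, norm_one] at h2
      rw [show ‖((ρ (a * (σ ^ (Multiplicative.toAdd k))⁻¹) : Fˣ) : F)‖ = 1 from
        (ρ (a * (σ ^ (Multiplicative.toAdd k))⁻¹)).2, one_mul] at h2
      exact (zpow_eq_one_iff_right₀ (norm_nonneg _) h1.ne).1 h2
    have hxJ : a * (σ ^ (Multiplicative.toAdd k))⁻¹ ∈ J := (hmem _).1 hx
    rw [hk, zpow_zero, zpow_zero, inv_one, mul_one, mul_one] at hx2
    rw [hk, zpow_zero, inv_one, mul_one] at hxJ
    have ha : a = 1 := hinj _ hxJ (Subtype.ext hx2)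
    exact Subtype.ext (Prod.ext ha (Multiplicative.toAdd.injective hk))
  · intro x
    obtain ⟨k, hk⟩ := hz x x.ne_zero
    have hn : ‖((x * (Units.mk0 ϖ h0 ^ k)⁻¹ : Fˣ) : F)‖ = 1 := by
      rw [Units.val_mul, Units.val_inv_eq_inv_val, Units.val_zpow_eq_zpow_val, Units.val_mk0,
        norm_mul, norm_inv, norm_zpow, hk]
      exact mul_inv_cancel₀ (zpow_ne_zero _ (norm_ne_zero_iff.2 h0))
    obtain ⟨g, hg, hgu⟩ := hsurj ⟨_, hn⟩
    refine ⟨⟨(g * σ ^ k, Multiplicative.ofAdd k), (hmem _).2 ?_⟩, ?_⟩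
    · change g * σ ^ k * (σ ^ k)⁻¹ ∈ J
      rwa [mul_inv_cancel_right]
    · change (ρ (g * σ ^ k * (σ ^ k)⁻¹) : Fˣ) * Units.mk0 ϖ h0 ^ k = x
      rw [mul_inv_cancel_right, hgu]
      exact inv_mul_cancel_right _ _

/-- The unit group of a nonarchimedean local field as a fibre product. -/
theorem nonempty_units_mulEquiv_fibreProd {p : ℕ} [Fact p.Prime] (F : Type*)
    [NontriviallyNormedField F] [IsUltrametricDist F] [ProperSpace F] [CharZero F]
    (hpn : ‖(p : F)‖ < 1) (φ : GunrK p F) :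
    Nonempty (Fˣ ≃* ↥(fibreProd p F φ)) := by
  let Ω := AlgebraicClosure F
  let : NontriviallyNormedField Ω := spectralNorm.nontriviallyNormedField F Ω
  let : NormedAlgebra F Ω := spectralNorm.normedAlgebra F Ω
  have : IsUltrametricDist Ω := IsUltrametricDist.isUltrametricDist_of_isNonarchimedean_norm
    (isNonarchimedean_spectralNorm (K := F) (L := Ω))
  obtain ⟨ϖ, q, h⟩ := exists_localParam (p := p) Fact.out F hpn
  obtain ⟨ρ, hρ, hinj, hsurj⟩ := h.exists_abelianized_character (Ω := Ω)
  refine exists_mulEquiv_fibreProduct h.unif_ne_zero h.norm_unif_lt_one h.norm_eq_zpow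
    (J := inertiaAb p F) (QuotientGroup.lift _ ρ hρ) ?_ ?_ φ (fibreProd p F φ) fun x => Iff.rfl
  · rintro _ ⟨g, hg, rfl⟩ hg1
    exact (QuotientGroup.eq_one_iff g).2 (hinj g hg hg1)
  · intro u
    obtain ⟨g, hg, rfl⟩ := hsurj u
    exact ⟨_, ⟨g, hg, rfl⟩, rfl⟩

/-- Let `K` be a finite extension of `ℚ_p`.  For any topological generator `φ` of the
unramified quotient `G_K^{unr} = G_K^{ab}/I_K` (e.g. the Frobenius element), the
multiplicative group `K^×` is isomorphic to the fibre product
`G_K^{ab} ×_{G_K^{unr}} φ^ℤ` of `G_K^{ab}` and the discrete subgroup generated by `φ`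
over `G_K^{unr}`. -/
theorem units_iso_fibre_product (φ : GunrK p K)
    (hφ : (Subgroup.zpowers φ).topologicalClosure = ⊤) :
    Nonempty (Kˣ ≃* ↥(fibreProd p K φ)) := by
  let : NontriviallyNormedField K := spectralNorm.nontriviallyNormedField ℚ_[p] K
  let : NormedAlgebra ℚ_[p] K := spectralNorm.normedAlgebra ℚ_[p] K
  have : IsUltrametricDist K := IsUltrametricDist.isUltrametricDist_of_isNonarchimedean_norm
    (isNonarchimedean_spectralNorm (K := ℚ_[p]) (L := K))
  have : ProperSpace K := FiniteDimensional.proper ℚ_[p] K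
  have : CharZero K := charZero_of_injective_algebraMap (algebraMap ℚ_[p] K).injective
  have hpn : ‖(p : K)‖ < 1 := by
    rw [← map_natCast (algebraMap ℚ_[p] K), norm_algebraMap']
    exact Padic.norm_p_lt_one
  exact nonempty_units_mulEquiv_fibreProd K hpn φ

end
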